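/- arXiv:1501.04814 — 2 statements merged into one kernel-verified Lean document; each statement's English description precedes it below -/
import Mathlib

section
/- Finiteness criterion for the upper quantization coefficient of Markov-type measures: In the setting of the ratio-specified Mauldin–Williams construction with N ≥ 2, row-stochastic matrix (p_ij) satisfying (A1) (each row has at least two positive entries) and separation condition (A2), let μ be the Markov-type measure with μ(J_σ) = χ_{σ₁} p_{σ₁σ₂} ⋯ p_{σ_{k−1}σ_k}, fix r ∈ (0,∞), and let s_r be the unique positive number such that the spectral radius of the matrix ((p_ij c_ij^r)^{s_r/(s_r+r)})_{1≤i,j≤N} equals 1. Let G be the directed graph on vertices {1,…,N} with an edge from i to j iff p_ij > 0; for each strongly connected component H of G, let s_r(H) be the unique positive number such that the spectral radius of the submatrix ((p_ij c_ij^r)^{s_r(H)/(s_r(H)+r)})_{i,j∈H} equals 1, and let M := { H ∈ SC(G) : s_r(H) = s_r }. Then Q̄_r^{s_r}(μ) < ∞ if and only if the elements of M are pairwise incomparable (where H₁ ≺ H₂ means there is a directed path from a vertex of H₁ to a vertex of H₂, and H₁, H₂ are incomparable if neither H₁ ≺ H₂ nor H₂ ≺ H₁); and if M contains two comparable elements then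 Q̲_r^{s_r}(μ) = ∞. -/
open MeasureTheory Filter Metric
open scoped ENNReal NNReal

/-- The `n`-th quantization error of order `r` for a measure `P`:
`e_{n,r}(P) = inf { (∫ d(x,α)^r dP)^{1/r} : α ⊆ E, 1 ≤ card α ≤ n }`. -/
noncomputable def quantError {E : Type*} [MetricSpace E] [MeasurableSpace E]
    (P : Measure E) (r : ℝ) (n : ℕ) : ℝ :=
  sInf {e : ℝ | ∃ α : Finset E, 1 ≤ α.card ∧ α.card ≤ n ∧
    e = (∫ x, infDist x (↑α : Set E) ^ r ∂P) ^ (1 / r)}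

/-- The upper quantization dimension of order `r`. -/
noncomputable def upperQuantDim {E : Type*} [MetricSpace E] [MeasurableSpace E]
    (P : Measure E) (r : ℝ) : ℝ :=
  limsup (fun n : ℕ => Real.log n / (- Real.log (quantError P r n))) atTop

/-- The lower quantization dimension of order `r`. -/
noncomputable def lowerQuantDim {E : Type*} [MetricSpace E] [MeasurableSpace E]
    (P : Measure E) (r : ℝ) : ℝ :=
  liminf (fun n : ℕ => Real.log n / (- Real.log (quantError P r n))) atTop

/-- The `s`-dimensional upper quantization coefficient of order `r`. -/
noncomputable def upperQuantCoeff {E : Type*} [MetricSpace E] [MeasurableSpace E]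
    (P : Measure E) (r s : ℝ) : ℝ≥0∞ :=
  limsup (fun n : ℕ => ENNReal.ofReal ((n : ℝ) ^ (1 / s) * quantError P r n)) atTop

/-- The `s`-dimensional lower quantization coefficient of order `r`. -/
noncomputable def lowerQuantCoeff {E : Type*} [MetricSpace E] [MeasurableSpace E]
    (P : Measure E) (r s : ℝ) : ℝ≥0∞ :=
  liminf (fun n : ℕ => ENNReal.ofReal ((n : ℝ) ^ (1 / s) * quantError P r n)) atTop

/-- A word `σ = σ₁…σ_k` is admissible when all transition probabilities along it are
positive (this also makes every word of length `≤ 1` admissible). -/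
def Adm {N : ℕ} (p : Fin N → Fin N → ℝ) (σ : List (Fin N)) : Prop :=
  List.Chain' (fun a b => 0 < p a b) σ

/-- The Markov mass `χ_{σ₁} p_{σ₁σ₂} ⋯ p_{σ_{k-1}σ_k}` of a cylinder word `σ`. -/
noncomputable def cylMass {N : ℕ} (χ : Fin N → ℝ) (p : Fin N → Fin N → ℝ) :
    List (Fin N) → ℝ
  | [] => 1
  | a :: l => χ a * (((a :: l).zip l).map (fun ab => p ab.1 ab.2)).prod

/-- Reachability in the directed graph on `{1,…,N}` with an edge `i → j` iff `p i j > 0`. -/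
def Reach {N : ℕ} (p : Fin N → Fin N → ℝ) : Fin N → Fin N → Prop :=
  Relation.ReflTransGen (fun a b => 0 < p a b)

/-- `H` is a strongly connected component of the directed graph associated with `p`:
it is the mutual-reachability class of one of the vertices. -/
def IsSCC {N : ℕ} (p : Fin N → Fin N → ℝ) (H : Finset (Fin N)) : Prop :=
  ∃ i : Fin N, ∀ j : Fin N, j ∈ H ↔ (Reach p i j ∧ Reach p j i)

/-- `H₁ ≺ H₂`: there is a directed path from a vertex of `H₁` to a vertex of `H₂`. -/
def Prec {N : ℕ} (p : Fin N → Fin N → ℝ) (H₁ H₂ : Finset (Fin N)) : Prop :=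
  ∃ i ∈ H₁, ∃ j ∈ H₂, Reach p i j

section MatrixPart
attribute [local instance] Matrix.linftyOpNormedRing Matrix.linftyOpNormedAlgebra

theorem growth_pow {ι : Type*} [Fintype ι] [DecidableEq ι] (A : Matrix ι ι ℝ)
    (hA : ∀ i j, 0 ≤ A i j) (κ : ℝ) (hκ : 0 < κ) (u : ι → ℝ)
    (hu2 : ∀ i, κ * u i ≤ ∑ j, A i j * u j) (n : ℕ) :
    ∀ i, κ ^ n * u i ≤ ((A ^ n).mulVec u) i := by
  induction n with
  | zero => intro i; simp
  | succ n ih =>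
    intro i
    rw [pow_succ' A, ← Matrix.mulVec_mulVec]
    calc κ ^ (n+1) * u i = κ ^ n * (κ * u i) := by ring
      _ ≤ κ ^ n * ∑ j, A i j * u j := by
        gcongr
        exact hu2 i
      _ = ∑ j, A i j * (κ ^ n * u j) := by
        rw [Finset.mul_sum]; exact Finset.sum_congr rfl (fun j _ => by ring)
      _ ≤ _ := by
        simp only [Matrix.mulVec, dotProduct]
        refine Finset.sum_le_sum (fun j _ => mul_le_mul_of_nonneg_left ?_ (hA i j))
        exact ih j

theorem spec_ge_of_growth {ι : Type*} [Fintype ι] [DecidableEq ι] (A : Matrix ι ι ℝ)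
    (hA : ∀ i j, 0 ≤ A i j) (κ : ℝ) (hκ : 0 < κ) (u : ι → ℝ) (hu0 : ∀ i, 0 ≤ u i)
    (hu1 : ∃ i, u i ≠ 0) (hu2 : ∀ i, κ * u i ≤ ∑ j, A i j * u j) :
    ENNReal.ofReal κ ≤ spectralRadius ℂ (Matrix.of fun i j => ((A i j : ℝ) : ℂ)) := by
  set Ac : Matrix ι ι ℂ := Matrix.of fun i j => ((A i j : ℝ) : ℂ) with hAc
  have hmap : Ac = A.map (algebraMap ℝ ℂ) := by ext i j; simp [hAc]
  have hne : Nonempty ι := ⟨hu1.choose⟩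
  obtain ⟨i0, hi0⟩ := Finite.exists_max u
  have hpos : 0 < u i0 := by
    obtain ⟨i, hi⟩ := hu1
    exact lt_of_lt_of_le (lt_of_le_of_ne (hu0 i) (Ne.symm hi)) (hi0 i)
  have key : ∀ n : ℕ, κ ^ n ≤ ‖Ac ^ n‖ := by
    intro n
    have h1 := growth_pow A hA κ hκ u hu2 n i0
    have h2 : ((Ac ^ n).mulVec (fun i => (u i : ℂ))) i0 = (((A ^ n).mulVec u) i0 : ℝ) := by
      rw [hmap, ← Matrix.map_pow]
      simp [Matrix.mulVec, dotProduct]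
    have h3 : ‖((Ac ^ n).mulVec (fun i => (u i : ℂ))) i0‖ ≤ ‖Ac ^ n‖ * ‖(fun i => (u i : ℂ))‖ :=
      (norm_le_pi_norm _ i0).trans (Matrix.linfty_opNorm_mulVec _ _)
    have h4 : ‖(fun i => (u i : ℂ))‖ ≤ u i0 := by
      rw [pi_norm_le_iff_of_nonneg hpos.le]
      intro i
      simp [abs_of_nonneg (hu0 i), hi0 i]
    rw [h2] at h3
    have h5 : κ ^ n * u i0 ≤ ‖Ac ^ n‖ * u i0 := by
      calc _ ≤ _ := h1
        _ ≤ ‖((((A ^ n).mulVec u) i0 : ℝ) : ℂ)‖ := by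
          rw [Complex.norm_real]; exact le_abs_self _
        _ ≤ _ := h3
        _ ≤ _ := by gcongr
    exact le_of_mul_le_mul_right h5 hpos
  refine ge_of_tendsto (spectrum.pow_nnnorm_pow_one_div_tendsto_nhds_spectralRadius Ac) ?_
  filter_upwards [Filter.eventually_gt_atTop 0] with n hn
  have h6 : (ENNReal.ofReal κ) ^ n ≤ (‖Ac ^ n‖₊ : ENNReal) := by
    rw [← ENNReal.ofReal_pow hκ.le, ← ENNReal.ofReal_coe_nnreal]
    exact ENNReal.ofReal_le_ofReal (key n)
  calc ENNReal.ofReal κ = ((ENNReal.ofReal κ) ^ n) ^ (1 / (n:ℝ)) := by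
        rw [← ENNReal.rpow_natCast, ← ENNReal.rpow_mul]
        have : (n:ℝ) ≠ 0 := by positivity
        field_simp; simp
    _ ≤ _ := ENNReal.rpow_le_rpow h6 (by positivity)

theorem growth_of_spec_ge {ι : Type*} [Fintype ι] [DecidableEq ι] (A : Matrix ι ι ℝ)
    (hA : ∀ i j, 0 ≤ A i j) (κ : ℝ) (hκ : 0 < κ)
    (h : ENNReal.ofReal κ ≤ spectralRadius ℂ (Matrix.of fun i j => ((A i j : ℝ) : ℂ))) :
    ∃ u : ι → ℝ, (∀ i, 0 ≤ u i) ∧ (∃ i, u i ≠ 0) ∧ ∀ i, κ * u i ≤ ∑ j, A i j * u j := by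
  set Ac : Matrix ι ι ℂ := Matrix.of fun i j => ((A i j : ℝ) : ℂ) with hAc
  have hne : (spectrum ℂ Ac).Nonempty := by
    by_contra hcon
    rw [Set.not_nonempty_iff_eq_empty] at hcon
    have : spectralRadius ℂ Ac = 0 := by simp [spectralRadius, hcon]
    rw [this] at h
    simp at h
    linarith
  obtain ⟨k, hk, hk2⟩ := spectrum.exists_nnnorm_eq_spectralRadius_of_nonempty hne
  rw [← hk2] at h
  have hkκ : κ ≤ ‖k‖ := by
    rw [← ENNReal.ofReal_coe_nnreal] at h
    have := (ENNReal.ofReal_le_ofReal_iff (by positivity)).1 h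
    simpa using this
  rw [← Matrix.spectrum_toLin', ← Module.End.hasEigenvalue_iff_mem_spectrum] at hk
  obtain ⟨z, hz⟩ := hk.exists_hasEigenvector
  have hz1 := hz.apply_eq_smul
  have hz2 := hz.2
  refine ⟨fun i => ‖z i‖, fun i => norm_nonneg _, ?_, ?_⟩
  · by_contra! hcon
    exact hz2 (funext fun i => by simpa using hcon i)
  · intro i
    have h1 := congrFun hz1 i
    simp only [Matrix.toLin'_apply, Matrix.mulVec, dotProduct, Pi.smul_apply, smul_eq_mul] at h1
    calc κ * ‖z i‖ ≤ ‖k‖ * ‖z i‖ := by gcongr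
      _ = ‖∑ j, Ac i j * z j‖ := by rw [h1, norm_mul]
      _ ≤ ∑ j, ‖Ac i j * z j‖ := norm_sum_le _ _
      _ = _ := by
        refine Finset.sum_congr rfl (fun j _ => ?_)
        simp [hAc, abs_of_nonneg (hA i j)]
end MatrixPart

/-- `H` supports a nonnegative vector that grows by `κ` under `a`. -/
def Grow {N : ℕ} (a : Fin N → Fin N → ℝ) (H : Finset (Fin N)) (κ : ℝ) : Prop :=
  ∃ u : Fin N → ℝ, (∀ i, 0 ≤ u i) ∧ (∃ i, u i ≠ 0) ∧ (∀ i, i ∉ H → u i = 0) ∧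
    ∀ i, κ * u i ≤ ∑ j, a i j * u j

theorem grow_iff {N : ℕ} (a : Fin N → Fin N → ℝ) (ha : ∀ i j, 0 ≤ a i j) (H : Finset (Fin N))
    (κ : ℝ) (hκ : 0 < κ) :
    ENNReal.ofReal κ ≤ spectralRadius ℂ
      (Matrix.of fun i j : {x // x ∈ H} => ((a i.1 j.1 : ℝ) : ℂ)) ↔ Grow a H κ := by
  constructor
  · intro h
    obtain ⟨u, h0, ⟨i1, h1⟩, h2⟩ := growth_of_spec_ge
      (Matrix.of fun i j : {x // x ∈ H} => a i.1 j.1) (fun i j => ha _ _) κ hκ h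
    refine ⟨fun i => if hi : i ∈ H then u ⟨i, hi⟩ else 0, ?_, ⟨i1.1, ?_⟩, ?_, ?_⟩
    · intro i; dsimp only; split_ifs; exacts [h0 _, le_rfl]
    · simpa using h1
    · intro i hi; simp [hi]
    · intro i
      dsimp only
      split_ifs with hi
      · refine (h2 ⟨i, hi⟩).trans (le_of_eq ?_)
        simp only [Matrix.of_apply]
        rw [Finset.sum_coe_sort_eq_attach, ← Finset.sum_subset (Finset.subset_univ H)]
        · rw [← Finset.sum_attach H]
          refine Finset.sum_congr rfl (fun j _ => ?_)
          simp
        · intro x _ hx; simp [hx]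
      · rw [mul_zero]
        refine Finset.sum_nonneg (fun j _ => mul_nonneg (ha _ _) ?_)
        split_ifs; exacts [h0 _, le_rfl]
  · rintro ⟨u, h0, ⟨i1, h1⟩, h2, h3⟩
    have hi1 : i1 ∈ H := by by_contra hc; exact h1 (h2 _ hc)
    refine spec_ge_of_growth (Matrix.of fun i j : {x // x ∈ H} => a i.1 j.1) (fun i j => ha _ _)
      κ hκ (fun i => u i.1) (fun i => h0 _) ⟨⟨i1, hi1⟩, h1⟩ ?_
    intro i
    refine (h3 i.1).trans (le_of_eq ?_)
    simp only [Matrix.of_apply]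
    rw [Finset.sum_coe_sort H (fun j => a i.1 j * u j),
      ← Finset.sum_subset (Finset.subset_univ H)]
    intro x _ hx; simp [h2 x hx]

theorem grow_univ_iff {N : ℕ} (a : Fin N → Fin N → ℝ) (ha : ∀ i j, 0 ≤ a i j)
    (κ : ℝ) (hκ : 0 < κ) :
    ENNReal.ofReal κ ≤ spectralRadius ℂ
      (Matrix.of fun i j : Fin N => ((a i j : ℝ) : ℂ)) ↔ Grow a Finset.univ κ := by
  constructor
  · intro h
    obtain ⟨u, h0, h1, h2⟩ := growth_of_spec_ge (Matrix.of a) (fun i j => ha _ _) κ hκ h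
    exact ⟨u, h0, h1, by simp, h2⟩
  · rintro ⟨u, h0, h1, _, h2⟩
    exact spec_ge_of_growth (Matrix.of a) (fun i j => ha _ _) κ hκ u h0 h1 h2

theorem exists_super {N : ℕ} (a : Fin N → Fin N → ℝ) (ha : ∀ i j, 0 ≤ a i j)
    (S : Finset (Fin N)) (hS : ¬ Grow a S 1) :
    ∃ v : Fin N → ℝ, (∀ i, 1 ≤ v i) ∧ ∀ i ∈ S, (∑ j ∈ S, a i j * v j) + 1 ≤ v i := by
  classical
  set B : Matrix (Fin N) (Fin N) ℝ := Matrix.of fun i j => if i ∈ S ∧ j ∈ S then a i j else 0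
    with hB
  have hB0 : ∀ i j, 0 ≤ B i j := by
    intro i j; simp only [hB, Matrix.of_apply]; split_ifs; exacts [ha _ _, le_rfl]
  have hBa : ∀ i j, B i j ≤ a i j := by
    intro i j; simp only [hB, Matrix.of_apply]; split_ifs; exacts [le_rfl, ha _ _]
  have hBS : ∀ i j, i ∉ S → B i j = 0 := by
    intro i j hi; simp [hB, hi]
  -- no nonnegative nonzero vector below its image
  have hno : ∀ w : Fin N → ℝ, (∀ i, 0 ≤ w i) → (∀ i, w i ≤ ∑ j, B i j * w j) → ∀ i, w i = 0 := by
    intro w hw0 hw i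
    by_contra hi
    refine hS ⟨w, hw0, ⟨i, hi⟩, ?_, ?_⟩
    · intro k hk
      have := hw k
      simp only [hBS k _ hk, zero_mul, Finset.sum_const_zero] at this
      exact le_antisymm this (hw0 k)
    · intro k
      rw [one_mul]
      exact (hw k).trans (Finset.sum_le_sum fun j _ => mul_le_mul_of_nonneg_right (hBa k j) (hw0 j))
  have hdet : (1 - B).det ≠ 0 := by
    intro h
    obtain ⟨z, hz, hz2⟩ := Matrix.exists_mulVec_eq_zero_iff.2 h
    apply hz
    rw [Matrix.sub_mulVec, Matrix.one_mulVec, sub_eq_zero] at hz2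
    have := hno (fun i => |z i|) (fun i => abs_nonneg _) (by
      intro i
      have h1 := congrFun hz2 i
      simp only [Matrix.mulVec, dotProduct] at h1
      calc |z i| = |∑ j, B i j * z j| := by rw [← h1]
        _ ≤ ∑ j, |B i j * z j| := Finset.abs_sum_le_sum_abs _ _
        _ = _ := Finset.sum_congr rfl fun j _ => by rw [abs_mul, abs_of_nonneg (hB0 i j)])
    funext i
    simpa using this i
  set v := (1 - B)⁻¹.mulVec (fun _ => (1:ℝ)) with hv
  have hv1 : (1 - B).mulVec v = fun _ => 1 := by
    rw [hv, Matrix.mulVec_mulVec, Matrix.mul_nonsing_inv _ (isUnit_iff_ne_zero.2 hdet),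
      Matrix.one_mulVec]
  have hv2 : ∀ i, v i = 1 + ∑ j, B i j * v j := by
    intro i
    have := congrFun hv1 i
    rw [Matrix.sub_mulVec, Matrix.one_mulVec] at this
    simp only [Matrix.mulVec, dotProduct, Pi.sub_apply] at this
    linarith
  have hneg := hno (fun i => max (-v i) 0) (fun i => le_max_right _ _) (by
    intro i
    apply max_le
    · rw [hv2 i]
      have : ∑ j, B i j * max (-v j) 0 ≥ ∑ j, B i j * (-v j) :=
        Finset.sum_le_sum fun j _ => mul_le_mul_of_nonneg_left (le_max_left _ _) (hB0 i j)
      simp only [mul_neg, Finset.sum_neg_distrib] at this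
      linarith
    · exact Finset.sum_nonneg fun j _ => mul_nonneg (hB0 i j) (le_max_right _ _))
  have hv0 : ∀ i, 0 ≤ v i := by
    intro i
    have h1 : max (-v i) 0 = 0 := hneg i
    have h2 := le_max_left (-v i) 0
    linarith
  refine ⟨v, ?_, ?_⟩
  · intro i
    rw [hv2 i]
    have : 0 ≤ ∑ j, B i j * v j := Finset.sum_nonneg fun j _ => mul_nonneg (hB0 i j) (hv0 j)
    linarith
  · intro i hi
    rw [hv2 i]
    have : ∑ j ∈ S, a i j * v j = ∑ j, B i j * v j := by
      rw [← Finset.sum_subset (Finset.subset_univ S)]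
      · exact Finset.sum_congr rfl fun j hj => by simp [hB, hi, hj]
      · intro j _ hj; simp [hB, hj]
    linarith

theorem scc_reach {N : ℕ} {p : Fin N → Fin N → ℝ} {H : Finset (Fin N)} (hH : IsSCC p H)
    {i j : Fin N} (hi : i ∈ H) (hj : j ∈ H) : Reach p i j := by
  obtain ⟨k, hk⟩ := hH
  exact ((hk i).1 hi).2.trans ((hk j).1 hj).1

theorem scc_mem {N : ℕ} {p : Fin N → Fin N → ℝ} {H : Finset (Fin N)} (hH : IsSCC p H)
    {i j : Fin N} (hi : i ∈ H) (h1 : Reach p i j) (h2 : Reach p j i) : j ∈ H := by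
  obtain ⟨k, hk⟩ := hH
  exact (hk j).2 ⟨((hk i).1 hi).1.trans h1, h2.trans ((hk i).1 hi).2⟩

theorem scc_eq {N : ℕ} {p : Fin N → Fin N → ℝ} {H₁ H₂ : Finset (Fin N)} (h₁ : IsSCC p H₁)
    (h₂ : IsSCC p H₂) {i : Fin N} (hi : i ∈ H₁) (hi2 : i ∈ H₂) : H₁ = H₂ := by
  ext j
  constructor
  · intro hj; exact scc_mem h₂ hi2 (scc_reach h₁ hi hj) (scc_reach h₁ hj hi)
  · intro hj; exact scc_mem h₁ hi (scc_reach h₂ hi2 hj) (scc_reach h₂ hj hi2)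

theorem sum_supp {N : ℕ} (a : Fin N → Fin N → ℝ) (H : Finset (Fin N)) (u : Fin N → ℝ)
    (hu : ∀ i, i ∉ H → u i = 0) (i : Fin N) : ∑ j, a i j * u j = ∑ j ∈ H, a i j * u j := by
  symm
  apply Finset.sum_subset (Finset.subset_univ H)
  intro j _ hj; simp [hu j hj]

theorem exists_harmonic {N : ℕ} (p a : Fin N → Fin N → ℝ) (ha : ∀ i j, 0 ≤ a i j)
    (hap : ∀ i j, 0 < p i j ↔ 0 < a i j) (H : Finset (Fin N)) (hH : IsSCC p H)
    (hg : Grow a H 1) (hng : ∀ κ, 1 < κ → ¬ Grow a H κ) :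
    ∃ u : Fin N → ℝ, (∀ i ∈ H, 0 < u i) ∧ ∀ i ∈ H, ∑ j ∈ H, a i j * u j ≤ u i := by
  classical
  obtain ⟨u, h0, ⟨i1, h1⟩, h2, h3⟩ := hg
  have hi1 : i1 ∈ H := by by_contra hc; exact h1 (h2 _ hc)
  have harm : ∀ i ∈ H, ∑ j ∈ H, a i j * u j ≤ u i := by
    by_contra! hcon
    obtain ⟨i0, hi0, hlt⟩ := hcon
    -- for each `k ∈ H` a subharmonic vector strict at `k`
    have step : ∀ k, Reach p k i0 → k ∈ H → ∃ w : Fin N → ℝ, (∀ i, 0 ≤ w i) ∧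
        (∀ i, i ∉ H → w i = 0) ∧ (∀ i ∈ H, w i ≤ ∑ j ∈ H, a i j * w j) ∧
        w k < ∑ j ∈ H, a k j * w j := by
      intro k hk
      induction hk using Relation.ReflTransGen.head_induction_on with
      | refl =>
        intro _
        refine ⟨u, h0, h2, fun i _ => ?_, hlt⟩
        rw [← sum_supp a H u h2]; simpa using h3 i
      | @head k k' hkk' hr ih =>
        intro hkH
        have hk'H : k' ∈ H := scc_mem hH hkH (Relation.ReflTransGen.single hkk')
          (hr.trans (scc_reach hH hi0 hkH))
        obtain ⟨w, w0, w1, w2, w3⟩ := ih hk'H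
        have hww : ∀ i ∈ H, ∀ j ∈ H, a i j * w j ≤ a i j * (∑ l ∈ H, a j l * w l) :=
          fun i _ j hj => mul_le_mul_of_nonneg_left (w2 j hj) (ha i j)
        refine ⟨fun i => if i ∈ H then ∑ j ∈ H, a i j * w j else 0, ?_, ?_, ?_, ?_⟩
        · intro i; dsimp only; split_ifs
          · exact Finset.sum_nonneg fun j _ => mul_nonneg (ha _ _) (w0 j)
          · exact le_rfl
        · intro i hi; simp [hi]
        · intro i hi
          simp only [hi, if_true]
          refine Finset.sum_le_sum fun j hj => ?_
          simp only [hj, if_true]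
          exact hww i hi j hj
        · simp only [hkH, if_true]
          refine Finset.sum_lt_sum (fun j hj => ?_) ⟨k', hk'H, ?_⟩
          · simp only [hj, if_true]
            exact hww k hkH j hj
          · simp only [hk'H, if_true]
            exact mul_lt_mul_of_pos_left w3 ((hap k k').1 hkk')
    have step' : ∀ k : Fin N, ∃ w : Fin N → ℝ, k ∈ H → (∀ i, 0 ≤ w i) ∧
        (∀ i, i ∉ H → w i = 0) ∧ (∀ i ∈ H, w i ≤ ∑ j ∈ H, a i j * w j) ∧
        w k < ∑ j ∈ H, a k j * w j := by
      intro k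
      by_cases hk : k ∈ H
      · obtain ⟨w, hw⟩ := step k (scc_reach hH hk hi0) hk
        exact ⟨w, fun _ => hw⟩
      · exact ⟨0, fun h => absurd h hk⟩
    choose w hw using step'
    set W : Fin N → ℝ := fun i => ∑ k ∈ H, w k i with hW
    have hWimg : ∀ i, ∑ j ∈ H, a i j * W j = ∑ k ∈ H, ∑ j ∈ H, a i j * w k j := by
      intro i
      simp only [hW, Finset.mul_sum]
      rw [Finset.sum_comm]
    have hW0 : ∀ i, 0 ≤ W i := fun i => Finset.sum_nonneg fun k hk => (hw k hk).1 i
    have hWs : ∀ i ∈ H, W i < ∑ j ∈ H, a i j * W j := by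
      intro i hi
      rw [hWimg]
      exact Finset.sum_lt_sum (fun k hk => (hw k hk).2.2.1 i hi) ⟨i, hi, (hw i hi).2.2.2⟩
    have hWz : ∀ i, i ∉ H → W i = 0 := fun i hi => Finset.sum_eq_zero fun k hk => (hw k hk).2.1 i hi
    -- uniform factor
    set C := ∑ i, W i + 1 with hC
    have hC0 : 0 < C := by
      have : 0 ≤ ∑ i, W i := Finset.sum_nonneg fun i _ => hW0 i
      linarith
    have hWC : ∀ i, W i ≤ C := by
      intro i
      have := Finset.single_le_sum (fun i _ => hW0 i) (Finset.mem_univ i)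
      linarith
    obtain ⟨m, hmH, hm⟩ := H.exists_min_image (fun i => (∑ j ∈ H, a i j * W j) - W i) ⟨i1, hi1⟩
    set g := (∑ j ∈ H, a m j * W j) - W m with hgdef
    have hg0 : 0 < g := sub_pos.2 (hWs m hmH)
    have hκ : 1 < 1 + g / C := by have := div_pos hg0 hC0; linarith
    refine hng _ hκ ⟨W, hW0, ?_, hWz, ?_⟩
    · by_contra! hall
      have := hWs i1 hi1
      simp [hall] at this
    · intro i
      rw [sum_supp a H W hWz]
      by_cases hi : i ∈ H
      · have h5 := hm i hi
        have h6 : g / C * W i ≤ g := by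
          calc g / C * W i ≤ g / C * C := by gcongr; exact hWC i
            _ = g := by field_simp
        have : (1 + g / C) * W i = W i + g / C * W i := by ring
        rw [this]
        linarith
      · rw [hWz i hi, mul_zero]
        exact Finset.sum_nonneg fun j _ => mul_nonneg (ha _ _) (hW0 j)
  refine ⟨u, ?_, harm⟩
  intro i hi
  have hr := scc_reach hH hi hi1
  have : ∀ k, Reach p k i1 → k ∈ H → 0 < u k := by
    intro k hk
    induction hk using Relation.ReflTransGen.head_induction_on with
    | refl => intro _; exact lt_of_le_of_ne (h0 _) (Ne.symm h1)
    | @head k k' hkk' hr ih =>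
      intro hkH
      have hk'H : k' ∈ H := scc_mem hH hkH (Relation.ReflTransGen.single hkk')
          (hr.trans (scc_reach hH hi1 hkH))
      have h4 := ih hk'H
      refine lt_of_lt_of_le ?_ (harm k hkH)
      refine lt_of_lt_of_le (mul_pos ((hap k k').1 hkk') h4) ?_
      exact Finset.single_le_sum (f := fun j => a k j * u j)
        (fun j _ => mul_nonneg (ha k j) (h0 j)) hk'H
  exact this i hr hi

open Classical in
/-- mutual reachability class -/
noncomputable def comp {N : ℕ} (p : Fin N → Fin N → ℝ) (i : Fin N) : Finset (Fin N) :=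
  Finset.univ.filter (fun j => Reach p i j ∧ Reach p j i)

theorem mem_comp {N : ℕ} (p : Fin N → Fin N → ℝ) (i j : Fin N) :
    j ∈ comp p i ↔ Reach p i j ∧ Reach p j i := by simp [comp]

theorem comp_scc {N : ℕ} (p : Fin N → Fin N → ℝ) (i : Fin N) : IsSCC p (comp p i) :=
  ⟨i, fun j => mem_comp p i j⟩

theorem self_mem_comp {N : ℕ} (p : Fin N → Fin N → ℝ) (i : Fin N) : i ∈ comp p i :=
  (mem_comp p i i).2 ⟨Relation.ReflTransGen.refl, Relation.ReflTransGen.refl⟩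

theorem not_grow_compl {N : ℕ} (p a : Fin N → Fin N → ℝ) (ha : ∀ i j, 0 ≤ a i j)
    (hap : ∀ i j, 0 < p i j ↔ 0 < a i j) (S : Finset (Fin N))
    (hS : ∀ i ∈ S, ¬ Grow a (comp p i) 1) : ¬ Grow a S 1 := by
  classical
  rintro ⟨u, h0, ⟨i1, h1⟩, h2, h3⟩
  let reachSet : Fin N → Finset (Fin N) := fun i => Finset.univ.filter (fun j => Reach p i j)
  obtain ⟨i, hi, hmin⟩ := (Finset.univ.filter (fun i => u i ≠ 0)).exists_min_image
    (fun i => (reachSet i).card) ⟨i1, by simpa using h1⟩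
  have hi' : u i ≠ 0 := by simpa using hi
  have hiS : i ∈ S := by by_contra hc; exact hi' (h2 _ hc)
  refine hS i hiS ⟨fun k => if k ∈ comp p i then u k else 0, ?_, ⟨i, ?_⟩, ?_, ?_⟩
  · intro k; dsimp only; split_ifs; exacts [h0 _, le_rfl]
  · simpa [self_mem_comp] using hi'
  · intro k hk; simp [hk]
  · intro k
    dsimp only
    split_ifs with hk
    · refine (h3 k).trans (Finset.sum_le_sum fun j _ => ?_)
      split_ifs with hj
      · exact le_rfl
      · rw [mul_zero]
        by_contra! hpos
        have haj : 0 < a k j := by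
          rcases (ha k j).lt_or_eq with h | h
          · exact h
          · rw [← h, zero_mul] at hpos; exact absurd hpos (lt_irrefl _)
        have huj : u j ≠ 0 := by rintro h; rw [h, mul_zero] at hpos; exact absurd hpos (lt_irrefl _)
        have hij : Reach p i j := ((mem_comp p i k).1 hk).1.tail ((hap k j).2 haj)
        have hsub : reachSet j ⊆ reachSet i := by
          intro l hl
          simp only [reachSet, Finset.mem_filter, Finset.mem_univ, true_and] at hl ⊢
          exact hij.trans hl
        have heq := Finset.eq_of_subset_of_card_le hsub (hmin j (by simpa using huj))
        have : i ∈ reachSet j := by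
          rw [heq]; simp only [reachSet, Finset.mem_filter, Finset.mem_univ, true_and]
          exact Relation.ReflTransGen.refl
        simp only [reachSet, Finset.mem_filter, Finset.mem_univ, true_and] at this
        exact hj ((mem_comp p i j).2 ⟨hij, this⟩)
    · rw [mul_zero]
      refine Finset.sum_nonneg fun j _ => mul_nonneg (ha _ _) ?_
      split_ifs; exacts [h0 _, le_rfl]

/-- application of the matrix `a` to a vector -/
noncomputable def app {N : ℕ} (a : Fin N → Fin N → ℝ) (z : Fin N → ℝ) : Fin N → ℝ :=
  fun i => ∑ j, a i j * z j

theorem app_mono {N : ℕ} (a : Fin N → Fin N → ℝ) (ha : ∀ i j, 0 ≤ a i j) {y z : Fin N → ℝ}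
    (h : ∀ i, y i ≤ z i) (i : Fin N) : app a y i ≤ app a z i :=
  Finset.sum_le_sum fun j _ => mul_le_mul_of_nonneg_left (h j) (ha i j)

theorem exit_edge {N : ℕ} (p : Fin N → Fin N → ℝ) (H : Finset (Fin N)) (j : Fin N) (hj : j ∉ H)
    (i : Fin N) (hr : Reach p i j) (hi : i ∈ H) :
    ∃ x y, x ∈ H ∧ y ∉ H ∧ 0 < p x y ∧ Reach p y j := by
  induction hr using Relation.ReflTransGen.head_induction_on with
  | refl => exact absurd hi hj
  | @head k k' hkk' hr ih =>
    by_cases hk' : k' ∈ H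
    · exact ih hk'
    · exact ⟨k, k', hi, hk', hkk', hr⟩

theorem unbounded_iter {N : ℕ} (p a : Fin N → Fin N → ℝ) (ha : ∀ i j, 0 ≤ a i j)
    (hap : ∀ i j, 0 < p i j ↔ 0 < a i j) (H₁ H₂ : Finset (Fin N)) (h₁ : IsSCC p H₁)
    (h₂ : IsSCC p H₂) (g₁ : Grow a H₁ 1) (g₂ : Grow a H₂ 1) (hne : H₁ ≠ H₂) (hP : Prec p H₁ H₂) :
    ∃ u : Fin N → ℝ, (∀ i, 0 ≤ u i) ∧ (∀ i, u i ≤ app a u i) ∧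
      ∃ i, ∀ K : ℝ, ∃ n : ℕ, K < (app a)^[n] u i := by
  classical
  obtain ⟨u, u0, ⟨k2, hk2⟩, us, ug⟩ := g₂
  obtain ⟨w, w0, ⟨k1, hk1⟩, ws, wg⟩ := g₁
  have hk2H : k2 ∈ H₂ := by by_contra hc; exact hk2 (us _ hc)
  have hk1H : k1 ∈ H₁ := by by_contra hc; exact hk1 (ws _ hc)
  have ug' : ∀ i, u i ≤ app a u i := fun i => by simpa [app] using ug i
  have wg' : ∀ i, w i ≤ ∑ j ∈ H₁, a i j * w j := fun i => by
    rw [← sum_supp a H₁ w ws]; simpa using wg i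
  refine ⟨u, u0, ug', ?_⟩
  by_contra! hcon
  choose K hK using hcon
  have hmono : ∀ n i, (app a)^[n] u i ≤ (app a)^[n+1] u i := by
    intro n
    induction n with
    | zero => intro i; simpa using ug' i
    | succ n ih =>
      intro i
      rw [Function.iterate_succ_apply', Function.iterate_succ_apply' _ (n+1)]
      exact app_mono a ha ih i
  have hbdd : ∀ i, BddAbove (Set.range fun n => (app a)^[n] u i) := fun i =>
    ⟨K i, by rintro _ ⟨n, rfl⟩; exact hK i n⟩
  set z : Fin N → ℝ := fun i => ⨆ n, (app a)^[n] u i with hz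
  have hlim : ∀ i, Tendsto (fun n => (app a)^[n] u i) atTop (nhds (z i)) := fun i =>
    tendsto_atTop_ciSup (monotone_nat_of_le_succ fun n => hmono n i) (hbdd i)
  have hzu : ∀ i, u i ≤ z i := fun i => le_ciSup (hbdd i) 0
  have hz0 : ∀ i, 0 ≤ z i := fun i => (u0 i).trans (hzu i)
  have hzA : ∀ i, app a z i ≤ z i := by
    intro i
    have : Tendsto (fun n => app a ((app a)^[n] u) i) atTop (nhds (app a z i)) :=
      tendsto_finsetSum _ fun j _ => (hlim j).const_mul _
    refine le_of_tendsto this (Eventually.of_forall fun n => ?_)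
    have := le_ciSup (hbdd i) (n+1)
    simp only [Function.iterate_succ_apply'] at this
    exact this
  have hzpos : ∀ k, Reach p k k2 → 0 < z k := by
    intro k hk
    induction hk using Relation.ReflTransGen.head_induction_on with
    | refl => exact lt_of_lt_of_le (lt_of_le_of_ne (u0 _) (Ne.symm hk2)) (hzu _)
    | @head k k' hkk' hr ih =>
      refine lt_of_lt_of_le ?_ (hzA k)
      refine lt_of_lt_of_le (mul_pos ((hap k k').1 hkk') ih) ?_
      exact Finset.single_le_sum (f := fun j => a k j * z j)
        (fun j _ => mul_nonneg (ha k j) (hz0 j)) (Finset.mem_univ k')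
  obtain ⟨i, hi, j, hj, hij⟩ := hP
  have hreach : ∀ k ∈ H₁, Reach p k k2 := fun k hk =>
    ((scc_reach h₁ hk hi).trans hij).trans (scc_reach h₂ hj hk2H)
  have hjH : j ∉ H₁ := fun h => hne (scc_eq h₁ h₂ h hj)
  obtain ⟨x, y, hx, hy, hxy, hyj⟩ := exit_edge p H₁ j hjH i hij hi
  -- restricted inequality
  have hzH : ∀ i, ∑ j ∈ H₁, a i j * z j ≤ z i := fun i =>
    (Finset.sum_le_sum_of_subset_of_nonneg (Finset.subset_univ H₁)
      fun j _ _ => mul_nonneg (ha i j) (hz0 j)).trans (hzA i)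
  have hstrict : ∑ j ∈ H₁, a x j * z j < z x := by
    have h1 : ∑ j ∈ insert y H₁, a x j * z j ≤ z x :=
      (Finset.sum_le_sum_of_subset_of_nonneg (Finset.subset_univ _)
        fun j _ _ => mul_nonneg (ha x j) (hz0 j)).trans (hzA x)
    rw [Finset.sum_insert hy] at h1
    have : 0 < a x y * z y := mul_pos ((hap x y).1 hxy)
      (hzpos y (hyj.trans (scc_reach h₂ hj hk2H)))
    linarith
  have hzp : ∀ k ∈ H₁, 0 < z k := fun k hk => hzpos k (hreach k hk)
  obtain ⟨m, hmH, hm⟩ := H₁.exists_max_image (fun i => w i / z i) ⟨k1, hk1H⟩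
  set M := w m / z m with hM
  have hMpos : 0 < M := by
    refine lt_of_lt_of_le ?_ (hm k1 hk1H)
    exact div_pos (lt_of_le_of_ne (w0 _) (Ne.symm hk1)) (hzp _ hk1H)
  have hwM : ∀ k ∈ H₁, w k ≤ M * z k := fun k hk => (div_le_iff₀ (hzp k hk)).1 (hm k hk)
  have hsumle : ∀ k, ∑ j ∈ H₁, a k j * w j ≤ M * ∑ j ∈ H₁, a k j * z j := by
    intro k
    rw [Finset.mul_sum]
    refine Finset.sum_le_sum fun j hj => ?_
    calc a k j * w j ≤ a k j * (M * z j) := mul_le_mul_of_nonneg_left (hwM j hj) (ha k j)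
      _ = _ := by ring
  have hprop : ∀ k, Reach p m k → k ∈ H₁ → w k = M * z k := by
    intro k hk
    induction hk with
    | refl => intro _; rw [hM]; have := hzp m hmH; field_simp
    | @tail k k' hr hkk' ih =>
      intro hk'
      have hkH : k ∈ H₁ := scc_mem h₁ hmH hr
        (Relation.ReflTransGen.head hkk' (scc_reach h₁ hk' hmH))
      have hk := ih hkH
      by_contra hlt
      have hlt' : w k' < M * z k' := lt_of_le_of_ne (hwM k' hk') hlt
      have : ∑ j ∈ H₁, a k j * w j < ∑ j ∈ H₁, a k j * (M * z j) := by
        refine Finset.sum_lt_sum (fun j hj => mul_le_mul_of_nonneg_left (hwM j hj) (ha k j))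
          ⟨k', hk', mul_lt_mul_of_pos_left hlt' ((hap k k').1 hkk')⟩
      have h2 : ∑ j ∈ H₁, a k j * (M * z j) = M * ∑ j ∈ H₁, a k j * z j := by
        rw [Finset.mul_sum]; exact Finset.sum_congr rfl fun j _ => by ring
      have h3 := mul_le_mul_of_nonneg_left (hzH k) hMpos.le
      have h4 := wg' k
      linarith
  have hxM := hprop x (scc_reach h₁ hmH hx) hx
  have h4 := wg' x
  have h5 := hsumle x
  have h6 := mul_lt_mul_of_pos_left hstrict hMpos
  linarith

set_option maxHeartbeats 2000000 in
theorem exists_bound {N : ℕ} (hN : 0 < N) (p a ε : Fin N → Fin N → ℝ) (ha : ∀ i j, 0 ≤ a i j)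
    (hap : ∀ i j, 0 < p i j ↔ 0 < a i j) (e0 lam θ : ℝ) (he0 : 0 < e0) (he1 : e0 < 1)
    (hl0 : 0 < lam) (hl1 : lam < 1) (hθ : 0 < θ)
    (hε : ∀ i j, 0 < p i j → e0 ≤ ε i j ∧ ε i j ≤ lam)
    (hng : ∀ κ, 1 < κ → ∀ H, ¬ Grow a H κ)
    (hinc : ∀ i j, Grow a (comp p i) 1 → Grow a (comp p j) 1 → Reach p i j →
      comp p i = comp p j) :
    ∃ (B : Fin N → ℝ → ℝ) (C : ℝ),
      (∀ i x, 1 < x → x ≤ 1 / e0 → x ^ θ ≤ B i x) ∧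
      (∀ i x, 0 < x → x ≤ 1 → ∑ j, a i j * B j (x / ε i j) ≤ B i x) ∧
      (∀ i x, 0 < x → x ≤ 1 → B i x ≤ C) := by
  classical
  have : Nonempty (Fin N) := ⟨⟨0, hN⟩⟩
  set T : Finset (Fin N) := Finset.univ.filter (fun i => Grow a (comp p i) 1) with hT
  have hTmem : ∀ i, i ∈ T ↔ Grow a (comp p i) 1 := fun i => by simp [hT]
  obtain ⟨v, hv1, hv⟩ := exists_super a ha Tᶜ (not_grow_compl p a ha hap Tᶜ (fun i hi => by
    rw [Finset.mem_compl, hTmem] at hi; exact hi))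
  -- positive superharmonic vector on T
  have hU : ∀ H : Finset (Fin N), ∃ u : Fin N → ℝ, IsSCC p H → Grow a H 1 →
      (∀ i ∈ H, 0 < u i) ∧ ∀ i ∈ H, ∑ j ∈ H, a i j * u j ≤ u i := by
    intro H
    by_cases h : IsSCC p H ∧ Grow a H 1
    · obtain ⟨u, hu⟩ := exists_harmonic p a ha hap H h.1 h.2 (fun κ hκ => hng κ hκ H)
      exact ⟨u, fun _ _ => hu⟩
    · exact ⟨0, fun h1 h2 => absurd ⟨h1, h2⟩ h⟩
  choose U hU using hU
  set u : Fin N → ℝ := fun i => if i ∈ T then U (comp p i) i else 1 with hu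
  have hupos : ∀ i, 0 < u i := by
    intro i
    simp only [hu]
    split_ifs with h
    · exact (hU _ (comp_scc p i) ((hTmem i).1 h)).1 i (self_mem_comp p i)
    · exact one_pos
  have husup : ∀ i ∈ T, ∑ j ∈ T, a i j * u j ≤ u i := by
    intro i hi
    have h1 := (hU _ (comp_scc p i) ((hTmem i).1 hi)).2 i (self_mem_comp p i)
    have h2 : u i = U (comp p i) i := by simp [hu, hi]
    rw [h2]
    refine le_trans ?_ h1
    calc ∑ j ∈ T, a i j * u j ≤ ∑ j ∈ T, (if j ∈ comp p i then a i j * U (comp p i) j else 0) := by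
          refine Finset.sum_le_sum fun j hj => ?_
          rcases (ha i j).lt_or_eq with h | h
          · have hr : Reach p i j := Relation.ReflTransGen.single ((hap i j).2 h)
            have hc := hinc i j ((hTmem i).1 hi) ((hTmem j).1 hj) hr
            have hjc : j ∈ comp p i := hc ▸ self_mem_comp p j
            rw [if_pos hjc]
            have huj : u j = U (comp p i) j := by simp only [hu, hj, if_true]; rw [hc]
            rw [huj]
          · simp [← h]
      _ ≤ ∑ j, (if j ∈ comp p i then a i j * U (comp p i) j else 0) := by
          refine Finset.sum_le_sum_of_subset_of_nonneg (Finset.subset_univ _) fun j _ _ => ?_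
          split_ifs with hj
          · exact mul_nonneg (ha _ _)
              ((hU _ (comp_scc p i) ((hTmem i).1 hi)).1 j hj).le
          · exact le_rfl
      _ = _ := by rw [Finset.sum_ite_mem, Finset.univ_inter]
  obtain ⟨imin, himin⟩ := Finite.exists_min u
  obtain ⟨imax, himax⟩ := Finite.exists_max u
  obtain ⟨vmax, hvmax⟩ := Finite.exists_max v
  set u1 := u imin
  set u2 := u imax
  set V := v vmax
  have hu1 : 0 < u1 := hupos _
  have hu2 : 0 < u2 := hupos _
  have hV : 1 ≤ V := hv1 _
  -- the low vertices
  let Low : Fin N → Prop := fun i => ∀ k ∈ T, ¬ Reach p i k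
  have lowlow : ∀ i j, Low i → 0 < a i j → Low j := fun i j hi hj k hk hr =>
    hi k hk (Relation.ReflTransGen.head ((hap i j).2 hj) hr)
  have lowS : ∀ i, Low i → i ∉ T := fun i hi h => hi i h Relation.ReflTransGen.refl
  have Tedge : ∀ i j, i ∈ T → 0 < a i j → j ∉ T → Low j := by
    intro i j hi hj hjT k hk hr
    have hij : Reach p i j := Relation.ReflTransGen.single ((hap i j).2 hj)
    have hc := hinc i k ((hTmem i).1 hi) ((hTmem k).1 hk) (hij.trans hr)
    have hki : k ∈ comp p i := hc ▸ self_mem_comp p k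
    have hji : j ∈ comp p i := (mem_comp p i j).2 ⟨hij, hr.trans ((mem_comp p i k).1 hki).2⟩
    have : comp p i = comp p j := scc_eq (comp_scc p i) (comp_scc p j) hji (self_mem_comp p j)
    exact hjT ((hTmem j).2 (this ▸ (hTmem i).1 hi))
  -- exponents
  have hb : 1 < 1 / e0 := by rw [lt_div_iff₀ he0]; linarith
  set δ := Real.logb (1 / e0) (1 + 1 / V) with hδ
  have hδ0 : 0 < δ := Real.logb_pos hb (by have : 0 < 1 / V := by positivity
                                           linarith)
  set κ0 := (1 / e0) ^ δ with hκ0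
  have hkV : κ0 = 1 + 1 / V := Real.rpow_logb (by linarith) (by linarith) (by positivity)
  have hκ1 : 1 ≤ κ0 := by rw [hkV]; have : 0 < 1 / V := by positivity
                          linarith
  set κ1 := (1 / lam) ^ δ with hkdef
  have hlb : 1 < 1 / lam := by rw [lt_div_iff₀ hl0]; linarith
  have hκ1' : 1 < κ1 := Real.one_lt_rpow hlb hδ0
  have hvκ : ∀ i, κ0 * (v i - 1) ≤ v i := by
    intro i
    rw [hkV]
    have h1 : 1 / V * (v i - 1) ≤ 1 := by
      rw [one_div, inv_mul_le_iff₀ (by linarith)]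
      have : v i ≤ V := hvmax i
      linarith
    have : (1 + 1 / V) * (v i - 1) = v i - 1 + 1 / V * (v i - 1) := by ring
    linarith
  set c1 := (1 / e0) ^ θ with hc1
  have hc1pos : 0 < c1 := by positivity
  have hxc : ∀ x, 1 < x → x ≤ 1 / e0 → x ^ θ ≤ c1 := fun x h1 h2 =>
    Real.rpow_le_rpow (by linarith) h2 hθ.le
  obtain ⟨amax, hamax⟩ := Finite.exists_max (fun i => ∑ j, a i j)
  set As := ∑ j, a amax j with hAs
  have hAs0 : 0 ≤ As := Finset.sum_nonneg fun j _ => ha _ _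
  set Lc := c1 * κ0 * V * As / ((κ1 - 1) * u1) with hLc
  have hLc0 : 0 ≤ Lc := by
    apply div_nonneg
    · positivity
    · exact mul_nonneg (by linarith) hu1.le
  set K := Lc * κ0 + c1 / u1 with hK
  have hK0 : 0 < K := by
    have : 0 < c1 / u1 := by positivity
    have : 0 ≤ Lc * κ0 := by positivity
    linarith
  set D := c1 * V * κ0 + K * u2 with hD
  have hD0 : 0 ≤ D := by positivity
  set C2 := As * D + c1 with hC2
  have hC20 : 0 < C2 := by positivity
  set B : Fin N → ℝ → ℝ := fun i x =>
    if i ∈ T then u i * (K - Lc * x ^ δ) else if Low i then c1 * v i * x ^ δ else C2 * v i with hB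
  have hpowle : ∀ x, 0 < x → x ≤ 1 → ∀ i j, 0 < a i j →
      x ^ δ * κ1 ≤ (x / ε i j) ^ δ ∧ (x / ε i j) ^ δ ≤ x ^ δ * κ0 := by
    intro x hx0 hx1 i j hij
    obtain ⟨h1, h2⟩ := hε i j ((hap i j).2 hij)
    have hε0 : 0 < ε i j := lt_of_lt_of_le he0 h1
    have : x / ε i j = x * (1 / ε i j) := by ring
    rw [this, Real.mul_rpow hx0.le (by positivity)]
    constructor
    · gcongr
      exact Real.rpow_le_rpow (by positivity) (one_div_le_one_div_of_le hε0 h2) hδ0.le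
    · gcongr
      exact Real.rpow_le_rpow (by positivity) (one_div_le_one_div_of_le he0 h1) hδ0.le
  refine ⟨B, K * u2 + c1 * V + C2 * V, ?_, ?_, ?_⟩
  · intro i x hx1 hx2
    refine (hxc x hx1 hx2).trans ?_
    have hxδ : x ^ δ ≤ κ0 := Real.rpow_le_rpow (by linarith) hx2 hδ0.le
    have hxδ1 : 1 ≤ x ^ δ := Real.one_le_rpow hx1.le hδ0.le
    simp only [hB]
    split_ifs with h1 h2
    · have h3 : c1 / u1 ≤ K - Lc * x ^ δ := by
        have := mul_le_mul_of_nonneg_left hxδ hLc0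
        rw [hK]; linarith
      calc c1 = u1 * (c1 / u1) := by field_simp
        _ ≤ u i * (K - Lc * x ^ δ) := by
          apply mul_le_mul (himin i) h3 (by positivity) (hupos i).le
    · calc c1 = c1 * 1 * 1 := by ring
        _ ≤ c1 * v i * x ^ δ := by
          have := hv1 i
          gcongr
    · calc c1 ≤ C2 * 1 := by
            have : 0 ≤ As * D := by positivity
            rw [hC2]; linarith
        _ ≤ C2 * v i := by
          have := hv1 i
          gcongr
  · intro i x hx0 hx1
    have hxδ0 : 0 < x ^ δ := by positivity
    have hxδ1 : x ^ δ ≤ 1 := Real.rpow_le_one hx0.le hx1 hδ0.le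
    by_cases hiT : i ∈ T
    · have hBi : B i x = u i * (K - Lc * x ^ δ) := by simp [hB, hiT]
      rw [hBi]
      calc ∑ j, a i j * B j (x / ε i j)
          ≤ ∑ j, ((if j ∈ T then a i j * u j * (K - Lc * (x ^ δ * κ1)) else 0)
              + a i j * (c1 * V * (x ^ δ * κ0))) := by
            refine Finset.sum_le_sum fun j _ => ?_
            rcases (ha i j).lt_or_eq with h | h
            · obtain ⟨hp1, hp2⟩ := hpowle x hx0 hx1 i j h
              by_cases hjT : j ∈ T
              · simp only [hB, hjT, if_true]
                have e1 : K - Lc * (x / ε i j) ^ δ ≤ K - Lc * (x ^ δ * κ1) := by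
                  have := mul_le_mul_of_nonneg_left hp1 hLc0
                  linarith
                have e2 : 0 ≤ a i j * (c1 * V * (x ^ δ * κ0)) := by positivity
                have e3 : a i j * (u j * (K - Lc * (x / ε i j) ^ δ)) ≤
                    a i j * u j * (K - Lc * (x ^ δ * κ1)) := by
                  rw [mul_assoc]
                  exact mul_le_mul_of_nonneg_left
                    (mul_le_mul_of_nonneg_left e1 (hupos j).le) h.le
                linarith
              · have hjL := Tedge i j hiT h hjT
                simp only [hB, hjT, hjL, if_true, if_false, zero_add]
                have : v j ≤ V := hvmax j
                have := hv1 j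
                have hq0 : 0 ≤ (x / ε i j) ^ δ := le_trans (by positivity) hp1
                gcongr
            · simp [← h]
        _ = (∑ j ∈ T, a i j * u j) * (K - Lc * (x ^ δ * κ1))
              + (∑ j, a i j) * (c1 * V * (x ^ δ * κ0)) := by
            rw [Finset.sum_add_distrib, Finset.sum_ite_mem, Finset.univ_inter, Finset.sum_mul,
              Finset.sum_mul]
        _ ≤ u i * (K - Lc * (x ^ δ * κ1)) + As * (c1 * V * (x ^ δ * κ0)) := by
            have hκ10 : κ1 ≤ κ0 := by
              obtain ⟨j, hj⟩ : ∃ j, 0 < a i j := by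
                obtain ⟨w, w0, ⟨k, hk⟩, hs, hw⟩ := (hTmem i).1 hiT
                by_contra! hcon
                have hp : ∀ j, a i j = 0 := fun j => le_antisymm (hcon j) (ha i j)
                have hkc : k ∈ comp p i := by
                  by_contra hc
                  exact hk (hs k hc)
                have : ∀ j, 0 < p i j → False := fun j hj => by
                  have := (hap i j).1 hj
                  rw [hp j] at this; exact lt_irrefl _ this
                have hki : k = i := by
                  rcases Relation.ReflTransGen.cases_head ((mem_comp p i k).1 hkc).1 with h | ⟨c, h, _⟩
                  · exact h.symm
                  · exact absurd (this c h) id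
                have h7 := hw k
                rw [hki] at h7 hk
                simp only [hp, zero_mul, Finset.sum_const_zero, one_mul] at h7
                exact hk (le_antisymm h7 (w0 i))
              obtain ⟨h1, h2⟩ := hε i j ((hap i j).2 hj)
              exact Real.rpow_le_rpow (by positivity) (one_div_le_one_div_of_le he0 (h1.trans h2))
                hδ0.le
            have e1 : 0 ≤ K - Lc * (x ^ δ * κ1) := by
              have : Lc * (x ^ δ * κ1) ≤ Lc * κ0 := by
                apply mul_le_mul_of_nonneg_left _ hLc0
                calc x ^ δ * κ1 ≤ 1 * κ0 := by gcongr
                  _ = κ0 := one_mul _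
              have : 0 < c1 / u1 := by positivity
              rw [hK]; linarith
            have e2 := mul_le_mul_of_nonneg_right (husup i hiT) e1
            have e3 : (∑ j, a i j) * (c1 * V * (x ^ δ * κ0)) ≤ As * (c1 * V * (x ^ δ * κ0)) :=
              mul_le_mul_of_nonneg_right (hamax i) (by positivity)
            linarith
        _ ≤ u i * (K - Lc * x ^ δ) := by
            have e1 : c1 * κ0 * V * As = Lc * ((κ1 - 1) * u1) := by
              rw [hLc]
              have : κ1 - 1 ≠ 0 := by linarith
              field_simp
            have e2 : Lc * ((κ1 - 1) * u1) ≤ Lc * ((κ1 - 1) * u i) := by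
              apply mul_le_mul_of_nonneg_left _ hLc0
              apply mul_le_mul_of_nonneg_left (himin i)
              linarith
            have e3 : As * (c1 * V * (x ^ δ * κ0)) ≤ Lc * ((κ1 - 1) * u i) * x ^ δ := by
              calc _ = (c1 * κ0 * V * As) * x ^ δ := by ring
                _ ≤ _ := by rw [e1]; exact mul_le_mul_of_nonneg_right e2 hxδ0.le
            nlinarith
    · have hiS : i ∈ Tᶜ := Finset.mem_compl.2 hiT
      have hvi := hv i hiS
      by_cases hiL : Low i
      · have hBi : B i x = c1 * v i * x ^ δ := by simp [hB, hiT, hiL]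
        rw [hBi]
        calc ∑ j, a i j * B j (x / ε i j)
            ≤ ∑ j, (if j ∈ Tᶜ then c1 * x ^ δ * κ0 * (a i j * v j) else 0) := by
              refine Finset.sum_le_sum fun j _ => ?_
              rcases (ha i j).lt_or_eq with h | h
              · obtain ⟨hp1, hp2⟩ := hpowle x hx0 hx1 i j h
                have hjL := lowlow i j hiL h
                have hjT := lowS j hjL
                simp only [hB, hjT, hjL, if_true, if_false, Finset.mem_compl, not_false_eq_true]
                have := hv1 j
                calc a i j * (c1 * v j * (x / ε i j) ^ δ) ≤ a i j * (c1 * v j * (x ^ δ * κ0)) := by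
                      gcongr
                  _ = _ := by ring
              · simp [← h]
          _ = c1 * x ^ δ * κ0 * ∑ j ∈ Tᶜ, a i j * v j := by
              rw [Finset.sum_ite_mem, Finset.univ_inter, Finset.mul_sum]
          _ ≤ c1 * x ^ δ * κ0 * (v i - 1) := by
              gcongr
              linarith
          _ = c1 * x ^ δ * (κ0 * (v i - 1)) := by ring
          _ ≤ c1 * x ^ δ * v i := by
              gcongr
              exact hvκ i
          _ = _ := by ring
      · have hBi : B i x = C2 * v i := by simp [hB, hiT, hiL]
        rw [hBi]
        calc ∑ j, a i j * B j (x / ε i j)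
            ≤ ∑ j, ((if j ∈ Tᶜ then C2 * (a i j * v j) else 0) + a i j * D) := by
              refine Finset.sum_le_sum fun j _ => ?_
              rcases (ha i j).lt_or_eq with h | h
              · obtain ⟨hp1, hp2⟩ := hpowle x hx0 hx1 i j h
                have hvj := hv1 j
                have hvj2 : v j ≤ V := hvmax j
                have huj2 : u j ≤ u2 := himax j
                have huj := hupos j
                have hq0 : 0 ≤ (x / ε i j) ^ δ := le_trans (by positivity) hp1
                by_cases hjT : j ∈ T
                · simp only [hB, hjT, if_true, Finset.mem_compl, not_true_eq_false, if_false,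
                    zero_add]
                  apply mul_le_mul_of_nonneg_left _ h.le
                  have e1 : u j * (K - Lc * (x / ε i j) ^ δ) ≤ u j * K := by
                    apply mul_le_mul_of_nonneg_left _ huj.le
                    have : 0 ≤ Lc * (x / ε i j) ^ δ := mul_nonneg hLc0 hq0
                    linarith
                  have e2 : u j * K ≤ u2 * K := mul_le_mul_of_nonneg_right huj2 hK0.le
                  have e3 : 0 ≤ c1 * V * κ0 := by positivity
                  rw [hD]; linarith
                · by_cases hjL : Low j
                  · simp only [hB, hjT, hjL, if_true, if_false, Finset.mem_compl,
                      not_false_eq_true]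
                    have e0 : 0 ≤ C2 * (a i j * v j) := by positivity
                    have e1 : a i j * (c1 * v j * (x / ε i j) ^ δ) ≤ a i j * D := by
                      apply mul_le_mul_of_nonneg_left _ h.le
                      have : c1 * v j * (x / ε i j) ^ δ ≤ c1 * V * (1 * κ0) := by
                        gcongr
                        exact hp2.trans (by gcongr)
                      have : 0 ≤ K * u2 := by positivity
                      rw [hD]; linarith
                    linarith
                  · simp only [hB, hjT, hjL, if_true, if_false, Finset.mem_compl,
                      not_false_eq_true]
                    have e0 : 0 ≤ a i j * D := by positivity
                    have e1 : a i j * (C2 * v j) = C2 * (a i j * v j) := by ring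
                    linarith
              · simp [← h]
          _ = C2 * (∑ j ∈ Tᶜ, a i j * v j) + (∑ j, a i j) * D := by
              rw [Finset.sum_add_distrib, Finset.sum_ite_mem, Finset.univ_inter, Finset.mul_sum,
                Finset.sum_mul]
          _ ≤ C2 * (v i - 1) + As * D := by
              have e1 : C2 * (∑ j ∈ Tᶜ, a i j * v j) ≤ C2 * (v i - 1) := by
                apply mul_le_mul_of_nonneg_left _ hC20.le
                linarith
              have e2 : (∑ j, a i j) * D ≤ As * D := mul_le_mul_of_nonneg_right (hamax i) hD0
              linarith
          _ ≤ C2 * v i := by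
              have : As * D ≤ C2 := by rw [hC2]; linarith
              linarith
  · intro i x hx0 hx1
    have hxδ0 : 0 < x ^ δ := by positivity
    have hxδ1 : x ^ δ ≤ 1 := Real.rpow_le_one hx0.le hx1 hδ0.le
    have hvi := hv1 i
    have hvi2 : v i ≤ V := hvmax i
    have hui2 : u i ≤ u2 := himax i
    have hui := hupos i
    have f1 : 0 ≤ K * u2 := by positivity
    have f2 : 0 ≤ c1 * V := by positivity
    have f3 : 0 ≤ C2 * V := by positivity
    simp only [hB]
    split_ifs with h1 h2
    · have e1 : u i * (K - Lc * x ^ δ) ≤ u i * K := by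
        apply mul_le_mul_of_nonneg_left _ hui.le
        have : 0 ≤ Lc * x ^ δ := by positivity
        linarith
      have e2 : u i * K ≤ u2 * K := mul_le_mul_of_nonneg_right hui2 hK0.le
      linarith
    · have : c1 * v i * x ^ δ ≤ c1 * V * 1 := by gcongr
      linarith
    · have : C2 * v i ≤ C2 * V := by gcongr
      linarith

/-- The geometric and measure-theoretic facts on cylinder sets that are used below. -/
structure Geo {N : ℕ} {E : Type*} [MetricSpace E] [MeasurableSpace E]
    (p c : Fin N → Fin N → ℝ) (J : List (Fin N) → Set E) (μ : Measure E) (t : ℝ) : Prop where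
  adm : ∀ (σ : List (Fin N)) (i j : Fin N), Adm p (σ ++ [i]) → 0 < p i j →
    Adm p (σ ++ [i] ++ [j])
  cpt : ∀ (σ : List (Fin N)) (i : Fin N), Adm p (σ ++ [i]) → IsCompact (J (σ ++ [i]))
  ne : ∀ (σ : List (Fin N)) (i : Fin N), Adm p (σ ++ [i]) → (J (σ ++ [i])).Nonempty
  dpos : ∀ (σ : List (Fin N)) (i : Fin N), Adm p (σ ++ [i]) → 0 < diam (J (σ ++ [i]))
  mpos : ∀ (σ : List (Fin N)) (i : Fin N), Adm p (σ ++ [i]) → 0 < μ.real (J (σ ++ [i]))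
  sub : ∀ (σ : List (Fin N)) (i j : Fin N), Adm p (σ ++ [i]) → 0 < p i j →
    J (σ ++ [i] ++ [j]) ⊆ J (σ ++ [i])
  dmul : ∀ (σ : List (Fin N)) (i j : Fin N), Adm p (σ ++ [i]) → 0 < p i j →
    diam (J (σ ++ [i] ++ [j])) = c i j * diam (J (σ ++ [i]))
  mmul : ∀ (σ : List (Fin N)) (i j : Fin N), Adm p (σ ++ [i]) → 0 < p i j →
    μ.real (J (σ ++ [i] ++ [j])) = p i j * μ.real (J (σ ++ [i]))
  sep : ∀ (σ : List (Fin N)) (i₁ i₂ : Fin N), i₁ ≠ i₂ →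
      Adm p (σ ++ [i₁]) → Adm p (σ ++ [i₂]) →
      ∀ x ∈ J (σ ++ [i₁]), ∀ y ∈ J (σ ++ [i₂]),
        t * max (diam (J (σ ++ [i₁]))) (diam (J (σ ++ [i₂]))) ≤ dist x y

theorem adm_iff {N : ℕ} (p : Fin N → Fin N → ℝ) (σ : List (Fin N)) (i j : Fin N) :
    Adm p (σ ++ [i, j]) ↔ Adm p (σ ++ [i]) ∧ 0 < p i j := by
  have h : List.IsChain (fun a b => 0 < p a b) (σ ++ [i, j]) ↔
      List.IsChain (fun a b => 0 < p a b) (σ ++ [i]) ∧ 0 < p i j := by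
    rw [List.isChain_append_cons_cons]
    simp
  exact h

theorem cylMass_snoc {N : ℕ} (χ : Fin N → ℝ) (p : Fin N → Fin N → ℝ) (σ : List (Fin N))
    (i j : Fin N) : cylMass χ p (σ ++ [i, j]) = cylMass χ p (σ ++ [i]) * p i j := by
  have key : ∀ (l : List (Fin N)) (a : Fin N),
      (((a :: (l ++ [i, j])).zip (l ++ [i, j])).map (fun ab => p ab.1 ab.2)).prod =
      (((a :: (l ++ [i])).zip (l ++ [i])).map (fun ab => p ab.1 ab.2)).prod * p i j := by
    intro l
    induction l with
    | nil => intro a; simp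
    | cons b l ih =>
      intro a
      have := ih b
      simp only [List.cons_append, List.zip_cons_cons, List.map_cons, List.prod_cons] at this ⊢
      rw [this]; ring
  cases σ with
  | nil => simp [cylMass]
  | cons a l =>
    simp only [List.cons_append, cylMass]
    rw [key l a]; ring

theorem cylMass_pos {N : ℕ} (χ : Fin N → ℝ) (p : Fin N → Fin N → ℝ) (hχ : ∀ i, 0 < χ i)
    (σ : List (Fin N)) : ∀ (i : Fin N), Adm p (σ ++ [i]) → 0 < cylMass χ p (σ ++ [i]) := by
  induction σ using List.reverseRecOn with
  | nil => intro i _; simpa [cylMass] using hχ i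
  | append_singleton l k ih =>
    intro i h
    simp only [List.append_assoc, List.cons_append, List.nil_append] at h ⊢
    rw [cylMass_snoc]
    obtain ⟨h1, h2⟩ := (adm_iff p l k i).1 h
    exact mul_pos (ih k h1) h2

theorem base_diam_pos {d N : ℕ} (hN : 2 ≤ N)
    (J : List (Fin N) → Set (EuclideanSpace ℝ (Fin d)))
    (hJbase : ∀ i : Fin N, IsCompact (J [i]) ∧ (J [i]).Nonempty ∧
      J [i] = closure (interior (J [i])))
    (χ : Fin N → ℝ) (hχ : ∀ i, 0 < χ i) (hχ1 : ∑ i, χ i = 1)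
    (μ : Measure (EuclideanSpace ℝ (Fin d))) [IsProbabilityMeasure μ]
    (hμ : ∀ i, μ.real (J [i]) = χ i) (i : Fin N) : 0 < diam (J [i]) := by
  obtain ⟨hc, hne, hcl⟩ := hJbase i
  rcases Nat.eq_zero_or_pos d with hd | hd
  · exfalso
    subst hd
    have hall : ∀ k, χ k = 1 := by
      intro k
      rw [← hμ k]
      have : J [k] = Set.univ := by
        obtain ⟨x, hx⟩ := (hJbase k).2.1
        ext y
        simp [Subsingleton.elim y x, hx]
      rw [this]; simp
    simp [hall] at hχ1
    have : (2:ℝ) ≤ N := by exact_mod_cast hN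
    have h1 : (N:ℝ) = 1 := by exact_mod_cast hχ1
    linarith
  · refine diam_pos ?_ hc.isBounded
    by_contra hnt
    rw [Set.not_nontrivial_iff] at hnt
    have hintg : (interior (J [i])).Nonempty := by
      rw [Set.nonempty_iff_ne_empty]
      intro h0
      rw [h0, closure_empty] at hcl
      rw [hcl] at hne
      exact Set.not_nonempty_empty hne
    obtain ⟨x, hx⟩ := hintg
    have hs : interior (J [i]) = {x} := by
      apply Set.Subsingleton.eq_singleton_of_mem _ hx
      exact hnt.anti interior_subset
    have ho : IsOpen ({x} : Set (EuclideanSpace ℝ (Fin d))) := by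
      rw [← hs]; exact isOpen_interior
    haveI : Nonempty (Fin d) := ⟨⟨0, hd⟩⟩
    haveI : Nontrivial (EuclideanSpace ℝ (Fin d)) := inferInstance
    haveI : (nhdsWithin x {x}ᶜ).NeBot := Module.punctured_nhds_neBot ℝ _ x
    exact not_isOpen_singleton x ho

theorem geo_of {d N : ℕ} (hN : 2 ≤ N)
    (p : Fin N → Fin N → ℝ)
    (c : Fin N → Fin N → ℝ) (hc : ∀ i j, 0 < c i j ∧ c i j < 1)
    (J : List (Fin N) → Set (EuclideanSpace ℝ (Fin d)))
    (hJbase : ∀ i : Fin N, IsCompact (J [i]) ∧ (J [i]).Nonempty ∧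
      J [i] = closure (interior (J [i])))
    (hJsub : ∀ (σ : List (Fin N)) (i j : Fin N), Adm p (σ ++ [i, j]) →
      J (σ ++ [i, j]) ⊆ J (σ ++ [i]))
    (hJsim : ∀ (σ : List (Fin N)) (i j : Fin N), Adm p (σ ++ [i, j]) →
      ∃ (S : EuclideanSpace ℝ (Fin d) → EuclideanSpace ℝ (Fin d)) (ρ : ℝ), 0 < ρ ∧
        (∀ x y, dist (S x) (S y) = ρ * dist x y) ∧ S '' J [j] = J (σ ++ [i, j]))
    (hJdiam : ∀ (σ : List (Fin N)) (i j : Fin N), Adm p (σ ++ [i, j]) →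
      diam (J (σ ++ [i, j])) = c i j * diam (J (σ ++ [i])))
    (t : ℝ) (hA2 : ∀ (σ : List (Fin N)) (i₁ i₂ : Fin N), i₁ ≠ i₂ →
      Adm p (σ ++ [i₁]) → Adm p (σ ++ [i₂]) →
      ∀ x ∈ J (σ ++ [i₁]), ∀ y ∈ J (σ ++ [i₂]),
        t * max (diam (J (σ ++ [i₁]))) (diam (J (σ ++ [i₂]))) ≤ dist x y)
    (χ : Fin N → ℝ) (hχ : ∀ i, 0 < χ i) (hχ1 : ∑ i, χ i = 1)
    (μ : Measure (EuclideanSpace ℝ (Fin d))) [IsProbabilityMeasure μ]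
    (hμ : ∀ σ : List (Fin N), σ ≠ [] → Adm p σ → μ (J σ) = ENNReal.ofReal (cylMass χ p σ)) :
    Geo p c J μ t ∧ ∀ i, μ.real (J [i]) = χ i := by
  have hreal : ∀ (σ : List (Fin N)) (i : Fin N), Adm p (σ ++ [i]) →
      μ.real (J (σ ++ [i])) = cylMass χ p (σ ++ [i]) := by
    intro σ i h
    rw [Measure.real, hμ _ (by simp) h, ENNReal.toReal_ofReal (cylMass_pos χ p hχ σ i h).le]
  have hadm1 : ∀ i : Fin N, Adm p ([] ++ [i]) := by
    intro i
    have h : List.IsChain (fun a b => 0 < p a b) ([] ++ [i]) := by simp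
    exact h
  have hχr : ∀ i, μ.real (J [i]) = χ i := by
    intro i
    have := hreal [] i (hadm1 i)
    simpa [cylMass] using this
  have hcpt : ∀ (σ : List (Fin N)) (i : Fin N), Adm p (σ ++ [i]) →
      IsCompact (J (σ ++ [i])) ∧ (J (σ ++ [i])).Nonempty := by
    intro σ i h
    rcases List.eq_nil_or_concat σ with rfl | ⟨l, k, rfl⟩
    · exact ⟨(hJbase i).1, (hJbase i).2.1⟩
    · simp only [List.concat_eq_append, List.append_assoc, List.cons_append,
        List.nil_append] at h ⊢
      obtain ⟨S, ρ, hρ, hS, hi⟩ := hJsim l k i h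
      rw [← hi]
      have hcont : Continuous S := by
        apply LipschitzWith.continuous (K := ⟨ρ, hρ.le⟩)
        apply LipschitzWith.of_dist_le_mul
        intro x y
        rw [hS]; rfl
      exact ⟨(hJbase i).1.image hcont, (hJbase i).2.1.image S⟩
  have hd : ∀ (σ : List (Fin N)) (i : Fin N), Adm p (σ ++ [i]) → 0 < diam (J (σ ++ [i])) := by
    intro σ
    induction σ using List.reverseRecOn with
    | nil => intro i _; exact base_diam_pos hN J hJbase χ hχ hχ1 μ hχr i
    | append_singleton l k ih =>
      intro i h
      simp only [List.append_assoc, List.cons_append, List.nil_append] at h ⊢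
      rw [hJdiam _ _ _ h]
      exact mul_pos (hc k i).1 (ih k ((adm_iff p l k i).1 h).1)
  refine ⟨⟨?_, fun σ i h => (hcpt σ i h).1, fun σ i h => (hcpt σ i h).2, hd, ?_, ?_, ?_, ?_, hA2⟩,
    hχr⟩
  · intro σ i j h hp
    rw [List.append_assoc]
    exact (adm_iff p σ i j).2 ⟨h, hp⟩
  · intro σ i h
    rw [hreal σ i h]
    exact cylMass_pos χ p hχ σ i h
  · intro σ i j h hp
    rw [List.append_assoc]
    exact hJsub σ i j ((adm_iff p σ i j).2 ⟨h, hp⟩)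
  · intro σ i j h hp
    rw [List.append_assoc]
    exact hJdiam σ i j ((adm_iff p σ i j).2 ⟨h, hp⟩)
  · intro σ i j h hp
    have h2 := (adm_iff p σ i j).2 ⟨h, hp⟩
    have e : σ ++ [i] ++ [j] = σ ++ [i, j] := by simp
    rw [hreal (σ ++ [i]) j (by rw [e]; exact h2), hreal σ i h, e, cylMass_snoc, mul_comm]

noncomputable def En {N : ℕ} {E : Type*} [MetricSpace E] [MeasurableSpace E]
    (J : List (Fin N) → Set E) (μ : Measure E) (r : ℝ) (τ : List (Fin N)) : ℝ :=
  μ.real (J τ) * diam (J τ) ^ r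

section GeoPart

variable {N : ℕ} {E : Type*} [MetricSpace E] [MeasurableSpace E] [BorelSpace E]
  {p c : Fin N → Fin N → ℝ} {J : List (Fin N) → Set E} {μ : Measure E} [IsProbabilityMeasure μ]
  {t : ℝ}

theorem En_pos (hg : Geo p c J μ t) (r : ℝ) (σ : List (Fin N)) (i : Fin N)
    (h : Adm p (σ ++ [i])) : 0 < En J μ r (σ ++ [i]) :=
  mul_pos (hg.mpos σ i h) (Real.rpow_pos_of_pos (hg.dpos σ i h) r)

theorem En_mul (hg : Geo p c J μ t) (hc : ∀ i j, 0 < c i j ∧ c i j < 1) (r : ℝ)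
    (σ : List (Fin N)) (i j : Fin N)
    (h : Adm p (σ ++ [i])) (hp : 0 < p i j) :
    En J μ r (σ ++ [i] ++ [j]) = (p i j * c i j ^ r) * En J μ r (σ ++ [i]) := by
  unfold En
  rw [hg.mmul σ i j h hp, hg.dmul σ i j h hp, Real.mul_rpow (hc i j).1.le diam_nonneg]
  ring

theorem geo_disj (hg : Geo p c J μ t) (ht : 0 < t) (σ : List (Fin N)) (i₁ i₂ : Fin N)
    (hne : i₁ ≠ i₂) (h₁ : Adm p (σ ++ [i₁])) (h₂ : Adm p (σ ++ [i₂])) :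
    Disjoint (J (σ ++ [i₁])) (J (σ ++ [i₂])) := by
  rw [Set.disjoint_left]
  intro x hx hx2
  have := hg.sep σ i₁ i₂ hne h₁ h₂ x hx x hx2
  rw [dist_self] at this
  have h3 : 0 < t * max (diam (J (σ ++ [i₁]))) (diam (J (σ ++ [i₂]))) :=
    mul_pos ht (lt_max_of_lt_left (hg.dpos σ i₁ h₁))
  linarith

theorem null_rest (hg : Geo p c J μ t) (ht : 0 < t) (hp0 : ∀ i j, 0 ≤ p i j)
    (hrow : ∀ i, ∑ j, p i j = 1) (σ : List (Fin N)) (i : Fin N) (h : Adm p (σ ++ [i])) :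
    μ (J (σ ++ [i]) \ ⋃ j ∈ Finset.univ.filter (fun j => 0 < p i j), J (σ ++ [i] ++ [j])) = 0 := by
  set F := Finset.univ.filter (fun j => 0 < p i j) with hF
  have hFm : ∀ j ∈ F, 0 < p i j := by intro j hj; simpa [hF] using hj
  have hmeas : ∀ j ∈ F, MeasurableSet (J (σ ++ [i] ++ [j])) := fun j hj =>
    (hg.cpt _ j (hg.adm σ i j h (hFm j hj))).isClosed.measurableSet
  have hU : μ.real (⋃ j ∈ F, J (σ ++ [i] ++ [j])) = μ.real (J (σ ++ [i])) := by
    rw [measureReal_biUnion_finset]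
    · rw [Finset.sum_congr rfl (fun j hj => hg.mmul σ i j h (hFm j hj)), ← Finset.sum_mul]
      have : ∑ j ∈ F, p i j = 1 := by
        rw [← hrow i, hF, Finset.sum_filter]
        apply Finset.sum_congr rfl
        intro j _
        split_ifs with hj
        · rfl
        · exact le_antisymm (hp0 i j) (not_lt.1 hj)
      rw [this, one_mul]
    · intro j hj k hk hjk
      exact geo_disj hg ht _ j k hjk (hg.adm σ i j h (hFm j hj)) (hg.adm σ i k h (hFm k hk))
    · exact hmeas
  have hsub : (⋃ j ∈ F, J (σ ++ [i] ++ [j])) ⊆ J (σ ++ [i]) :=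
    Set.iUnion₂_subset fun j hj => hg.sub σ i j h (hFm j hj)
  have hms : MeasurableSet (⋃ j ∈ F, J (σ ++ [i] ++ [j])) := F.measurableSet_biUnion hmeas
  have := measureReal_diff (μ := μ) hsub hms
  rw [hU, sub_self] at this
  exact (measureReal_eq_zero_iff (by finiteness)).1 this

theorem upper_cyl (hg : Geo p c J μ t) (ht : 0 < t) (hp0 : ∀ i j, 0 ≤ p i j)
    (hrow : ∀ i, ∑ j, p i j = 1) (hc : ∀ i j, 0 < c i j ∧ c i j < 1) (r : ℝ) (hr : 0 < r)
    (e0 lam : ℝ) (he0 : 0 < e0) (hl0 : 0 < lam)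
    (hε : ∀ i j, 0 < p i j → e0 ≤ p i j * c i j ^ r ∧ p i j * c i j ^ r ≤ lam)
    (R : Fin N → ℝ → ℝ) (hR1 : ∀ i x, 1 < x → x ≤ 1 / e0 → 1 ≤ R i x)
    (hR2 : ∀ i x, 0 < x → x ≤ 1 →
      ∑ j ∈ Finset.univ.filter (fun j => 0 < p i j), R j (x / (p i j * c i j ^ r)) ≤ R i x)
    (m : ℕ) : ∀ x, lam ^ m < x → x ≤ 1 / e0 → ∀ (σ : List (Fin N)) (i : Fin N),
      Adm p (σ ++ [i]) → ∃ α : Finset E, α.Nonempty ∧ (α.card : ℝ) ≤ R i x ∧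
      ∫⁻ y in J (σ ++ [i]), ENNReal.ofReal (infDist y (α : Set E) ^ r) ∂μ ≤
        ENNReal.ofReal (En J μ r (σ ++ [i]) * x * R i x) := by
  classical
  have base : ∀ x, 1 < x → x ≤ 1 / e0 → ∀ (σ : List (Fin N)) (i : Fin N),
      Adm p (σ ++ [i]) → ∃ α : Finset E, α.Nonempty ∧ (α.card : ℝ) ≤ R i x ∧
      ∫⁻ y in J (σ ++ [i]), ENNReal.ofReal (infDist y (α : Set E) ^ r) ∂μ ≤
        ENNReal.ofReal (En J μ r (σ ++ [i]) * x * R i x) := by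
    intro x hx1 hx2 σ i h
    obtain ⟨b, hb⟩ := hg.ne σ i h
    have hR := hR1 i x hx1 hx2
    refine ⟨{b}, by simp, by simpa using hR, ?_⟩
    have hcp := hg.cpt σ i h
    calc ∫⁻ y in J (σ ++ [i]), ENNReal.ofReal (infDist y (({b} : Finset E) : Set E) ^ r) ∂μ
        ≤ ∫⁻ y in J (σ ++ [i]), ENNReal.ofReal (diam (J (σ ++ [i])) ^ r) ∂μ := by
          apply setLIntegral_mono' hcp.isClosed.measurableSet
          intro y hy
          apply ENNReal.ofReal_le_ofReal
          apply Real.rpow_le_rpow infDist_nonneg _ hr.le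
          simp only [Finset.coe_singleton, infDist_singleton]
          exact dist_le_diam_of_mem hcp.isBounded hy hb
      _ = ENNReal.ofReal (En J μ r (σ ++ [i])) := by
          rw [setLIntegral_const, ← ofReal_measureReal, ← ENNReal.ofReal_mul (by positivity), En,
            mul_comm]
      _ ≤ _ := by
          apply ENNReal.ofReal_le_ofReal
          have hE := En_pos hg r σ i h
          rw [mul_assoc]
          apply le_mul_of_one_le_right hE.le
          nlinarith
  induction m with
  | zero => intro x hx; rw [pow_zero] at hx; exact base x hx
  | succ m ih =>
    intro x hx1 hx2 σ i h
    rcases lt_or_ge 1 x with hx | hx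
    · exact base x hx hx2 σ i h
    have hx0 : 0 < x := lt_trans (by positivity) hx1
    set F := Finset.univ.filter (fun j => 0 < p i j) with hF
    have hFm : ∀ j ∈ F, 0 < p i j := by intro j hj; simpa [hF] using hj
    have hεp : ∀ j ∈ F, 0 < p i j * c i j ^ r := fun j hj =>
      lt_of_lt_of_le he0 (hε i j (hFm j hj)).1
    have hch : ∀ j : Fin N, ∃ α : Finset E, j ∈ F → (α.Nonempty ∧
        (α.card : ℝ) ≤ R j (x / (p i j * c i j ^ r)) ∧
      ∫⁻ y in J (σ ++ [i] ++ [j]), ENNReal.ofReal (infDist y (α : Set E) ^ r) ∂μ ≤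
        ENNReal.ofReal (En J μ r (σ ++ [i]) * x * R j (x / (p i j * c i j ^ r)))) := by
      intro j
      by_cases hj : j ∈ F
      · have hpj := hFm j hj
        have hej := hε i j hpj
        have hep := hεp j hj
        obtain ⟨α, h1, h2, h3⟩ := ih (x / (p i j * c i j ^ r))
          (by
            rw [lt_div_iff₀ hep]
            calc lam ^ m * (p i j * c i j ^ r) ≤ lam ^ m * lam := by gcongr; exact hej.2
              _ = lam ^ (m + 1) := by ring
              _ < x := hx1)
          (div_le_div₀ zero_le_one hx he0 hej.1) (σ ++ [i]) j (hg.adm σ i j h hpj)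
        refine ⟨α, fun _ => ⟨h1, h2, h3.trans (le_of_eq ?_)⟩⟩
        rw [En_mul hg hc r σ i j h hpj]
        congr 1
        have key : ∀ e E' R' : ℝ, 0 < e → e * E' * (x / e) * R' = E' * x * R' := by
          intro e E' R' he
          field_simp
        exact key _ _ _ hep
      · exact ⟨∅, fun h => absurd h hj⟩
    choose A hA using hch
    have hFne : F.Nonempty := by
      by_contra hcon
      have : ∑ j, p i j = 0 := by
        apply Finset.sum_eq_zero
        intro j _
        by_contra hj
        exact hcon ⟨j, by simp [hF, lt_of_le_of_ne (hp0 i j) (Ne.symm hj)]⟩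
      rw [hrow] at this; norm_num at this
    have hR2' := hR2 i x hx0 hx
    rw [← hF] at hR2'
    have hE := En_pos hg r σ i h
    refine ⟨F.biUnion A, ?_, ?_, ?_⟩
    · obtain ⟨j, hj⟩ := hFne
      exact Finset.Nonempty.biUnion ⟨j, hj⟩ (fun k hk => (hA k hk).1)
    · calc ((F.biUnion A).card : ℝ) ≤ ((∑ j ∈ F, (A j).card : ℕ) : ℝ) := by
            exact_mod_cast Finset.card_biUnion_le
        _ = ∑ j ∈ F, ((A j).card : ℝ) := by push_cast; rfl
        _ ≤ ∑ j ∈ F, R j (x / (p i j * c i j ^ r)) := Finset.sum_le_sum fun j hj => (hA j hj).2.1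
        _ ≤ R i x := hR2'
    · set U := ⋃ j ∈ F, J (σ ++ [i] ++ [j]) with hU
      have hnull := null_rest hg ht hp0 hrow σ i h
      rw [← hF, ← hU] at hnull
      set f : E → ℝ≥0∞ := fun y => ENNReal.ofReal (infDist y (F.biUnion A : Set E) ^ r) with hf
      have hmeas : ∀ j ∈ F, MeasurableSet (J (σ ++ [i] ++ [j])) := fun j hj =>
        (hg.cpt _ j (hg.adm σ i j h (hFm j hj))).isClosed.measurableSet
      calc ∫⁻ y in J (σ ++ [i]), f y ∂μ
          ≤ ∫⁻ y in (J (σ ++ [i]) \ U) ∪ U, f y ∂μ := by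
            apply lintegral_mono_set
            intro y hy
            by_cases hyU : y ∈ U
            · exact Or.inr hyU
            · exact Or.inl ⟨hy, hyU⟩
        _ ≤ ∫⁻ y in (J (σ ++ [i]) \ U), f y ∂μ + ∫⁻ y in U, f y ∂μ := lintegral_union_le _ _ _
        _ = ∫⁻ y in U, f y ∂μ := by rw [setLIntegral_measure_zero _ _ hnull, zero_add]
        _ = ∑ j ∈ F, ∫⁻ y in J (σ ++ [i] ++ [j]), f y ∂μ := by
            rw [hU, lintegral_biUnion_finset]
            · intro j hj k hk hjk
              exact geo_disj hg ht _ j k hjk (hg.adm σ i j h (hFm j hj))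
                (hg.adm σ i k h (hFm k hk))
            · exact hmeas
        _ ≤ ∑ j ∈ F, ENNReal.ofReal (En J μ r (σ ++ [i]) * x * R j (x / (p i j * c i j ^ r))) := by
            apply Finset.sum_le_sum
            intro j hj
            refine le_trans ?_ (hA j hj).2.2
            apply lintegral_mono
            intro y
            apply ENNReal.ofReal_le_ofReal
            apply Real.rpow_le_rpow infDist_nonneg _ hr.le
            apply infDist_le_infDist_of_subset
            · exact_mod_cast Finset.subset_biUnion_of_mem A hj
            · exact_mod_cast (hA j hj).1
        _ = ENNReal.ofReal (∑ j ∈ F, En J μ r (σ ++ [i]) * x * R j (x / (p i j * c i j ^ r))) := by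
            rw [ENNReal.ofReal_sum_of_nonneg]
            intro j hj
            have : 0 ≤ R j (x / (p i j * c i j ^ r)) := le_trans (by positivity) (hA j hj).2.1
            positivity
        _ ≤ _ := by
            apply ENNReal.ofReal_le_ofReal
            rw [← Finset.mul_sum]
            gcongr

theorem null_base (hg : Geo p c J μ t) (ht : 0 < t)
    (hadm : ∀ i : Fin N, Adm p ([] ++ [i])) (hsum : ∑ i, μ.real (J ([] ++ [i])) = 1) :
    μ ((⋃ i : Fin N, J ([] ++ [i]))ᶜ) = 0 := by
  have hmeas : ∀ i : Fin N, MeasurableSet (J ([] ++ [i])) := fun i =>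
    (hg.cpt _ i (hadm i)).isClosed.measurableSet
  have h1 : μ.real (⋃ i : Fin N, J ([] ++ [i])) = 1 := by
    have := measureReal_biUnion_finset (μ := μ) (s := (Finset.univ : Finset (Fin N)))
      (f := fun i => J ([] ++ [i]))
      (fun i _ k _ hik => geo_disj hg ht _ i k hik (hadm i) (hadm k)) (fun i _ => hmeas i)
    rw [hsum] at this
    simpa using this
  have h2 : μ.real ((⋃ i : Fin N, J ([] ++ [i]))ᶜ) = 0 := by
    rw [probReal_compl_eq_one_sub (MeasurableSet.iUnion hmeas), h1, sub_self]
  exact (measureReal_eq_zero_iff (by finiteness)).1 h2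

theorem upper_glob (hN : 0 < N) (hg : Geo p c J μ t) (ht : 0 < t) (hp0 : ∀ i j, 0 ≤ p i j)
    (hrow : ∀ i, ∑ j, p i j = 1) (hc : ∀ i j, 0 < c i j ∧ c i j < 1) (r : ℝ) (hr : 0 < r)
    (e0 lam : ℝ) (he0 : 0 < e0) (he1 : e0 < 1) (hl0 : 0 < lam) (hl1 : lam < 1)
    (hε : ∀ i j, 0 < p i j → e0 ≤ p i j * c i j ^ r ∧ p i j * c i j ^ r ≤ lam)
    (hadm : ∀ i : Fin N, Adm p ([] ++ [i])) (hsum : ∑ i, μ.real (J ([] ++ [i])) = 1)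
    (R : Fin N → ℝ → ℝ) (hR1 : ∀ i x, 1 < x → x ≤ 1 / e0 → 1 ≤ R i x)
    (hR2 : ∀ i x, 0 < x → x ≤ 1 →
      ∑ j ∈ Finset.univ.filter (fun j => 0 < p i j), R j (x / (p i j * c i j ^ r)) ≤ R i x)
    (x : ℝ) (hx0 : 0 < x) (hx1 : x ≤ 1) :
    ∃ α : Finset E, α.Nonempty ∧ (α.card : ℝ) ≤ ∑ i, R i x ∧
      ∫ y, infDist y (α : Set E) ^ r ∂μ ≤ ∑ i, En J μ r ([] ++ [i]) * x * R i x := by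
  classical
  obtain ⟨m, hm⟩ := exists_pow_lt_of_lt_one hx0 hl1
  have hx2 : x ≤ 1 / e0 := hx1.trans (by rw [le_div_iff₀ he0]; linarith)
  have H := fun i : Fin N => upper_cyl hg ht hp0 hrow hc r hr e0 lam he0 hl0 hε R hR1 hR2 m x hm hx2
    [] i (hadm i)
  choose A hA1 hA2 hA3 using H
  have hRn : ∀ i, 0 ≤ R i x := fun i => le_trans (by positivity) (hA2 i)
  refine ⟨Finset.univ.biUnion A, ?_, ?_, ?_⟩
  · exact Finset.Nonempty.biUnion ⟨⟨0, hN⟩, Finset.mem_univ _⟩ (fun k _ => hA1 k)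
  · calc ((Finset.univ.biUnion A).card : ℝ) ≤ ((∑ j, (A j).card : ℕ) : ℝ) := by
            exact_mod_cast Finset.card_biUnion_le
        _ = ∑ j, ((A j).card : ℝ) := by push_cast; rfl
        _ ≤ _ := Finset.sum_le_sum fun j hj => hA2 j
  · have hnn : 0 ≤ ∑ i, En J μ r ([] ++ [i]) * x * R i x := by
      apply Finset.sum_nonneg
      intro i _
      have := En_pos hg r [] i (hadm i)
      have := hRn i
      positivity
    rw [integral_eq_lintegral_of_nonneg_ae (Eventually.of_forall fun y => Real.rpow_nonneg infDist_nonneg r)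
      (by
        apply Measurable.aestronglyMeasurable
        have : Measurable fun y => infDist y ((Finset.univ.biUnion A : Finset E) : Set E) :=
          measurable_infDist
        fun_prop)]
    apply ENNReal.toReal_le_of_le_ofReal hnn
    set f : E → ℝ≥0∞ :=
      fun y => ENNReal.ofReal (infDist y (Finset.univ.biUnion A : Set E) ^ r) with hf
    set U := ⋃ i : Fin N, J ([] ++ [i]) with hU
    have hnull : μ Uᶜ = 0 := null_base hg ht hadm hsum
    calc ∫⁻ y, f y ∂μ = ∫⁻ y in Uᶜ ∪ U, f y ∂μ := by simp
      _ ≤ ∫⁻ y in Uᶜ, f y ∂μ + ∫⁻ y in U, f y ∂μ := lintegral_union_le _ _ _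
      _ = ∫⁻ y in U, f y ∂μ := by rw [setLIntegral_measure_zero _ _ hnull, zero_add]
      _ = ∫⁻ y in ⋃ i ∈ (Finset.univ : Finset (Fin N)), J ([] ++ [i]), f y ∂μ := by simp [hU]
      _ = ∑ j, ∫⁻ y in J ([] ++ [j]), f y ∂μ := by
            rw [lintegral_biUnion_finset]
            · intro j hj k hk hjk
              exact geo_disj hg ht _ j k hjk (hadm j) (hadm k)
            · exact fun i _ => (hg.cpt _ i (hadm i)).isClosed.measurableSet
      _ ≤ ∑ j, ENNReal.ofReal (En J μ r ([] ++ [j]) * x * R j x) := by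
            apply Finset.sum_le_sum
            intro j hj
            refine le_trans ?_ (hA3 j)
            apply lintegral_mono
            intro y
            apply ENNReal.ofReal_le_ofReal
            apply Real.rpow_le_rpow infDist_nonneg _ hr.le
            apply infDist_le_infDist_of_subset
            · exact_mod_cast Finset.subset_biUnion_of_mem A hj
            · exact_mod_cast hA1 j
      _ = _ := by
            rw [ENNReal.ofReal_sum_of_nonneg]
            intro j hj
            have := hRn j
            have := En_pos hg r [] j (hadm j)
            positivity

theorem quantError_le (r : ℝ) (n : ℕ) (α : Finset E) (h1 : 1 ≤ α.card) (h2 : α.card ≤ n) :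
    quantError μ r n ≤ (∫ x, infDist x (↑α : Set E) ^ r ∂μ) ^ (1 / r) := by
  apply csInf_le
  · refine ⟨0, ?_⟩
    rintro e ⟨β, _, _, rfl⟩
    apply Real.rpow_nonneg
    apply integral_nonneg
    intro x
    exact Real.rpow_nonneg infDist_nonneg r
  · exact ⟨α, h1, h2, rfl⟩

theorem upper_final (hN : 0 < N) (hg : Geo p c J μ t) (ht : 0 < t) (hp0 : ∀ i j, 0 ≤ p i j)
    (hrow : ∀ i, ∑ j, p i j = 1) (hc : ∀ i j, 0 < c i j ∧ c i j < 1) (r : ℝ) (hr : 0 < r)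
    (sr : ℝ) (hsr : 0 < sr)
    (e0 lam : ℝ) (he0 : 0 < e0) (he1 : e0 < 1) (hl0 : 0 < lam) (hl1 : lam < 1)
    (hε : ∀ i j, 0 < p i j → e0 ≤ p i j * c i j ^ r ∧ p i j * c i j ^ r ≤ lam)
    (hadm : ∀ i : Fin N, Adm p ([] ++ [i])) (hsum : ∑ i, μ.real (J ([] ++ [i])) = 1)
    (B : Fin N → ℝ → ℝ) (C : ℝ)
    (hB1 : ∀ i x, 1 < x → x ≤ 1 / e0 → x ^ (sr / (sr + r)) ≤ B i x)
    (hB2 : ∀ i x, 0 < x → x ≤ 1 →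
      ∑ j, (p i j * c i j ^ r) ^ (sr / (sr + r)) * B j (x / (p i j * c i j ^ r)) ≤ B i x)
    (hB3 : ∀ i x, 0 < x → x ≤ 1 → B i x ≤ C) : upperQuantCoeff μ r sr < ∞ := by
  set θ := sr / (sr + r) with hθ
  have hθ0 : 0 < θ := by positivity
  have hNR : (0 : ℝ) < N := by exact_mod_cast hN
  set D : ℝ := N * max C 1 with hD
  have hD0 : 0 < D := by positivity
  set Em : ℝ := ∑ i, En J μ r ([] ++ [i]) with hEm
  have hEn : ∀ i, 0 < En J μ r ([] ++ [i]) := fun i => En_pos hg r [] i (hadm i)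
  have hEm0 : 0 ≤ Em := Finset.sum_nonneg fun i _ => (hEn i).le
  have hG := upper_glob hN hg ht hp0 hrow hc r hr e0 lam he0 he1 hl0 hl1 hε hadm hsum
    (fun i x => x ^ (-θ) * B i x)
    (by
      intro i x h1 h2
      have h0 : 0 < x := by linarith
      calc (1:ℝ) = x ^ (-θ) * x ^ θ := by rw [← Real.rpow_add h0]; simp
        _ ≤ _ := mul_le_mul_of_nonneg_left (hB1 i x h1 h2) (by positivity))
    (by
      intro i x h0 h1
      calc ∑ j ∈ Finset.univ.filter (fun j => 0 < p i j),
            (x / (p i j * c i j ^ r)) ^ (-θ) * B j (x / (p i j * c i j ^ r))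
          = ∑ j ∈ Finset.univ.filter (fun j => 0 < p i j), x ^ (-θ) * ((p i j * c i j ^ r) ^ θ *
              B j (x / (p i j * c i j ^ r))) := by
            apply Finset.sum_congr rfl
            intro j hj
            have hpj : 0 < p i j := by simpa using hj
            have he : 0 < p i j * c i j ^ r := lt_of_lt_of_le he0 (hε i j hpj).1
            rw [Real.div_rpow h0.le he.le, Real.rpow_neg he.le, div_inv_eq_mul]
            ring
        _ = ∑ j, x ^ (-θ) * ((p i j * c i j ^ r) ^ θ * B j (x / (p i j * c i j ^ r))) := by
            apply Finset.sum_subset (Finset.subset_univ _)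
            intro j _ hj
            have hpj : p i j = 0 := le_antisymm (by simpa using hj) (hp0 i j)
            rw [hpj, zero_mul, Real.zero_rpow hθ0.ne']
            ring
        _ ≤ x ^ (-θ) * B i x := by
            rw [← Finset.mul_sum]
            exact mul_le_mul_of_nonneg_left (hB2 i x h0 h1) (by positivity))
  refine lt_of_le_of_lt (b := ENNReal.ofReal ((Em * D ^ (1 / θ)) ^ (1 / r))) ?_
    ENNReal.ofReal_lt_top
  apply limsup_le_of_le
  · isBoundedDefault
  obtain ⟨n0, hn0⟩ := exists_nat_ge D
  filter_upwards [eventually_ge_atTop (max n0 1)] with n hn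
  have hn1 : 1 ≤ n := le_trans (le_max_right _ _) hn
  have hnR : (0:ℝ) < n := by exact_mod_cast hn1
  have hnD : D ≤ n := hn0.trans (by exact_mod_cast le_trans (le_max_left _ _) hn)
  set y : ℝ := n / D with hy
  have hy1 : 1 ≤ y := by rw [hy, le_div_iff₀ hD0]; linarith
  have hy0 : 0 < y := by linarith
  set x : ℝ := y ^ (-(1 / θ)) with hx
  have hx0 : 0 < x := by positivity
  have hx1 : x ≤ 1 := Real.rpow_le_one_of_one_le_of_nonpos hy1 (by
    rw [neg_nonpos]; positivity)
  have hxy : x ^ (-θ) = y := by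
    rw [hx, ← Real.rpow_mul hy0.le]
    have : -(1 / θ) * -θ = 1 := by field_simp
    rw [this, Real.rpow_one]
  obtain ⟨α, hα1, hα2, hα3⟩ := hG x hx0 hx1
  have hR : ∀ i, x ^ (-θ) * B i x ≤ y * max C 1 := by
    intro i
    rw [hxy]
    exact mul_le_mul_of_nonneg_left ((hB3 i x hx0 hx1).trans (le_max_left _ _)) hy0.le
  have hDy : N * (y * max C 1) = n := by
    rw [hy, hD]; field_simp
  have hRn : y * max C 1 ≤ n := by
    have : (1:ℝ) ≤ N := by exact_mod_cast hN
    rw [← hDy]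
    exact le_mul_of_one_le_left (by positivity) this
  have hcard : α.card ≤ n := by
    have : (α.card : ℝ) ≤ n := by
      refine hα2.trans ?_
      rw [← hDy]
      refine (Finset.sum_le_sum fun i _ => hR i).trans ?_
      simp
    exact_mod_cast this
  have hintg : ∫ y, infDist y (α : Set E) ^ r ∂μ ≤ Em * x * n := by
    refine hα3.trans ?_
    rw [hEm, Finset.sum_mul, Finset.sum_mul]
    apply Finset.sum_le_sum
    intro i _
    have := hEn i
    exact mul_le_mul_of_nonneg_left ((hR i).trans hRn) (by positivity)
  have hint0 : 0 ≤ ∫ y, infDist y (α : Set E) ^ r ∂μ :=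
    integral_nonneg fun x => Real.rpow_nonneg infDist_nonneg r
  apply ENNReal.ofReal_le_ofReal
  calc (n:ℝ) ^ (1 / sr) * quantError μ r n
      ≤ (n:ℝ) ^ (1 / sr) * (Em * x * n) ^ (1 / r) := by
        apply mul_le_mul_of_nonneg_left _ (by positivity)
        refine (quantError_le r n α hα1.card_pos hcard).trans ?_
        exact Real.rpow_le_rpow hint0 hintg (by positivity)
    _ = ((n:ℝ) ^ (r / sr) * (Em * x * n)) ^ (1 / r) := by
        rw [Real.mul_rpow (x := (n:ℝ) ^ (r / sr)) (by positivity) (by positivity),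
          ← Real.rpow_mul hnR.le]
        congr 2
        field_simp
    _ = (Em * D ^ (1 / θ)) ^ (1 / r) := by
        congr 1
        have e1 : (n:ℝ) ^ (r / sr) * n = (n:ℝ) ^ (1 / θ) := by
          rw [← Real.rpow_add_one hnR.ne']
          congr 1
          rw [hθ]; field_simp; ring
        have e2 : x = D ^ (1 / θ) / (n:ℝ) ^ (1 / θ) := by
          rw [hx, Real.rpow_neg hy0.le, hy, Real.div_rpow hnR.le hD0.le, inv_div]
        have e3 : (n:ℝ) ^ (r / sr) * (Em * x * n) = Em * x * ((n:ℝ) ^ (r / sr) * n) := by ring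
        rw [e3, e1, e2]
        field_simp

/-- a well separated family of cylinders inside the cylinder `J τ0` with energies bounded below -/
structure Fam {N : ℕ} {E : Type*} [MetricSpace E] [MeasurableSpace E]
    (J : List (Fin N) → Set E) (μ : Measure E) (r t : ℝ) (τ0 : List (Fin N)) (q : ℝ)
    (Γ : Finset (List (Fin N))) : Prop where
  cpt : ∀ τ ∈ Γ, IsCompact (J τ)
  ne : ∀ τ ∈ Γ, (J τ).Nonempty
  dpos : ∀ τ ∈ Γ, 0 < diam (J τ)
  sub : ∀ τ ∈ Γ, J τ ⊆ J τ0
  dle : ∀ τ ∈ Γ, diam (J τ) ≤ diam (J τ0)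
  en : ∀ τ ∈ Γ, q * En J μ r τ0 ≤ En J μ r τ
  sep : ∀ τ ∈ Γ, ∀ τ' ∈ Γ, τ ≠ τ' → ∀ x ∈ J τ, ∀ y ∈ J τ',
    t * max (diam (J τ)) (diam (J τ')) ≤ dist x y

theorem low_union (hg : Geo p c J μ t) (ht : 0 < t) (hp0 : ∀ i j, 0 ≤ p i j)
    (hc : ∀ i j, 0 < c i j ∧ c i j < 1) (r θ e0 c0 : ℝ) (hθ : 0 < θ) (z : Fin N → ℝ) (x : ℝ)
    (hx : 0 < x) (σ : List (Fin N)) (i : Fin N) (h : Adm p (σ ++ [i]))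
    (hch : ∀ j, 0 < p i j → ∃ Γ, Fam J μ r t (σ ++ [i] ++ [j]) (e0 * (x / (p i j * c i j ^ r))) Γ ∧
      c0 * z j * (x / (p i j * c i j ^ r)) ^ (-θ) ≤ (Γ.card : ℝ)) :
    ∃ Γ, Fam J μ r t (σ ++ [i]) (e0 * x) Γ ∧
      c0 * app (fun i j => (p i j * c i j ^ r) ^ θ) z i * x ^ (-θ) ≤ (Γ.card : ℝ) := by
  classical
  have hch' : ∀ j : Fin N, ∃ Γ : Finset (List (Fin N)), 0 < p i j →
      (Fam J μ r t (σ ++ [i] ++ [j]) (e0 * (x / (p i j * c i j ^ r))) Γ ∧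
      c0 * z j * (x / (p i j * c i j ^ r)) ^ (-θ) ≤ (Γ.card : ℝ)) := by
    intro j
    by_cases hj : 0 < p i j
    · obtain ⟨Γ, hΓ⟩ := hch j hj
      exact ⟨Γ, fun _ => hΓ⟩
    · exact ⟨∅, fun h => absurd h hj⟩
  choose G hG using hch'
  set F := Finset.univ.filter (fun j => 0 < p i j) with hF
  have hFm : ∀ j ∈ F, 0 < p i j := by intro j hj; simpa [hF] using hj
  have hεp : ∀ j ∈ F, 0 < p i j * c i j ^ r := fun j hj =>
    mul_pos (hFm j hj) (Real.rpow_pos_of_pos (hc i j).1 r)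
  have hmem : ∀ τ ∈ F.biUnion G, ∃ j, 0 < p i j ∧ τ ∈ G j := by
    intro τ hτ
    obtain ⟨j, hj, hτ⟩ := Finset.mem_biUnion.1 hτ
    exact ⟨j, hFm j hj, hτ⟩
  refine ⟨F.biUnion G, ⟨?_, ?_, ?_, ?_, ?_, ?_, ?_⟩, ?_⟩
  · intro τ hτ
    obtain ⟨j, hj, hτ⟩ := hmem τ hτ
    exact (hG j hj).1.cpt τ hτ
  · intro τ hτ
    obtain ⟨j, hj, hτ⟩ := hmem τ hτ
    exact (hG j hj).1.ne τ hτ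
  · intro τ hτ
    obtain ⟨j, hj, hτ⟩ := hmem τ hτ
    exact (hG j hj).1.dpos τ hτ
  · intro τ hτ
    obtain ⟨j, hj, hτ⟩ := hmem τ hτ
    exact ((hG j hj).1.sub τ hτ).trans (hg.sub σ i j h hj)
  · intro τ hτ
    obtain ⟨j, hj, hτ⟩ := hmem τ hτ
    exact ((hG j hj).1.dle τ hτ).trans
      (diam_mono (hg.sub σ i j h hj) (hg.cpt σ i h).isBounded)
  · intro τ hτ
    obtain ⟨j, hj, hτ⟩ := hmem τ hτ
    refine le_trans (le_of_eq ?_) ((hG j hj).1.en τ hτ)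
    rw [En_mul hg hc r σ i j h hj]
    have key : ∀ e E' : ℝ, 0 < e → e0 * x * E' = e0 * (x / e) * (e * E') := by
      intro e E' he
      field_simp
    exact key _ _ (hεp j (by simp [hF, hj]))
  · intro τ hτ τ' hτ' hne y hy y' hy'
    obtain ⟨j, hj, hτ⟩ := hmem τ hτ
    obtain ⟨k, hk, hτ'⟩ := hmem τ' hτ'
    by_cases hjk : j = k
    · subst hjk
      exact (hG j hj).1.sep τ hτ τ' hτ' hne y hy y' hy'
    · refine le_trans ?_ (hg.sep (σ ++ [i]) j k hjk (hg.adm σ i j h hj) (hg.adm σ i k h hk)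
        y ((hG j hj).1.sub τ hτ hy) y' ((hG k hk).1.sub τ' hτ' hy'))
      exact mul_le_mul_of_nonneg_left
        (max_le_max ((hG j hj).1.dle τ hτ) ((hG k hk).1.dle τ' hτ')) ht.le
  · have hcard : (F.biUnion G).card = ∑ j ∈ F, (G j).card := by
      apply Finset.card_biUnion
      intro j hj k hk hjk
      rw [Function.onFun, Finset.disjoint_left]
      intro τ h1 h2
      have hj' := hFm j hj
      have hk' := hFm k hk
      obtain ⟨y, hy⟩ := (hG j hj').1.ne τ h1
      exact Set.disjoint_left.1 (geo_disj hg ht (σ ++ [i]) j k hjk (hg.adm σ i j h hj')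
        (hg.adm σ i k h hk')) ((hG j hj').1.sub τ h1 hy) ((hG k hk').1.sub τ h2 hy)
    rw [hcard]
    push_cast
    calc c0 * app (fun i j => (p i j * c i j ^ r) ^ θ) z i * x ^ (-θ)
        = ∑ j, c0 * ((p i j * c i j ^ r) ^ θ * z j) * x ^ (-θ) := by
          rw [app, Finset.mul_sum, Finset.sum_mul]
      _ = ∑ j ∈ F, c0 * ((p i j * c i j ^ r) ^ θ * z j) * x ^ (-θ) := by
          symm
          apply Finset.sum_subset (Finset.subset_univ _)
          intro j _ hj
          have hpj : p i j = 0 := le_antisymm (by simpa [hF] using hj) (hp0 i j)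
          rw [hpj, zero_mul, Real.zero_rpow hθ.ne']
          ring
      _ = ∑ j ∈ F, c0 * z j * (x / (p i j * c i j ^ r)) ^ (-θ) := by
          apply Finset.sum_congr rfl
          intro j hj
          have he := hεp j hj
          rw [Real.div_rpow hx.le he.le, Real.rpow_neg he.le, div_inv_eq_mul]
          ring
      _ ≤ ∑ j ∈ F, ((G j).card : ℝ) := Finset.sum_le_sum fun j hj => (hG j (hFm j hj)).2

theorem low_base (hg : Geo p c J μ t) (ht : 0 < t) (hp0 : ∀ i j, 0 ≤ p i j)
    (hc : ∀ i j, 0 < c i j ∧ c i j < 1) (r θ e0 lam c0 : ℝ) (hθ : 0 < θ)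
    (he0 : 0 < e0) (he1 : e0 < 1) (hl0 : 0 < lam)
    (hε : ∀ i j, 0 < p i j → e0 ≤ p i j * c i j ^ r ∧ p i j * c i j ^ r ≤ lam)
    (u : Fin N → ℝ) (hu0 : ∀ i, 0 ≤ u i) (hc0 : 0 < c0)
    (hu : ∀ i, u i ≤ app (fun i j => (p i j * c i j ^ r) ^ θ) u i)
    (hcu : ∀ i, c0 * u i * e0 ^ (-θ) ≤ 1) (m : ℕ) :
    ∀ x, lam ^ m < x → x ≤ 1 → ∀ (σ : List (Fin N)) (i : Fin N), Adm p (σ ++ [i]) →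
    ∃ Γ, Fam J μ r t (σ ++ [i]) (e0 * x) Γ ∧ c0 * u i * x ^ (-θ) ≤ (Γ.card : ℝ) := by
  induction m with
  | zero => intro x h1 h2; rw [pow_zero] at h1; linarith
  | succ m ih =>
    intro x hx1 hx2 σ i h
    have hx0 : 0 < x := lt_trans (by positivity) hx1
    rcases lt_or_ge e0 x with hx | hx
    · refine ⟨{σ ++ [i]}, ⟨?_, ?_, ?_, ?_, ?_, ?_, ?_⟩, ?_⟩
      · intro τ hτ; rw [Finset.mem_singleton.1 hτ]; exact hg.cpt σ i h
      · intro τ hτ; rw [Finset.mem_singleton.1 hτ]; exact hg.ne σ i h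
      · intro τ hτ; rw [Finset.mem_singleton.1 hτ]; exact hg.dpos σ i h
      · intro τ hτ; rw [Finset.mem_singleton.1 hτ]
      · intro τ hτ; rw [Finset.mem_singleton.1 hτ]
      · intro τ hτ; rw [Finset.mem_singleton.1 hτ]
        have := En_pos hg r σ i h
        apply mul_le_of_le_one_left this.le
        nlinarith
      · intro τ hτ τ' hτ' hne
        exact absurd ((Finset.mem_singleton.1 hτ).trans (Finset.mem_singleton.1 hτ').symm) hne
      · simp only [Finset.card_singleton, Nat.cast_one]
        refine le_trans ?_ (hcu i)
        apply mul_le_mul_of_nonneg_left _ (mul_nonneg hc0.le (hu0 i))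
        exact Real.rpow_le_rpow_of_nonpos he0 hx.le (by linarith)
    · obtain ⟨Γ, h1, h2⟩ := low_union hg ht hp0 hc r θ e0 c0 hθ u x hx0 σ i h (by
        intro j hj
        obtain ⟨h1, h2⟩ := hε i j hj
        have hep := lt_of_lt_of_le he0 h1
        refine ih _ ?_ ?_ (σ ++ [i]) j (hg.adm σ i j h hj)
        · rw [lt_div_iff₀ hep]
          calc lam ^ m * (p i j * c i j ^ r) ≤ lam ^ m * lam := by gcongr
            _ = lam ^ (m + 1) := by ring
            _ < x := hx1
        · rw [div_le_one hep]; linarith)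
      refine ⟨Γ, h1, le_trans ?_ h2⟩
      have := hu i
      gcongr

theorem low_iter (hg : Geo p c J μ t) (ht : 0 < t) (hp0 : ∀ i j, 0 ≤ p i j)
    (hc : ∀ i j, 0 < c i j ∧ c i j < 1) (r θ e0 lam c0 : ℝ) (hθ : 0 < θ)
    (he0 : 0 < e0) (he1 : e0 < 1) (hl0 : 0 < lam) (hl1 : lam < 1)
    (hε : ∀ i j, 0 < p i j → e0 ≤ p i j * c i j ^ r ∧ p i j * c i j ^ r ≤ lam)
    (u : Fin N → ℝ) (hu0 : ∀ i, 0 ≤ u i) (hc0 : 0 < c0)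
    (hu : ∀ i, u i ≤ app (fun i j => (p i j * c i j ^ r) ^ θ) u i)
    (hcu : ∀ i, c0 * u i * e0 ^ (-θ) ≤ 1) (k : ℕ) :
    ∃ x0 : ℝ, 0 < x0 ∧ ∀ x, 0 < x → x ≤ x0 →
    ∀ (σ : List (Fin N)) (i : Fin N), Adm p (σ ++ [i]) →
    ∃ Γ, Fam J μ r t (σ ++ [i]) (e0 * x) Γ ∧
      c0 * ((app (fun i j => (p i j * c i j ^ r) ^ θ))^[k] u i) * x ^ (-θ) ≤ (Γ.card : ℝ) := by
  induction k with
  | zero =>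
    refine ⟨1, one_pos, ?_⟩
    intro x hx0 hx1 σ i h
    obtain ⟨m, hm⟩ := exists_pow_lt_of_lt_one hx0 hl1
    exact low_base hg ht hp0 hc r θ e0 lam c0 hθ he0 he1 hl0 hε u hu0 hc0 hu hcu m x hm hx1 σ i h
  | succ k ih =>
    obtain ⟨x0, hx0, H⟩ := ih
    refine ⟨x0 * e0, by positivity, ?_⟩
    intro x hx hx1 σ i h
    rw [Function.iterate_succ_apply']
    apply low_union hg ht hp0 hc r θ e0 c0 hθ _ x hx σ i h
    intro j hj
    have he := (hε i j hj).1
    have hep := lt_of_lt_of_le he0 he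
    refine H _ (by positivity) ?_ (σ ++ [i]) j (hg.adm σ i j h hj)
    rw [div_le_iff₀ hep]
    exact hx1.trans (by gcongr)

theorem fam_integral (ht : 0 < t) (r : ℝ) (hr : 0 < r) (τ0 : List (Fin N)) (q : ℝ)
    (hq : 0 ≤ q * En J μ r τ0)
    (Γ : Finset (List (Fin N))) (hΓ : Fam J μ r t τ0 q Γ) (α : Finset E) (hα : α.Nonempty)
    (hintg : Integrable (fun y => infDist y (α : Set E) ^ r) μ)
    (n : ℕ) (hn : α.card ≤ n) (hn2 : 2 * n ≤ Γ.card) :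
    (t / 2) ^ r * (q * En J μ r τ0) * n ≤ ∫ y, infDist y (α : Set E) ^ r ∂μ := by
  classical
  set bad := Γ.filter (fun τ => ∃ b ∈ α, infDist b (J τ) < t / 2 * diam (J τ)) with hbad
  set good := Γ.filter (fun τ => ¬ ∃ b ∈ α, infDist b (J τ) < t / 2 * diam (J τ)) with hgood
  have hbc : bad.card ≤ α.card := by
    have hch : ∀ τ : List (Fin N), ∃ b : E, τ ∈ bad →
        (b ∈ α ∧ infDist b (J τ) < t / 2 * diam (J τ)) := by
      intro τ
      by_cases h : τ ∈ bad
      · obtain ⟨b, hb⟩ := (Finset.mem_filter.1 h).2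
        exact ⟨b, fun _ => hb⟩
      · exact ⟨hα.choose, fun h' => absurd h' h⟩
    choose f hf using hch
    apply Finset.card_le_card_of_injOn f (fun τ hτ => (hf τ hτ).1)
    intro τ hτ τ' hτ' heq
    by_contra hne
    have h1 := (hf τ hτ).2
    have h2 := (hf τ' hτ').2
    rw [← heq] at h2
    have hm := (Finset.mem_filter.1 hτ).1
    have hm' := (Finset.mem_filter.1 hτ').1
    obtain ⟨x, hx, hdx⟩ := (infDist_lt_iff (hΓ.ne τ hm)).1 h1
    obtain ⟨y, hy, hdy⟩ := (infDist_lt_iff (hΓ.ne τ' hm')).1 h2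
    have h3 := hΓ.sep τ hm τ' hm' hne x hx y hy
    have h4 := dist_triangle_left x y (f τ)
    have h5 : diam (J τ) ≤ max (diam (J τ)) (diam (J τ')) := le_max_left _ _
    have h6 : diam (J τ') ≤ max (diam (J τ)) (diam (J τ')) := le_max_right _ _
    nlinarith
  have hgc : n ≤ good.card := by
    have : bad.card + good.card = Γ.card := Finset.card_filter_add_card_filter_not _
    omega
  have hmeas : ∀ τ ∈ good, MeasurableSet (J τ) := fun τ hτ =>
    (hΓ.cpt τ (Finset.mem_filter.1 hτ).1).isClosed.measurableSet
  have hdisj : Set.Pairwise (good : Set (List (Fin N))) (Function.onFun Disjoint J) := by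
    intro τ hτ τ' hτ' hne
    have hm := (Finset.mem_filter.1 hτ).1
    have hm' := (Finset.mem_filter.1 hτ').1
    rw [Function.onFun, Set.disjoint_left]
    intro x hx hx'
    have h3 := hΓ.sep τ hm τ' hm' hne x hx x hx'
    rw [dist_self] at h3
    have : 0 < t * max (diam (J τ)) (diam (J τ')) :=
      mul_pos ht (lt_max_of_lt_left (hΓ.dpos τ hm))
    linarith
  calc (t / 2) ^ r * (q * En J μ r τ0) * n
      ≤ (t / 2) ^ r * (q * En J μ r τ0) * good.card := by gcongr
    _ = ∑ τ ∈ good, (t / 2) ^ r * (q * En J μ r τ0) := by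
        rw [Finset.sum_const, nsmul_eq_mul]; ring
    _ ≤ ∑ τ ∈ good, ∫ y in J τ, infDist y (α : Set E) ^ r ∂μ := by
        apply Finset.sum_le_sum
        intro τ hτ
        obtain ⟨hm, hg⟩ := Finset.mem_filter.1 hτ
        push Not at hg
        calc (t / 2) ^ r * (q * En J μ r τ0) ≤ (t / 2) ^ r * En J μ r τ := by
              have := hΓ.en τ hm
              gcongr
          _ = (t / 2 * diam (J τ)) ^ r * μ.real (J τ) := by
              rw [Real.mul_rpow (by positivity) diam_nonneg, En]; ring
          _ ≤ _ := by
              apply setIntegral_ge_of_const_le_real (hmeas τ hτ) (by finiteness) _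
                hintg.integrableOn
              intro y hy
              apply Real.rpow_le_rpow (mul_nonneg (by positivity) diam_nonneg) _ hr.le
              rw [le_infDist (by exact_mod_cast hα)]
              intro b hb
              refine (hg b (by exact_mod_cast hb)).trans ?_
              rw [dist_comm]
              exact infDist_le_dist_of_mem hy
    _ = ∫ y in ⋃ τ ∈ good, J τ, infDist y (α : Set E) ^ r ∂μ := by
        rw [integral_biUnion_finset good hmeas hdisj (fun τ _ => hintg.integrableOn)]
    _ ≤ _ := setIntegral_le_integral hintg
        (Eventually.of_forall fun y => Real.rpow_nonneg infDist_nonneg r)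

theorem dist_integrable (hg : Geo p c J μ t) (ht : 0 < t)
    (hadm : ∀ i : Fin N, Adm p ([] ++ [i])) (hsum : ∑ i, μ.real (J ([] ++ [i])) = 1)
    (r : ℝ) (hr : 0 < r) (α : Finset E) :
    Integrable (fun y => infDist y (α : Set E) ^ r) μ := by
  have hcont : Continuous (fun y => infDist y (α : Set E) ^ r) :=
    (continuous_infDist_pt _).rpow_const (fun _ => Or.inr hr.le)
  have hcp : IsCompact (⋃ i : Fin N, J ([] ++ [i])) :=
    isCompact_iUnion fun i => hg.cpt [] i (hadm i)
  have h := hcont.continuousOn.integrableOn_compact (μ := μ) hcp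
  have hae : (⋃ i : Fin N, J ([] ++ [i])) =ᵐ[μ] (Set.univ : Set E) := by
    rw [ae_eq_univ]
    exact null_base hg ht hadm hsum
  rw [integrableOn_congr_set_ae hae] at h
  rwa [integrableOn_univ] at h

theorem lower_final (hg : Geo p c J μ t) (ht : 0 < t) (hp0 : ∀ i j, 0 ≤ p i j)
    (hc : ∀ i j, 0 < c i j ∧ c i j < 1) (r : ℝ) (hr : 0 < r)
    (sr : ℝ) (hsr : 0 < sr)
    (e0 lam : ℝ) (he0 : 0 < e0) (he1 : e0 < 1) (hl0 : 0 < lam) (hl1 : lam < 1)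
    (hε : ∀ i j, 0 < p i j → e0 ≤ p i j * c i j ^ r ∧ p i j * c i j ^ r ≤ lam)
    (hadm : ∀ i : Fin N, Adm p ([] ++ [i])) (hsum : ∑ i, μ.real (J ([] ++ [i])) = 1)
    (u : Fin N → ℝ) (hu0 : ∀ i, 0 ≤ u i)
    (hu : ∀ i, u i ≤ app (fun i j => (p i j * c i j ^ r) ^ (sr / (sr + r))) u i)
    (i : Fin N) (hunb : ∀ K : ℝ, ∃ n : ℕ,
      K < (app (fun i j => (p i j * c i j ^ r) ^ (sr / (sr + r))))^[n] u i) :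
    lowerQuantCoeff μ r sr = ∞ := by
  set θ := sr / (sr + r) with hθ
  have hθ0 : 0 < θ := by positivity
  obtain ⟨c0, hc0, hcu⟩ : ∃ c0 : ℝ, 0 < c0 ∧ ∀ i, c0 * u i * e0 ^ (-θ) ≤ 1 := by
    have hS : 0 ≤ ∑ i, u i := Finset.sum_nonneg fun i _ => hu0 i
    have hE : 0 < e0 ^ (-θ) := by positivity
    refine ⟨1 / ((1 + ∑ i, u i) * e0 ^ (-θ)), by positivity, ?_⟩
    intro i
    have : u i ≤ ∑ i, u i := Finset.single_le_sum (fun i _ => hu0 i) (Finset.mem_univ i)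
    rw [div_mul_eq_mul_div, div_mul_eq_mul_div, div_le_one (by positivity), one_mul]
    gcongr
    linarith
  set E0 := En J μ r ([] ++ [i]) with hE0
  have hE0p : 0 < E0 := En_pos hg r [] i (hadm i)
  apply ENNReal.eq_top_of_forall_nnreal_le
  intro L
  apply le_liminf_of_le
  · isBoundedDefault
  set W : ℝ := (t / 2) ^ r * e0 * E0 with hW
  have hW0 : 0 < W := by positivity
  set L' : ℝ := (L : ℝ) + 1 with hL'
  have hL'0 : 0 < L' := by positivity
  set K : ℝ := 2 * (L' ^ r / W) ^ θ with hK
  have hK0 : 0 < K := by positivity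
  obtain ⟨k, hk⟩ := hunb (K / c0)
  rw [div_lt_iff₀ hc0] at hk
  obtain ⟨x0, hx0, H⟩ := low_iter hg ht hp0 hc r θ e0 lam c0 hθ0 he0 he1 hl0 hl1 hε u hu0 hc0 hu
    hcu k
  obtain ⟨n0, hn0⟩ := exists_nat_ge (K / 2 * x0 ^ (-θ))
  filter_upwards [eventually_ge_atTop (max n0 1)] with n hn
  have hn1 : 1 ≤ n := le_trans (le_max_right _ _) hn
  have hnR : (0:ℝ) < n := by exact_mod_cast hn1
  have hnK : K / 2 * x0 ^ (-θ) ≤ n := hn0.trans (by exact_mod_cast le_trans (le_max_left _ _) hn)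
  set y : ℝ := 2 * n / K with hy
  have hy0 : 0 < y := by positivity
  have hyx : x0 ^ (-θ) ≤ y := by
    rw [hy, le_div_iff₀ hK0]; linarith
  set x : ℝ := y ^ (-(1 / θ)) with hx
  have hxp : 0 < x := by positivity
  have hxy : x ^ (-θ) = y := by
    rw [hx, ← Real.rpow_mul hy0.le]
    have : -(1 / θ) * -θ = 1 := by field_simp
    rw [this, Real.rpow_one]
  have hxx0 : x ≤ x0 := by
    calc x ≤ (x0 ^ (-θ)) ^ (-(1 / θ)) :=
          Real.rpow_le_rpow_of_nonpos (by positivity) hyx (by rw [neg_nonpos]; positivity)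
      _ = x0 := by
          rw [← Real.rpow_mul hx0.le]
          have : -θ * -(1 / θ) = 1 := by field_simp
          rw [this, Real.rpow_one]
  obtain ⟨Γ, hΓ, hcard⟩ := H x hxp hxx0 [] i (hadm i)
  have h2n : 2 * n ≤ Γ.card := by
    have : (2 * n : ℝ) ≤ Γ.card := by
      refine le_trans ?_ hcard
      rw [hxy]
      calc (2 * n : ℝ) = K * y := by rw [hy]; field_simp
        _ ≤ _ := by
          apply mul_le_mul_of_nonneg_right _ hy0.le
          linarith
    exact_mod_cast this
  have hq : L' ≤ (n:ℝ) ^ (1 / sr) * quantError μ r n := by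
    have hle : (W * x * n) ^ (1 / r) ≤ quantError μ r n := by
      obtain ⟨b, hb⟩ := hg.ne [] i (hadm i)
      apply le_csInf
      · exact ⟨_, {b}, by simp, by simpa using hn1, rfl⟩
      · rintro e ⟨α, h1, h2, rfl⟩
        have := fam_integral ht r hr ([] ++ [i]) (e0 * x) (by positivity) Γ hΓ α
          (Finset.card_pos.1 h1) (dist_integrable hg ht hadm hsum r hr α) n h2 h2n
        apply Real.rpow_le_rpow (by positivity) _ (by positivity)
        refine le_trans (le_of_eq ?_) this
        rw [hW, ← hE0]; ring
    calc L' = (L' ^ r) ^ (1 / r) := by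
          rw [← Real.rpow_mul hL'0.le, mul_one_div_cancel hr.ne', Real.rpow_one]
      _ = ((n:ℝ) ^ (r / sr) * (W * x * n)) ^ (1 / r) := by
        congr 1
        have e1 : (n:ℝ) ^ (r / sr) * n = (n:ℝ) ^ (1 / θ) := by
          rw [← Real.rpow_add_one hnR.ne']
          congr 1
          rw [hθ]; field_simp; ring
        have hyn : y = n / (L' ^ r / W) ^ θ := by
          rw [hy, hK]; field_simp
        have e2 : x = (L' ^ r / W) / (n:ℝ) ^ (1 / θ) := by
          rw [hx, Real.rpow_neg hy0.le, hyn, Real.div_rpow hnR.le (by positivity), inv_div,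
            ← Real.rpow_mul (by positivity), mul_one_div_cancel hθ0.ne', Real.rpow_one]
        have e3 : (n:ℝ) ^ (r / sr) * (W * x * n) = W * x * ((n:ℝ) ^ (r / sr) * n) := by ring
        rw [e3, e1, e2]
        field_simp
      _ = (n:ℝ) ^ (1 / sr) * (W * x * n) ^ (1 / r) := by
        rw [Real.mul_rpow (x := (n:ℝ) ^ (r / sr)) (by positivity) (by positivity),
          ← Real.rpow_mul hnR.le]
        congr 2
        field_simp
      _ ≤ _ := by gcongr
  rw [← ENNReal.ofReal_coe_nnreal]
  apply ENNReal.ofReal_le_ofReal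
  linarith

end GeoPart

theorem exists_eps {N : ℕ} (p c : Fin N → Fin N → ℝ) (hp0 : ∀ i j, 0 ≤ p i j)
    (hrow : ∀ i, ∑ j, p i j = 1) (hc : ∀ i j, 0 < c i j ∧ c i j < 1) (r : ℝ) (hr : 0 < r) :
    ∃ e0 lam : ℝ, 0 < e0 ∧ e0 < 1 ∧ 0 < lam ∧ lam < 1 ∧
      ∀ i j, 0 < p i j → e0 ≤ p i j * c i j ^ r ∧ p i j * c i j ^ r ≤ lam := by
  have hlt : ∀ i j, p i j * c i j ^ r < 1 := by
    intro i j
    have h1 : p i j ≤ 1 := by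
      rw [← hrow i]
      exact Finset.single_le_sum (fun j _ => hp0 i j) (Finset.mem_univ j)
    have h2 : c i j ^ r < 1 := Real.rpow_lt_one (hc i j).1.le (hc i j).2 hr
    have h3 : 0 < c i j ^ r := Real.rpow_pos_of_pos (hc i j).1 r
    calc p i j * c i j ^ r ≤ 1 * c i j ^ r := by gcongr
      _ < 1 := by linarith
  have hle : ∀ b : ℝ, 0 < b → ∀ᶠ e in nhdsWithin (0:ℝ) (Set.Ioi 0), e ≤ b := by
    intro b hb
    filter_upwards [Ioo_mem_nhdsGT hb] with e he using he.2.le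
  have hall : ∀ᶠ e in nhdsWithin (0:ℝ) (Set.Ioi 0), 0 < e ∧ e ≤ 1 / 2 ∧ ∀ i j, 0 < p i j →
      (e ≤ p i j * c i j ^ r ∧ e ≤ 1 - p i j * c i j ^ r) := by
    refine Eventually.and self_mem_nhdsWithin ((hle _ (by norm_num)).and ?_)
    rw [eventually_all]
    intro i
    rw [eventually_all]
    intro j
    rw [eventually_imp_distrib_left]
    intro hp
    exact (hle _ (mul_pos hp (Real.rpow_pos_of_pos (hc i j).1 r))).and
      (hle _ (by linarith [hlt i j]))
  obtain ⟨e, h0, h1, h2⟩ := hall.exists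
  refine ⟨e, 1 - e, h0, by linarith, by linarith, by linarith, ?_⟩
  intro i j hp
  obtain ⟨h3, h4⟩ := h2 i j hp
  exact ⟨h3, by linarith⟩

/-- in the Mauldin–Williams setting, with `s_r` the unique positive number for
which the spectral radius of `((p_{ij}c_{ij}^r)^{s_r/(s_r+r)})` is one, and `M` the family of
strongly connected components `H` whose submatrix at the same exponent has spectral radius one
(i.e. `s_r(H) = s_r`): `Q̄_r^{s_r}(μ) < ∞` iff the elements of `M` are pairwise incomparable;
otherwise `Q̲_r^{s_r}(μ) = ∞`. -/
theorem upperQuantCoeff_markov_finite_iff (d N : ℕ) (hN : 2 ≤ N)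
    (p : Fin N → Fin N → ℝ) (hp0 : ∀ i j, 0 ≤ p i j) (hrow : ∀ i, ∑ j, p i j = 1)
    (hA1 : ∀ i, 2 ≤ (Finset.univ.filter (fun j => 0 < p i j)).card)
    (c : Fin N → Fin N → ℝ) (hc : ∀ i j, 0 < c i j ∧ c i j < 1)
    (J : List (Fin N) → Set (EuclideanSpace ℝ (Fin d)))
    (hJbase : ∀ i : Fin N, IsCompact (J [i]) ∧ (J [i]).Nonempty ∧
      J [i] = closure (interior (J [i])))
    (hJsub : ∀ (σ : List (Fin N)) (i j : Fin N), Adm p (σ ++ [i, j]) →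
      J (σ ++ [i, j]) ⊆ J (σ ++ [i]))
    (hJsim : ∀ (σ : List (Fin N)) (i j : Fin N), Adm p (σ ++ [i, j]) →
      ∃ (S : EuclideanSpace ℝ (Fin d) → EuclideanSpace ℝ (Fin d)) (ρ : ℝ), 0 < ρ ∧
        (∀ x y, dist (S x) (S y) = ρ * dist x y) ∧ S '' J [j] = J (σ ++ [i, j]))
    (hJdiam : ∀ (σ : List (Fin N)) (i j : Fin N), Adm p (σ ++ [i, j]) →
      diam (J (σ ++ [i, j])) = c i j * diam (J (σ ++ [i])))
    (hA2 : ∃ t : ℝ, 0 < t ∧ t < 1 ∧ ∀ (σ : List (Fin N)) (i₁ i₂ : Fin N), i₁ ≠ i₂ →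
      Adm p (σ ++ [i₁]) → Adm p (σ ++ [i₂]) →
      ∀ x ∈ J (σ ++ [i₁]), ∀ y ∈ J (σ ++ [i₂]),
        t * max (diam (J (σ ++ [i₁]))) (diam (J (σ ++ [i₂]))) ≤ dist x y)
    (χ : Fin N → ℝ) (hχ : ∀ i, 0 < χ i) (hχ1 : ∑ i, χ i = 1)
    (μ : Measure (EuclideanSpace ℝ (Fin d))) [IsProbabilityMeasure μ]
    (hμ : ∀ σ : List (Fin N), σ ≠ [] → Adm p σ → μ (J σ) = ENNReal.ofReal (cylMass χ p σ))
    (r sr : ℝ) (hr : 0 < r) (hsr : 0 < sr)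
    (hspec : spectralRadius ℂ (Matrix.of fun i j : Fin N =>
      (((p i j * c i j ^ r) ^ (sr / (sr + r)) : ℝ) : ℂ)) = 1) :
    (upperQuantCoeff μ r sr < ∞ ↔
      (∀ H₁ H₂ : Finset (Fin N),
        (IsSCC p H₁ ∧ spectralRadius ℂ (Matrix.of fun i j : {x // x ∈ H₁} =>
          (((p i.1 j.1 * c i.1 j.1 ^ r) ^ (sr / (sr + r)) : ℝ) : ℂ)) = 1) →
        (IsSCC p H₂ ∧ spectralRadius ℂ (Matrix.of fun i j : {x // x ∈ H₂} =>
          (((p i.1 j.1 * c i.1 j.1 ^ r) ^ (sr / (sr + r)) : ℝ) : ℂ)) = 1) →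
        H₁ ≠ H₂ → ¬ Prec p H₁ H₂ ∧ ¬ Prec p H₂ H₁)) ∧
    (¬ (∀ H₁ H₂ : Finset (Fin N),
        (IsSCC p H₁ ∧ spectralRadius ℂ (Matrix.of fun i j : {x // x ∈ H₁} =>
          (((p i.1 j.1 * c i.1 j.1 ^ r) ^ (sr / (sr + r)) : ℝ) : ℂ)) = 1) →
        (IsSCC p H₂ ∧ spectralRadius ℂ (Matrix.of fun i j : {x // x ∈ H₂} =>
          (((p i.1 j.1 * c i.1 j.1 ^ r) ^ (sr / (sr + r)) : ℝ) : ℂ)) = 1) →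
        H₁ ≠ H₂ → ¬ Prec p H₁ H₂ ∧ ¬ Prec p H₂ H₁) →
      lowerQuantCoeff μ r sr = ∞) := by
  obtain ⟨t, ht, _, hA2⟩ := hA2
  obtain ⟨hg, hχr⟩ := geo_of hN p c hc J hJbase hJsub hJsim hJdiam t hA2 χ hχ hχ1 μ hμ
  obtain ⟨e0, lam, he0, he1, hl0, hl1, hε⟩ := exists_eps p c hp0 hrow hc r hr
  have hadm : ∀ i : Fin N, Adm p ([] ++ [i]) := by
    intro i
    have h : List.IsChain (fun a b => 0 < p a b) ([] ++ [i]) := by simp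
    exact h
  have hsum : ∑ i, μ.real (J ([] ++ [i])) = 1 := by
    rw [← hχ1]
    exact Finset.sum_congr rfl fun i _ => hχr i
  have hN0 : 0 < N := by omega
  have hθ0 : 0 < sr / (sr + r) := by positivity
  let a : Fin N → Fin N → ℝ := fun i j => (p i j * c i j ^ r) ^ (sr / (sr + r))
  have hcr : ∀ i j, 0 < c i j ^ r := fun i j => Real.rpow_pos_of_pos (hc i j).1 r
  have ha : ∀ i j, 0 ≤ a i j := fun i j =>
    Real.rpow_nonneg (mul_nonneg (hp0 i j) (hcr i j).le) _
  have hap : ∀ i j, 0 < p i j ↔ 0 < a i j := by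
    intro i j
    constructor
    · intro h
      exact Real.rpow_pos_of_pos (mul_pos h (hcr i j)) _
    · intro h
      rcases (hp0 i j).lt_or_eq with h1 | h1
      · exact h1
      · exfalso
        have : a i j = 0 := by
          change (p i j * c i j ^ r) ^ (sr / (sr + r)) = 0
          rw [← h1, zero_mul, Real.zero_rpow hθ0.ne']
        linarith
  have hng : ∀ κ : ℝ, 1 < κ → ∀ H : Finset (Fin N), ¬ Grow a H κ := by
    rintro κ hκ H ⟨v, hv0, hv1, hv2, hv3⟩
    have h1 : Grow a Finset.univ κ := ⟨v, hv0, hv1, fun i hi => absurd (Finset.mem_univ i) hi, hv3⟩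
    have h2 := (grow_univ_iff a ha κ (by linarith)).2 h1
    have h3 : ENNReal.ofReal κ ≤ 1 := h2.trans (le_of_eq hspec)
    rw [ENNReal.ofReal_le_one] at h3
    linarith
  have hM : ∀ H : Finset (Fin N), spectralRadius ℂ (Matrix.of fun i j : {x // x ∈ H} =>
      (((p i.1 j.1 * c i.1 j.1 ^ r) ^ (sr / (sr + r)) : ℝ) : ℂ)) = 1 ↔ Grow a H 1 := by
    intro H
    have h1 := grow_iff a ha H 1 one_pos
    constructor
    · intro h
      apply h1.1
      rw [ENNReal.ofReal_one]
      exact h.ge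
    · intro h
      have h2 := h1.2 h
      rw [ENNReal.ofReal_one] at h2
      refine le_antisymm ?_ h2
      by_contra hcon
      rw [not_le] at hcon
      obtain ⟨q, hq1, hq2⟩ := exists_between hcon
      have hqt : q ≠ ∞ := ne_top_of_lt hq2
      have hq3 : 1 < q.toReal := by
        rw [← ENNReal.toReal_one]
        exact (ENNReal.toReal_lt_toReal ENNReal.one_ne_top hqt).2 hq1
      refine hng q.toReal hq3 H ((grow_iff a ha H q.toReal (by linarith)).1 ?_)
      rw [ENNReal.ofReal_toReal hqt]
      exact hq2.le
  simp only [hM]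
  have hlow : ¬ (∀ H₁ H₂ : Finset (Fin N), (IsSCC p H₁ ∧ Grow a H₁ 1) →
      (IsSCC p H₂ ∧ Grow a H₂ 1) → H₁ ≠ H₂ → ¬ Prec p H₁ H₂ ∧ ¬ Prec p H₂ H₁) →
      lowerQuantCoeff μ r sr = ∞ := by
    intro hnot
    have key : ∀ H₁ H₂ : Finset (Fin N), (IsSCC p H₁ ∧ Grow a H₁ 1) →
        (IsSCC p H₂ ∧ Grow a H₂ 1) → H₁ ≠ H₂ → Prec p H₁ H₂ → lowerQuantCoeff μ r sr = ∞ := by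
      intro H₁ H₂ h1 h2 hne hP
      obtain ⟨u, hu0, hu, i, hi⟩ := unbounded_iter p a ha hap H₁ H₂ h1.1 h2.1 h1.2 h2.2 hne hP
      exact lower_final hg ht hp0 hc r hr sr hsr e0 lam he0 he1 hl0 hl1 hε hadm hsum u hu0 hu i hi
    by_contra hcon
    apply hnot
    intro H₁ H₂ h1 h2 hne
    exact ⟨fun hP => hcon (key H₁ H₂ h1 h2 hne hP), fun hP => hcon (key H₂ H₁ h2 h1 hne.symm hP)⟩
  refine ⟨⟨?_, ?_⟩, hlow⟩
  · intro hfin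
    by_contra hcon
    have h1 := hlow hcon
    have h2 : lowerQuantCoeff μ r sr ≤ upperQuantCoeff μ r sr := liminf_le_limsup
    rw [h1] at h2
    exact absurd hfin (not_lt.2 h2)
  · intro hinc
    obtain ⟨B, C, hB1, hB2, hB3⟩ := exists_bound hN0 p a (fun i j => p i j * c i j ^ r) ha hap
      e0 lam (sr / (sr + r)) he0 he1 hl0 hl1 hθ0 hε hng (by
        intro i j h1 h2 hR
        by_contra hne
        exact (hinc (comp p i) (comp p j) ⟨comp_scc p i, h1⟩ ⟨comp_scc p j, h2⟩ hne).1
          ⟨i, self_mem_comp p i, j, self_mem_comp p j, hR⟩)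
    exact upper_final hN0 hg ht hp0 hrow hc r hr sr hsr e0 lam he0 he1 hl0 hl1 hε hadm hsum B C
      hB1 hB2 hB3
end

section
/- Quantization dimension of multiscale Moran measures: Let m ≥ 2, and for 1 ≤ i ≤ m let N_i ≥ 2 be integers, (g_ij)_{j=1}^{N_i} contraction vectors with g_ij ∈ (0,1), and (p_ij)_{j=1}^{N_i} probability vectors with all p_ij > 0. Let χ = (χ_i)_{i=1}^m be a probability vector with all χ_i > 0 and let ω ∈ G(χ), i.e. lim_{k→∞} k^{−1} card{1 ≤ l ≤ k : ω_l = i} = χ_i for each i. Let E(ω) ⊆ ℝ^d be a multiscale Moran set built from compact cylinder sets (J_σ) satisfying conditions (B1) (the contraction ratios are uniformly bounded below by some c > 0) and (B2) (dist(J_{σ*i}, J_{σ*j}) ≥ β·max{|J_{σ*i}|, |J_{σ*j}|} for i ≠ j, some β ∈ (0,1)) and with ratios at level l+1 given by (g_{ω_{l+1} j})_{j=1}^{N_{ω_{l+1}}}, and let μ_ω be the Moran measure with μ_ω(J_σ) = p_{ω₁σ₁}⋯p_{ω_kσ_k} for σ = σ₁⋯σ_k ∈ Ω_k. Fix r ∈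 (0,∞) and let s_r > 0 be the unique number with Π_{i=1}^m (Σ_{j=1}^{N_i} (p_ij g_ij^r)^{s_r/(s_r+r)})^{χ_i} = 1. Then D_r(μ_ω) exists and equals s_r; in particular it is independent of ω ∈ G(χ). -/
open MeasureTheory Filter Metric
open scoped ENNReal NNReal

/-- A word `σ ∈ Ω_k = Π_{l=1}^k {0,…,N_{ω_l}-1}` for the multiscale Moran construction:
the letter at (0-based) position `l` must be `< N (ω l)`. -/
def ValidWord {m : ℕ} (N : Fin m → ℕ) (ω : ℕ → Fin m) (σ : List ℕ) : Prop :=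
  ∀ l : Fin σ.length, σ.get l < N (ω l)

/-- `N_{k,i}(ω)`: the number of `0 ≤ l < k` with `ω_l = i`. -/
noncomputable def freqCount {m : ℕ} (ω : ℕ → Fin m) (k : ℕ) (i : Fin m) : ℕ :=
  ((Finset.range k).filter (fun l => ω l = i)).card

/-- product weight of a word -/
noncomputable def wt {m : ℕ} (f : Fin m → ℕ → ℝ) (ω : ℕ → Fin m) (σ : List ℕ) : ℝ :=
  ∏ l ∈ Finset.range σ.length, f (ω l) (σ.getD l 0)

lemma wt_nil {m : ℕ} (f : Fin m → ℕ → ℝ) (ω : ℕ → Fin m) : wt f ω [] = 1 := by simp [wt]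

lemma wt_snoc {m : ℕ} (f : Fin m → ℕ → ℝ) (ω : ℕ → Fin m) (σ : List ℕ) (j : ℕ) :
    wt f ω (σ ++ [j]) = wt f ω σ * f (ω σ.length) j := by
  unfold wt
  rw [List.length_append, List.length_singleton, Finset.prod_range_succ]
  congr 1
  · apply Finset.prod_congr rfl
    intro l hl
    rw [Finset.mem_range] at hl
    rw [List.getD_append _ _ _ _ hl]
  · rw [List.getD_append_right _ _ _ _ le_rfl]; simp

lemma wt_eq {m : ℕ} (f : Fin m → ℕ → ℝ) (ω : ℕ → Fin m) (σ : List ℕ) :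
    ∏ l : Fin σ.length, f (ω l) (σ.get l) = wt f ω σ := by
  unfold wt
  rw [Finset.prod_range]
  apply Finset.prod_congr rfl
  intro l _
  simp

lemma valid_snoc {m : ℕ} {N : Fin m → ℕ} {ω : ℕ → Fin m} {σ : List ℕ} {j : ℕ} :
    ValidWord N ω (σ ++ [j]) ↔ ValidWord N ω σ ∧ j < N (ω σ.length) := by
  have key : ∀ τ : List ℕ, ValidWord N ω τ ↔ ∀ l, l < τ.length → τ.getD l 0 < N (ω l) := by
    intro τ
    constructor
    · intro h l hl
      have := h ⟨l, hl⟩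
      rw [List.getD_eq_getElem _ _ hl]; exact this
    · intro h l
      have := h l l.2
      simpa using this
  rw [key, key]
  constructor
  · intro h
    constructor
    · intro l hl
      have := h l (by simp; omega)
      rwa [List.getD_append _ _ _ _ hl] at this
    · have := h σ.length (by simp)
      rw [List.getD_append_right _ _ _ _ le_rfl] at this
      simpa using this
  · rintro ⟨h1, h2⟩ l hl
    rcases Nat.lt_or_ge l σ.length with h | h
    · rw [List.getD_append _ _ _ _ h]; exact h1 l h
    · have : l = σ.length := by simp at hl; omega
      subst this
      rw [List.getD_append_right _ _ _ _ le_rfl]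
      simpa using h2

lemma valid_nil {m : ℕ} (N : Fin m → ℕ) (ω : ℕ → Fin m) : ValidWord N ω [] := by
  intro l; exact l.elim0

/-- induction over valid words -/
lemma valid_ind {m : ℕ} {N : Fin m → ℕ} {ω : ℕ → Fin m} {P : List ℕ → Prop} (h0 : P [])
    (h1 : ∀ σ, ValidWord N ω σ → P σ → ∀ j < N (ω σ.length), P (σ ++ [j])) :
    ∀ σ, ValidWord N ω σ → P σ := by
  intro σ
  induction σ using List.reverseRecOn with
  | nil => intro _; exact h0
  | append_singleton σ j ih =>
    intro h
    rw [valid_snoc] at h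
    exact h1 σ h.1 (ih h.1) j h.2

lemma exists_cut {m : ℕ} {E : Type*} [MetricSpace E] (N : Fin m → ℕ) (ω : ℕ → Fin m)
    (h : Fin m → ℕ → ℝ) (c q ε β : ℝ)
    (hc0 : 0 < c) (hε : 0 < ε) (hq0 : 0 ≤ q) (hβ : 0 ≤ β)
    (hc : ∀ i, ∀ j < N i, c ≤ h i j) (hq : ∀ i, ∀ j < N i, h i j ≤ q)
    (J : List ℕ → Set E)
    (hJsub : ∀ σ : List ℕ, ValidWord N ω σ → ∀ j < N (ω σ.length), J (σ ++ [j]) ⊆ J σ)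
    (hJb : ∀ σ : List ℕ, ValidWord N ω σ → Bornology.IsBounded (J σ))
    (hsep : ∀ σ : List ℕ, ValidWord N ω σ →
      ∀ j₁ j₂ : ℕ, j₁ < N (ω σ.length) → j₂ < N (ω σ.length) → j₁ ≠ j₂ →
      ∀ x ∈ J (σ ++ [j₁]), ∀ y ∈ J (σ ++ [j₂]),
        β * max (diam (J (σ ++ [j₁]))) (diam (J (σ ++ [j₂]))) ≤ dist x y) :
    ∀ k σ, ValidWord N ω σ → c * ε ≤ wt h ω σ → q ^ k * wt h ω σ < ε →
      ∃ Λ : Finset (List ℕ),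
        (∀ τ ∈ Λ, ValidWord N ω τ ∧ σ <+: τ ∧ J τ ⊆ J σ ∧ c * ε ≤ wt h ω τ ∧ wt h ω τ < ε) ∧
        (∀ τ₁ ∈ Λ, ∀ τ₂ ∈ Λ, τ₁ ≠ τ₂ → ∀ x ∈ J τ₁, ∀ y ∈ J τ₂,
          β * max (diam (J τ₁)) (diam (J τ₂)) ≤ dist x y) ∧
        (∀ ν : Fin m → ℕ → ℝ, (∀ i, ∑ j ∈ Finset.range (N i), ν i j = 1) →
          ∑ τ ∈ Λ, wt ν ω τ = wt ν ω σ) := by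
  classical
  have base : ∀ σ, ValidWord N ω σ → c * ε ≤ wt h ω σ → wt h ω σ < ε →
      ∃ Λ : Finset (List ℕ),
        (∀ τ ∈ Λ, ValidWord N ω τ ∧ σ <+: τ ∧ J τ ⊆ J σ ∧ c * ε ≤ wt h ω τ ∧ wt h ω τ < ε) ∧
        (∀ τ₁ ∈ Λ, ∀ τ₂ ∈ Λ, τ₁ ≠ τ₂ → ∀ x ∈ J τ₁, ∀ y ∈ J τ₂,
          β * max (diam (J τ₁)) (diam (J τ₂)) ≤ dist x y) ∧
        (∀ ν : Fin m → ℕ → ℝ, (∀ i, ∑ j ∈ Finset.range (N i), ν i j = 1) →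
          ∑ τ ∈ Λ, wt ν ω τ = wt ν ω σ) := by
    intro σ hv h1 h2
    refine ⟨{σ}, ?_, ?_, ?_⟩
    · intro τ hτ
      rw [Finset.mem_singleton] at hτ
      subst hτ
      exact ⟨hv, List.prefix_rfl, subset_rfl, h1, h2⟩
    · intro τ₁ h₁ τ₂ h₂ hne
      rw [Finset.mem_singleton] at h₁ h₂
      exact absurd (h₁.trans h₂.symm) hne
    · intro ν _
      simp
  intro k
  induction k with
  | zero =>
    intro σ hv h1 h2
    exact base σ hv h1 (by simpa using h2)
  | succ k ih =>
    intro σ hv h1 h2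
    by_cases hlt : wt h ω σ < ε
    · exact base σ hv h1 hlt
    have hge : ε ≤ wt h ω σ := not_lt.mp hlt
    have hpos : 0 < wt h ω σ := hε.trans_le hge
    have hch : ∀ j, j < N (ω σ.length) → ∃ Λ : Finset (List ℕ),
        (∀ τ ∈ Λ, ValidWord N ω τ ∧ (σ ++ [j]) <+: τ ∧ J τ ⊆ J (σ ++ [j]) ∧
          c * ε ≤ wt h ω τ ∧ wt h ω τ < ε) ∧
        (∀ τ₁ ∈ Λ, ∀ τ₂ ∈ Λ, τ₁ ≠ τ₂ → ∀ x ∈ J τ₁, ∀ y ∈ J τ₂,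
          β * max (diam (J τ₁)) (diam (J τ₂)) ≤ dist x y) ∧
        (∀ ν : Fin m → ℕ → ℝ, (∀ i, ∑ j ∈ Finset.range (N i), ν i j = 1) →
          ∑ τ ∈ Λ, wt ν ω τ = wt ν ω (σ ++ [j])) := by
      intro j hj
      apply ih (σ ++ [j]) (valid_snoc.mpr ⟨hv, hj⟩)
      · rw [wt_snoc, mul_comm]
        exact mul_le_mul hge (hc _ _ hj) hc0.le hpos.le
      · rw [wt_snoc]
        calc q ^ k * (wt h ω σ * h (ω σ.length) j) ≤ q ^ k * (wt h ω σ * q) := by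
              gcongr; exact hq _ _ hj
          _ = q ^ (k + 1) * wt h ω σ := by ring
          _ < ε := h2
    choose! L hL1 hL2 hL3 using hch
    refine ⟨(Finset.range (N (ω σ.length))).biUnion L, ?_, ?_, ?_⟩
    · intro τ hτ
      rw [Finset.mem_biUnion] at hτ
      obtain ⟨j, hj, hτ⟩ := hτ
      rw [Finset.mem_range] at hj
      obtain ⟨a1, a2, a3, a4⟩ := hL1 j hj τ hτ
      exact ⟨a1, (List.prefix_append _ _).trans a2, a3.trans (hJsub σ hv j hj), a4⟩
    · intro τ₁ h₁ τ₂ h₂ hne x hx y hy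
      rw [Finset.mem_biUnion] at h₁ h₂
      obtain ⟨j₁, hj₁, h₁⟩ := h₁
      obtain ⟨j₂, hj₂, h₂⟩ := h₂
      rw [Finset.mem_range] at hj₁ hj₂
      by_cases hj : j₁ = j₂
      · subst hj
        exact hL2 j₁ hj₁ τ₁ h₁ τ₂ h₂ hne x hx y hy
      · have s1 := (hL1 j₁ hj₁ τ₁ h₁).2.2.1
        have s2 := (hL1 j₂ hj₂ τ₂ h₂).2.2.1
        refine le_trans ?_ (hsep σ hv j₁ j₂ hj₁ hj₂ hj x (s1 hx) y (s2 hy))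
        apply mul_le_mul_of_nonneg_left _ hβ
        exact max_le_max (diam_mono s1 (hJb _ (valid_snoc.mpr ⟨hv, hj₁⟩)))
          (diam_mono s2 (hJb _ (valid_snoc.mpr ⟨hv, hj₂⟩)))
    · intro ν hν
      rw [Finset.sum_biUnion]
      · rw [Finset.sum_congr rfl (fun j hj => hL3 j (Finset.mem_range.mp hj) ν hν)]
        simp_rw [wt_snoc]
        rw [← Finset.mul_sum, hν, mul_one]
      · intro j₁ hj₁ j₂ hj₂ hne
        rw [Finset.mem_coe, Finset.mem_range] at hj₁ hj₂
        rw [Function.onFun, Finset.disjoint_left]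
        intro τ h₁ h₂
        have p1 := (hL1 j₁ hj₁ τ h₁).2.1
        have p2 := (hL1 j₂ hj₂ τ h₂).2.1
        have := (List.prefix_of_prefix_length_le p1 p2 (by simp)).eq_of_length (by simp)
        simp at this
        exact hne this

/-- the frequency asymptotics -/
lemma log_prod_bound {m : ℕ} (ω : ℕ → Fin m) (χ : Fin m → ℝ) (F : Fin m → ℝ)
    (hF : ∀ i, 0 < F i)
    (hωG : ∀ i, Tendsto (fun k => (freqCount ω k i : ℝ) / (k : ℝ)) atTop (nhds (χ i)))
    (h1 : ∏ i, F i ^ χ i = 1) (η : ℝ) (hη : 0 < η) :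
    ∃ C : ℝ, ∀ k : ℕ, |∑ l ∈ Finset.range k, Real.log (F (ω l))| ≤ η * k + C := by
  classical
  have e1 : ∀ k : ℕ, ∑ l ∈ Finset.range k, Real.log (F (ω l))
      = ∑ i, (freqCount ω k i : ℝ) * Real.log (F i) := by
    intro k
    rw [← Finset.sum_fiberwise (Finset.range k) ω]
    apply Finset.sum_congr rfl
    intro i _
    rw [Finset.sum_congr rfl (g := fun _ => Real.log (F i))]
    · rw [Finset.sum_const, nsmul_eq_mul]
      unfold freqCount
      congr 3
    · intro l hl
      rw [(Finset.mem_filter.mp hl).2]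
  have e2 : ∑ i, χ i * Real.log (F i) = 0 := by
    have := congrArg Real.log h1
    rw [Real.log_prod (fun i _ => (Real.rpow_pos_of_pos (hF i) _).ne'), Real.log_one] at this
    rw [← this]
    exact Finset.sum_congr rfl (fun i _ => (Real.log_rpow (hF i) _).symm)
  have e3 : Tendsto (fun k : ℕ => ∑ i, ((freqCount ω k i : ℝ) / k) * Real.log (F i)) atTop
      (nhds 0) := by
    rw [← e2]
    exact tendsto_finsetSum _ (fun i _ => (hωG i).mul_const _)
  rw [Metric.tendsto_atTop] at e3
  obtain ⟨K, hK⟩ := e3 η hη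
  refine ⟨∑ k ∈ Finset.range (K + 1), |∑ l ∈ Finset.range k, Real.log (F (ω l))|, fun k => ?_⟩
  have hn : ∀ k ∈ Finset.range (K + 1), 0 ≤ |∑ l ∈ Finset.range k, Real.log (F (ω l))| :=
    fun _ _ => abs_nonneg _
  rcases Nat.lt_or_ge k (K + 1) with hk | hk
  · have := Finset.single_le_sum hn (Finset.mem_range.mpr hk)
    have h2 : 0 ≤ η * k := by positivity
    linarith
  · have h0 := Finset.sum_nonneg hn
    have := hK k (by omega)
    have kpos : (0 : ℝ) < k := by exact_mod_cast (by omega : 0 < k)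
    have e : ∑ i, ((freqCount ω k i : ℝ) / k) * Real.log (F i)
        = (∑ l ∈ Finset.range k, Real.log (F (ω l))) / k := by
      rw [e1, Finset.sum_div]
      exact Finset.sum_congr rfl (fun i _ => by ring)
    rw [Real.dist_eq, sub_zero, e, abs_div, abs_of_pos kpos, div_lt_iff₀ kpos] at this
    linarith

/-- final limit -/
lemma final_limit (a : ℕ → ℝ) (r s t : ℝ) (hr : 0 < r) (hs : 0 < s) (ht : t = s / (s + r))
    (H : ∀ δ, 0 < δ → δ < t → ∃ C, ∀ᶠ n : ℕ in atTop,
      (1 / (t + δ) - 1) * Real.log n - C ≤ r * a n ∧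
      r * a n ≤ (1 / (t - δ) - 1) * Real.log n + C) :
    Tendsto (fun n : ℕ => Real.log n / a n) atTop (nhds s) := by
  have t0 : 0 < t := by rw [ht]; positivity
  have hts : 1 / t - 1 = r / s := by rw [ht]; field_simp; ring
  have hlog : Tendsto (fun n : ℕ => Real.log n) atTop atTop :=
    Real.tendsto_log_atTop.comp tendsto_natCast_atTop_atTop
  have key : Tendsto (fun n : ℕ => r * a n / Real.log n) atTop (nhds (r / s)) := by
    have c1 : Tendsto (fun δ : ℝ => 1 / (t + δ) - 1) (nhdsWithin 0 (Set.Ioi 0)) (nhds (r / s)) := by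
      apply tendsto_nhdsWithin_of_tendsto_nhds
      have : ContinuousAt (fun δ : ℝ => 1 / (t + δ) - 1) 0 := by
        apply ContinuousAt.sub _ continuousAt_const
        exact continuousAt_const.div (by fun_prop) (by simpa using t0.ne')
      simpa [ContinuousAt, ← hts] using this
    have c2 : Tendsto (fun δ : ℝ => 1 / (t - δ) - 1) (nhdsWithin 0 (Set.Ioi 0)) (nhds (r / s)) := by
      apply tendsto_nhdsWithin_of_tendsto_nhds
      have : ContinuousAt (fun δ : ℝ => 1 / (t - δ) - 1) 0 := by
        apply ContinuousAt.sub _ continuousAt_const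
        exact continuousAt_const.div (by fun_prop) (by simpa using t0.ne')
      simpa [ContinuousAt, ← hts] using this
    have hIoo : ∀ᶠ δ : ℝ in nhdsWithin 0 (Set.Ioi 0), δ ∈ Set.Ioo 0 t := Ioo_mem_nhdsGT t0
    have hC : ∀ C : ℝ, Tendsto (fun n : ℕ => C / Real.log n) atTop (nhds 0) :=
      fun C => hlog.const_div_atTop C
    rw [tendsto_order]
    constructor
    · intro b hb
      obtain ⟨δ, h1, h2⟩ := ((c1.eventually (lt_mem_nhds hb)).and hIoo).exists
      obtain ⟨C, hCn⟩ := H δ h2.1 h2.2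
      have : Tendsto (fun n : ℕ => (1 / (t + δ) - 1) - C / Real.log n) atTop
          (nhds ((1 / (t + δ) - 1) - 0)) := tendsto_const_nhds.sub (hC C)
      rw [sub_zero] at this
      filter_upwards [this.eventually (lt_mem_nhds h1), hCn, hlog.eventually_gt_atTop 0]
        with n n1 n2 n3
      refine n1.trans_le ?_
      rw [le_div_iff₀ n3, sub_mul, div_mul_cancel₀ _ n3.ne']
      exact n2.1
    · intro b hb
      obtain ⟨δ, h1, h2⟩ := ((c2.eventually (gt_mem_nhds hb)).and hIoo).exists
      obtain ⟨C, hCn⟩ := H δ h2.1 h2.2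
      have : Tendsto (fun n : ℕ => (1 / (t - δ) - 1) + C / Real.log n) atTop
          (nhds ((1 / (t - δ) - 1) + 0)) := tendsto_const_nhds.add (hC C)
      rw [add_zero] at this
      filter_upwards [this.eventually (gt_mem_nhds h1), hCn, hlog.eventually_gt_atTop 0]
        with n n1 n2 n3
      refine lt_of_le_of_lt ?_ n1
      rw [div_le_iff₀ n3, add_mul, div_mul_cancel₀ _ n3.ne']
      exact n2.2
  have k2 := (key.const_mul r⁻¹).inv₀ (by positivity)
  have : (r⁻¹ * (r / s))⁻¹ = s := by field_simp
  rw [this] at k2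
  refine k2.congr (fun n => ?_)
  rw [mul_div_assoc, ← mul_assoc, inv_mul_cancel₀ hr.ne', one_mul, inv_div]

lemma diam_sim {E : Type*} [MetricSpace E] (S : E → E) (c : ℝ) (hc : 0 < c)
    (hS : ∀ x y, dist (S x) (S y) = c * dist x y) (A : Set E) (hA : Bornology.IsBounded A)
    (hb : Bornology.IsBounded (S '' A)) :
    diam (S '' A) = c * diam A := by
  apply le_antisymm
  · apply diam_le_of_forall_dist_le (by have := diam_nonneg (s := A); positivity)
    rintro _ ⟨x, hx, rfl⟩ _ ⟨y, hy, rfl⟩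
    rw [hS]
    exact mul_le_mul_of_nonneg_left (dist_le_diam_of_mem hA hx hy) hc.le
  · rw [mul_comm, ← le_div_iff₀ hc]
    apply diam_le_of_forall_dist_le (by have := diam_nonneg (s := S '' A); positivity)
    intro x hx y hy
    rw [le_div_iff₀ hc, mul_comm, ← hS]
    exact dist_le_diam_of_mem hb (Set.mem_image_of_mem _ hx) (Set.mem_image_of_mem _ hy)

lemma quant_bddBelow {E : Type*} [MetricSpace E] [MeasurableSpace E]
    (P : Measure E) (r : ℝ) (n : ℕ) :
    BddBelow {e : ℝ | ∃ α : Finset E, 1 ≤ α.card ∧ α.card ≤ n ∧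
      e = (∫ x, infDist x (↑α : Set E) ^ r ∂P) ^ (1 / r)} := by
  refine ⟨0, ?_⟩
  rintro _ ⟨α, _, _, rfl⟩
  apply Real.rpow_nonneg
  exact integral_nonneg (fun x => Real.rpow_nonneg infDist_nonneg _)

lemma sep_disjoint {E : Type*} [MetricSpace E] {ι : Type*} (Λ : Finset ι) (J : ι → Set E) (β : ℝ)
    (hβ : 0 < β) (hd : ∀ τ ∈ Λ, 0 < diam (J τ))
    (hsep : ∀ τ₁ ∈ Λ, ∀ τ₂ ∈ Λ, τ₁ ≠ τ₂ → ∀ x ∈ J τ₁, ∀ y ∈ J τ₂,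
          β * max (diam (J τ₁)) (diam (J τ₂)) ≤ dist x y) :
    ∀ τ₁ ∈ Λ, ∀ τ₂ ∈ Λ, τ₁ ≠ τ₂ → Disjoint (J τ₁) (J τ₂) := by
  intro τ₁ h₁ τ₂ h₂ hne
  rw [Set.disjoint_left]
  intro x hx hy
  have := hsep τ₁ h₁ τ₂ h₂ hne x hx x hy
  rw [dist_self] at this
  have h3 : 0 < max (diam (J τ₁)) (diam (J τ₂)) := lt_max_of_lt_left (hd τ₁ h₁)
  have := mul_pos hβ h3
  linarith

lemma quant_upper {E : Type*} [MetricSpace E] [MeasurableSpace E] [BorelSpace E]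
    (μ : Measure E) [IsProbabilityMeasure μ] (r : ℝ) (hr : 0 < r) {ι : Type*}
    (Λ : Finset ι) (J : ι → Set E) (hJm : ∀ τ ∈ Λ, MeasurableSet (J τ))
    (hJb : ∀ τ ∈ Λ, Bornology.IsBounded (J τ)) (hJn : ∀ τ ∈ Λ, (J τ).Nonempty)
    (hdisj : ∀ τ₁ ∈ Λ, ∀ τ₂ ∈ Λ, τ₁ ≠ τ₂ → Disjoint (J τ₁) (J τ₂))
    (hsum : ∑ τ ∈ Λ, μ.real (J τ) = 1) (B : ℝ)
    (hB : ∀ τ ∈ Λ, μ.real (J τ) * diam (J τ) ^ r ≤ B) (n : ℕ) (hn : Λ.card ≤ n) :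
    quantError μ r n ≤ (Λ.card * B) ^ (1 / r) := by
  classical
  have hne : Λ.Nonempty := by
    by_contra h
    rw [Finset.not_nonempty_iff_eq_empty] at h
    simp [h] at hsum
  have hex : ∀ τ, ∃ x : E, τ ∈ Λ → x ∈ J τ := by
    intro τ
    obtain ⟨τ0, h0⟩ := hne
    by_cases h : τ ∈ Λ
    · obtain ⟨x, hx⟩ := hJn τ h
      exact ⟨x, fun _ => hx⟩
    · exact ⟨(hJn τ0 h0).some, fun h' => absurd h' h⟩
  choose a ha using hex
  refine (csInf_le (quant_bddBelow μ r n) ⟨Λ.image a, ?_, ?_, rfl⟩).trans ?_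
  · exact Finset.card_pos.mpr (hne.image a)
  · exact Finset.card_image_le.trans hn
  apply Real.rpow_le_rpow (integral_nonneg (fun x => Real.rpow_nonneg infDist_nonneg _)) _
    (by positivity)
  have hU : μ.real (⋃ τ ∈ Λ, J τ) = 1 := by
    rw [measureReal_biUnion_finset (fun i hi j hj hij => hdisj i hi j hj hij) hJm]
    exact hsum
  have hUm : MeasurableSet (⋃ τ ∈ Λ, J τ) := Finset.measurableSet_biUnion Λ hJm
  have hUae : ∀ᵐ x ∂μ, x ∈ ⋃ τ ∈ Λ, J τ := by
    have : μ (⋃ τ ∈ Λ, J τ) = 1 := by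
      rw [measureReal_def] at hU
      rw [← ENNReal.ofReal_toReal (measure_ne_top μ (⋃ τ ∈ Λ, J τ)), hU, ENNReal.ofReal_one]
    exact (mem_ae_iff_prob_eq_one hUm).mpr this
  calc ∫ x, infDist x (↑(Λ.image a) : Set E) ^ r ∂μ
      ≤ ∫ x, ∑ τ ∈ Λ, (J τ).indicator (fun _ => diam (J τ) ^ r) x ∂μ := by
        apply integral_mono_of_nonneg
        · exact Eventually.of_forall (fun x => Real.rpow_nonneg infDist_nonneg _)
        · exact integrable_finsetSum _ (fun τ hτ => (integrable_const _).indicator (hJm τ hτ))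
        · filter_upwards [hUae] with x hx
          simp only [Set.mem_iUnion] at hx
          obtain ⟨τ, hτ, hx⟩ := hx
          have nn : ∀ τ' ∈ Λ, 0 ≤ (J τ').indicator (fun _ => diam (J τ') ^ r) x :=
            fun τ' _ => Set.indicator_nonneg (fun _ _ => Real.rpow_nonneg diam_nonneg _) _
          refine le_trans ?_ (Finset.single_le_sum nn hτ)
          rw [Set.indicator_of_mem hx]
          apply Real.rpow_le_rpow infDist_nonneg _ hr.le
          refine (infDist_le_dist_of_mem (y := a τ) ?_).trans
            (dist_le_diam_of_mem (hJb τ hτ) hx (ha τ hτ))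
          exact_mod_cast Finset.mem_image_of_mem a hτ
    _ = ∑ τ ∈ Λ, μ.real (J τ) * diam (J τ) ^ r := by
        rw [integral_finsetSum _ (fun τ hτ => (integrable_const _).indicator (hJm τ hτ))]
        apply Finset.sum_congr rfl
        intro τ hτ
        rw [integral_indicator_const _ (hJm τ hτ), smul_eq_mul]
    _ ≤ Λ.card * B := by
        rw [← nsmul_eq_mul]
        exact Finset.sum_le_card_nsmul _ _ _ hB

lemma quant_lower {E : Type*} [MetricSpace E] [MeasurableSpace E] [BorelSpace E]
    (μ : Measure E) [IsProbabilityMeasure μ] (r : ℝ) (hr : 0 < r) {ι : Type*}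
    (K : Set E) (hK : IsCompact K) (hKn : K.Nonempty) (hμK : μ K = 1)
    (Λ : Finset ι) (J : ι → Set E) (hJm : ∀ τ ∈ Λ, MeasurableSet (J τ)) (β : ℝ) (hβ : 0 < β)
    (hd : ∀ τ ∈ Λ, 0 < diam (J τ))
    (hsep : ∀ τ₁ ∈ Λ, ∀ τ₂ ∈ Λ, τ₁ ≠ τ₂ → ∀ x ∈ J τ₁, ∀ y ∈ J τ₂,
          β * max (diam (J τ₁)) (diam (J τ₂)) ≤ dist x y)
    (A : ℝ) (hA0 : 0 ≤ A)
    (hA : ∀ τ ∈ Λ, A ≤ μ.real (J τ) * (β / 2 * diam (J τ)) ^ r) (n : ℕ) (hn1 : 1 ≤ n)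
    (hn : 2 * n ≤ Λ.card) :
    (n * A) ^ (1 / r) ≤ quantError μ r n := by
  classical
  have hdisj := sep_disjoint Λ J β hβ hd hsep
  apply le_csInf
  · obtain ⟨x, _⟩ := hKn
    exact ⟨_, {x}, by simp, by simpa using hn1, rfl⟩
  rintro _ ⟨α, hα1, hαn, rfl⟩
  apply Real.rpow_le_rpow (by positivity) _ (by positivity)
  have hαne : (α : Set E).Nonempty := by exact_mod_cast Finset.card_pos.mp hα1
  have hcont : Continuous (fun x => infDist x (α : Set E) ^ r) :=
    (continuous_infDist_pt _).rpow_const (fun _ => Or.inr hr.le)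
  have hint : Integrable (fun x => infDist x (α : Set E) ^ r) μ := by
    obtain ⟨C, hC⟩ := hK.exists_bound_of_continuousOn hcont.continuousOn
    refine Integrable.of_bound hcont.aestronglyMeasurable C ?_
    have : ∀ᵐ x ∂μ, x ∈ K := (mem_ae_iff_prob_eq_one hK.measurableSet).mpr hμK
    filter_upwards [this] with x hx using hC x hx
  -- bad words: those with a point of α close to the cylinder
  set bad := Λ.filter (fun τ => ∃ a ∈ α, ∃ y ∈ J τ, dist y a < β / 2 * diam (J τ)) with hbad
  have hbadcard : bad.card ≤ n := by
    refine le_trans ?_ hαn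
    have hex : ∀ τ ∈ bad, ∃ a ∈ α, ∃ y ∈ J τ, dist y a < β / 2 * diam (J τ) :=
      fun τ hτ => (Finset.mem_filter.mp hτ).2
    have : Nonempty E := ⟨hKn.some⟩
    choose! a ha y hy hya using hex
    apply Finset.card_le_card_of_injOn a (fun τ hτ => ha τ hτ)
    intro τ₁ h₁ τ₂ h₂ h12
    by_contra hne
    have q1 := hya τ₁ h₁
    have q2 := hya τ₂ h₂
    rw [← h12] at q2
    have q3 := hsep τ₁ (Finset.mem_filter.mp h₁).1 τ₂ (Finset.mem_filter.mp h₂).1 hne _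
      (hy τ₁ h₁) _ (hy τ₂ h₂)
    have q4 := dist_triangle_right (y τ₁) (y τ₂) (a τ₁)
    have m1 := mul_le_mul_of_nonneg_left (le_max_left (diam (J τ₁)) (diam (J τ₂))) hβ.le
    have m2 := mul_le_mul_of_nonneg_left (le_max_right (diam (J τ₁)) (diam (J τ₂))) hβ.le
    linarith
  have hgoodcard : n ≤ (Λ \ bad).card := by
    have h1 := Finset.card_sdiff_add_card_eq_card (s := bad) (t := Λ) (Finset.filter_subset _ _)
    omega
  have hgm : ∀ τ ∈ Λ \ bad, MeasurableSet (J τ) := fun τ hτ => hJm τ (Finset.mem_sdiff.mp hτ).1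
  calc (n : ℝ) * A ≤ (Λ \ bad).card * A := by gcongr
    _ ≤ ∑ τ ∈ Λ \ bad, μ.real (J τ) * (β / 2 * diam (J τ)) ^ r := by
        rw [← nsmul_eq_mul]
        exact Finset.card_nsmul_le_sum _ _ _ (fun τ hτ => hA τ (Finset.mem_sdiff.mp hτ).1)
    _ ≤ ∑ τ ∈ Λ \ bad, ∫ x in J τ, infDist x (α : Set E) ^ r ∂μ := by
        apply Finset.sum_le_sum
        intro τ hτ
        rw [← smul_eq_mul, ← setIntegral_const]
        apply setIntegral_mono_on (integrableOn_const) hint.integrableOn (hgm τ hτ)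
        intro x hx
        have dp := hd τ (Finset.mem_sdiff.mp hτ).1
        apply Real.rpow_le_rpow (by positivity) _ hr.le
        rw [le_infDist hαne]
        intro a ha
        by_contra hlt
        apply (Finset.mem_sdiff.mp hτ).2
        exact Finset.mem_filter.mpr ⟨(Finset.mem_sdiff.mp hτ).1, a, by exact_mod_cast ha, x, hx,
          not_le.mp hlt⟩
    _ = ∫ x in ⋃ τ ∈ Λ \ bad, J τ, infDist x (α : Set E) ^ r ∂μ := by
        rw [integral_biUnion_finset _ hgm _ (fun τ _ => hint.integrableOn)]
        intro i hi j hj hij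
        exact hdisj i (Finset.mem_sdiff.mp hi).1 j (Finset.mem_sdiff.mp hj).1 hij
    _ ≤ ∫ x, infDist x (α : Set E) ^ r ∂μ :=
        setIntegral_le_integral hint
          (Eventually.of_forall (fun x => Real.rpow_nonneg infDist_nonneg _))

lemma wt_pos {m : ℕ} {N : Fin m → ℕ} {ω : ℕ → Fin m} {f : Fin m → ℕ → ℝ}
    (hf : ∀ i, ∀ j < N i, 0 < f i j) : ∀ σ, ValidWord N ω σ → 0 < wt f ω σ := by
  apply valid_ind
  · rw [wt_nil]; exact one_pos
  · intro σ _ ih j hj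
    rw [wt_snoc]
    exact mul_pos ih (hf _ _ hj)

/-- bounds for the auxiliary product probability in terms of `h` -/
lemma nu_bound {m : ℕ} {N : Fin m → ℕ} {ω : ℕ → Fin m} {h : Fin m → ℕ → ℝ}
    (χ : Fin m → ℝ) (t q : ℝ) (hh : ∀ i, ∀ j < N i, 0 < h i j) (hq0 : 0 < q) (hq1 : q < 1)
    (hq : ∀ i, ∀ j < N i, h i j ≤ q) (F : Fin m → ℝ) (hF : ∀ i, 0 < F i)
    (hωG : ∀ i, Tendsto (fun k => (freqCount ω k i : ℝ) / (k : ℝ)) atTop (nhds (χ i)))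
    (h1 : ∏ i, F i ^ χ i = 1) (δ : ℝ) (hδ : 0 < δ) :
    ∃ C : ℝ, ∀ σ, ValidWord N ω σ →
      (t + δ) * Real.log (wt h ω σ) - C ≤ Real.log (wt (fun i j => h i j ^ t / F i) ω σ) ∧
      Real.log (wt (fun i j => h i j ^ t / F i) ω σ) ≤ (t - δ) * Real.log (wt h ω σ) + C := by
  have lq : Real.log q < 0 := Real.log_neg hq0 hq1
  obtain ⟨C, hC⟩ := log_prod_bound ω χ F hF hωG h1 (δ * (-Real.log q))
    (mul_pos hδ (by linarith))
  refine ⟨C, fun σ hσ => ?_⟩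
  have e1 : ∀ σ, ValidWord N ω σ → Real.log (wt (fun i j => h i j ^ t / F i) ω σ)
      = t * Real.log (wt h ω σ) - ∑ l ∈ Finset.range σ.length, Real.log (F (ω l)) := by
    apply valid_ind
    · simp [wt_nil]
    · intro σ hv ih j hj
      have p1 : 0 < h (ω σ.length) j ^ t := Real.rpow_pos_of_pos (hh _ _ hj) _
      have p2 : 0 < wt (fun i j => h i j ^ t / F i) ω σ :=
        wt_pos (N := N) (fun i j hj => div_pos (Real.rpow_pos_of_pos (hh _ _ hj) _) (hF i)) σ hv
      rw [wt_snoc, wt_snoc, Real.log_mul p2.ne' (div_pos p1 (hF _)).ne',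
        Real.log_mul (wt_pos hh σ hv).ne' (hh _ _ hj).ne', ih, Real.log_div p1.ne' (hF _).ne',
        Real.log_rpow (hh _ _ hj), List.length_append, List.length_singleton,
        Finset.sum_range_succ]
      ring
  have e2 : ∀ σ, ValidWord N ω σ → Real.log (wt h ω σ) ≤ σ.length * Real.log q := by
    apply valid_ind
    · simp [wt_nil]
    · intro σ hv ih j hj
      rw [wt_snoc, Real.log_mul (wt_pos hh σ hv).ne' (hh _ _ hj).ne']
      have := Real.log_le_log (hh _ _ hj) (hq _ _ hj)
      push_cast [List.length_append, List.length_singleton]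
      linarith
  have a1 := e1 σ hσ
  have a2 := mul_le_mul_of_nonneg_left (e2 σ hσ) hδ.le
  have a3 := abs_le.mp (hC σ.length)
  constructor
  · rw [a1]; linarith [a3.2]
  · rw [a1]; linarith [a3.1]

/-- for a multiscale Moran measure `μ_ω` with `ω ∈ G(χ)`, the quantization
dimension of order `r` exists and equals the unique `s_r > 0` with
`Π_i (Σ_j (p_{ij} g_{ij}^r)^{s_r/(s_r+r)})^{χ_i} = 1`; in particular it is independent of
`ω ∈ G(χ)`. -/
theorem quantDim_multiscale_moran
    (d m : ℕ) (hm : 2 ≤ m)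
    (N : Fin m → ℕ) (hN : ∀ i, 2 ≤ N i)
    (g : Fin m → ℕ → ℝ) (hg : ∀ i, ∀ j < N i, 0 < g i j ∧ g i j < 1)
    (p : Fin m → ℕ → ℝ) (hp : ∀ i, ∀ j < N i, 0 < p i j)
    (hp1 : ∀ i, ∑ j ∈ Finset.range (N i), p i j = 1)
    (χ : Fin m → ℝ) (hχ : ∀ i, 0 < χ i) (hχ1 : ∑ i, χ i = 1)
    (ω : ℕ → Fin m)
    (hωG : ∀ i, Tendsto (fun k => (freqCount ω k i : ℝ) / (k : ℝ)) atTop (nhds (χ i)))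
    (J : List ℕ → Set (EuclideanSpace ℝ (Fin d)))
    (hJ0 : IsCompact (J []) ∧ (J []).Nonempty ∧ J [] = closure (interior (J [])))
    (hJsub : ∀ σ : List ℕ, ValidWord N ω σ → ∀ j < N (ω σ.length), J (σ ++ [j]) ⊆ J σ)
    (hJsim : ∀ σ : List ℕ, ValidWord N ω σ → ∀ j < N (ω σ.length),
      ∃ S : EuclideanSpace ℝ (Fin d) → EuclideanSpace ℝ (Fin d),
        (∀ x y, dist (S x) (S y) = g (ω σ.length) j * dist x y) ∧ S '' J σ = J (σ ++ [j]))
    (hsep : ∃ β : ℝ, 0 < β ∧ β < 1 ∧ ∀ σ : List ℕ, ValidWord N ω σ →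
      ∀ j₁ j₂ : ℕ, j₁ < N (ω σ.length) → j₂ < N (ω σ.length) → j₁ ≠ j₂ →
      ∀ x ∈ J (σ ++ [j₁]), ∀ y ∈ J (σ ++ [j₂]),
        β * max (diam (J (σ ++ [j₁]))) (diam (J (σ ++ [j₂]))) ≤ dist x y)
    (μ : Measure (EuclideanSpace ℝ (Fin d))) [IsProbabilityMeasure μ]
    (hμ : ∀ σ : List ℕ, ValidWord N ω σ →
      μ (J σ) = ENNReal.ofReal (∏ l : Fin σ.length, p (ω l) (σ.get l)))
    (r sr : ℝ) (hr : 0 < r) (hsr : 0 < sr)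
    (hsreq : ∏ i, (∑ j ∈ Finset.range (N i), (p i j * g i j ^ r) ^ (sr / (sr + r))) ^ (χ i) = 1)
    :
    upperQuantDim μ r = sr ∧ lowerQuantDim μ r = sr := by
  obtain ⟨β, hβ0, hβ1, hsep⟩ := hsep
  obtain ⟨hJc, hJne, hJi⟩ := hJ0
  -- basic geometry
  have hgpos : ∀ i, ∀ j < N i, 0 < g i j := fun i j hj => (hg i j hj).1
  have hgeo : ∀ σ, ValidWord N ω σ → IsCompact (J σ) ∧ (J σ).Nonempty ∧
      diam (J σ) = wt g ω σ * diam (J []) := by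
    apply valid_ind
    · exact ⟨hJc, hJne, by rw [wt_nil, one_mul]⟩
    · rintro σ hv ⟨i1, i2, i3⟩ j hj
      obtain ⟨S, hS, hSJ⟩ := hJsim σ hv j hj
      have hScont : Continuous S := by
        apply (LipschitzWith.of_dist_le_mul (K := ⟨g (ω σ.length) j, (hgpos _ _ hj).le⟩) ?_).continuous
        intro x y
        exact (hS x y).le
      have hc := i1.image hScont
      refine ⟨hSJ ▸ hc, hSJ ▸ i2.image S, ?_⟩
      rw [← hSJ, diam_sim S _ (hgpos _ _ hj) hS _ i1.isBounded hc.isBounded, i3, wt_snoc]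
      ring
  have hμr : ∀ σ, ValidWord N ω σ → μ.real (J σ) = wt p ω σ := by
    intro σ hv
    rw [measureReal_def, hμ σ hv, wt_eq, ENNReal.toReal_ofReal (wt_pos hp σ hv).le]
  have hple : ∀ i, ∀ j < N i, p i j ≤ 1 := by
    intro i j hj
    rw [← hp1 i]
    exact Finset.single_le_sum (fun j hj => (hp i j (Finset.mem_range.mp hj)).le)
      (Finset.mem_range.mpr hj)
  -- the diameter is positive
  have hD : 0 < diam (J []) := by
    rcases (diam_nonneg (s := J [])).lt_or_eq with h | h
    · exact h
    exfalso
    have hlt : μ.real (J ([] ++ [0])) < 1 := by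
      have h0 : 0 < N (ω 0) := by have := hN (ω 0); omega
      have hv0 : ValidWord N ω ([] ++ [0]) := valid_snoc.mpr ⟨valid_nil N ω, h0⟩
      rw [hμr _ hv0, wt_snoc, wt_nil, one_mul]
      have hsub : Finset.range 2 ⊆ Finset.range (N (ω 0)) := by
        intro x hx
        have := hN (ω 0)
        rw [Finset.mem_range] at hx ⊢
        omega
      have := Finset.sum_le_sum_of_subset_of_nonneg (f := p (ω 0)) hsub
        (fun j hj _ => (hp _ j (Finset.mem_range.mp hj)).le)
      rw [hp1, Finset.sum_range_succ, Finset.sum_range_one] at this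
      have h2 := hp (ω 0) 1 (by have := hN (ω 0); omega)
      simp only [List.length_nil]
      linarith
    have hsame : J [] ⊆ J ([] ++ [0]) := by
      have h0 : 0 < N (ω 0) := by have := hN (ω 0); omega
      have hv0 : ValidWord N ω ([] ++ [0]) := valid_snoc.mpr ⟨valid_nil N ω, h0⟩
      obtain ⟨y, hy⟩ := (hgeo _ hv0).2.1
      intro x hx
      have hy' := hJsub [] (valid_nil N ω) 0 h0 hy
      have := dist_le_diam_of_mem hJc.isBounded hx hy'
      rw [← h] at this
      rw [dist_le_zero.mp this]
      exact hy
    have h1 := measureReal_mono (μ := μ) hsame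
    rw [hμr [] (valid_nil N ω), wt_nil] at h1
    linarith
  -- the weights
  set h : Fin m → ℕ → ℝ := fun i j => p i j * g i j ^ r with hdef
  have hh : ∀ i, ∀ j < N i, 0 < h i j := fun i j hj =>
    mul_pos (hp i j hj) (Real.rpow_pos_of_pos (hgpos i j hj) _)
  have hh1 : ∀ i, ∀ j < N i, h i j < 1 := by
    intro i j hj
    have := Real.rpow_lt_one (hgpos i j hj).le (hg i j hj).2 hr
    have h0 := Real.rpow_pos_of_pos (hgpos i j hj) r
    calc p i j * g i j ^ r ≤ 1 * g i j ^ r := by gcongr; exact hple i j hj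
      _ < 1 := by linarith
  have hwt : ∀ σ, ValidWord N ω σ → wt h ω σ = wt p ω σ * wt g ω σ ^ r := by
    apply valid_ind
    · simp [wt_nil]
    · intro σ hv ih j hj
      rw [wt_snoc, wt_snoc, wt_snoc, ih, Real.mul_rpow (wt_pos hgpos σ hv).le (hgpos _ _ hj).le]
      simp only [hdef]
      ring
  let idx : Finset (Σ _ : Fin m, ℕ) := Finset.univ.sigma (fun i => Finset.range (N i))
  have hidx : idx.Nonempty := by
    refine ⟨⟨ω 0, 0⟩, ?_⟩
    have := hN (ω 0)
    simp only [idx, Finset.mem_sigma, Finset.mem_univ, Finset.mem_range, true_and]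
    omega
  have hmem : ∀ i, ∀ j < N i, (⟨i, j⟩ : Σ _ : Fin m, ℕ) ∈ idx := by
    intro i j hj
    simp only [idx, Finset.mem_sigma, Finset.mem_univ, Finset.mem_range, true_and]
    exact hj
  have hmem' : ∀ x ∈ idx, x.2 < N x.1 := by
    intro x hx
    simpa only [idx, Finset.mem_sigma, Finset.mem_univ, Finset.mem_range, true_and] using hx
  obtain ⟨xc, hxc, hcmin⟩ := idx.exists_min_image (fun x => h x.1 x.2) hidx
  obtain ⟨xq, hxq, hqmax⟩ := idx.exists_max_image (fun x => h x.1 x.2) hidx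
  obtain ⟨c, hcdef⟩ : ∃ c, c = h xc.1 xc.2 := ⟨_, rfl⟩
  obtain ⟨q, hqdef⟩ : ∃ q, q = h xq.1 xq.2 := ⟨_, rfl⟩
  have hc0 : 0 < c := hcdef ▸ hh _ _ (hmem' _ hxc)
  have hc1 : c < 1 := hcdef ▸ hh1 _ _ (hmem' _ hxc)
  have hq0 : 0 < q := hqdef ▸ hh _ _ (hmem' _ hxq)
  have hq1 : q < 1 := hqdef ▸ hh1 _ _ (hmem' _ hxq)
  have hc : ∀ i, ∀ j < N i, c ≤ h i j := fun i j hj => hcdef ▸ hcmin _ (hmem i j hj)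
  have hq : ∀ i, ∀ j < N i, h i j ≤ q := fun i j hj => hqdef ▸ hqmax _ (hmem i j hj)
  obtain ⟨t, ht⟩ : ∃ t, t = sr / (sr + r) := ⟨_, rfl⟩
  rw [← ht] at hsreq
  have ht0 : 0 < t := by rw [ht]; positivity
  set F : Fin m → ℝ := fun i => ∑ j ∈ Finset.range (N i), h i j ^ t with hFdef
  have hF : ∀ i, 0 < F i := by
    intro i
    apply Finset.sum_pos
    · intro j hj
      exact Real.rpow_pos_of_pos (hh i j (Finset.mem_range.mp hj)) _
    · exact ⟨0, Finset.mem_range.mpr (by have := hN i; omega)⟩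
  have hFprod : ∏ i, F i ^ χ i = 1 := hsreq
  set ν : Fin m → ℕ → ℝ := fun i j => h i j ^ t / F i with hνdef
  have hνsum : ∀ i, ∑ j ∈ Finset.range (N i), ν i j = 1 := by
    intro i
    simp only [hνdef]
    rw [← Finset.sum_div]
    exact div_self (hF i).ne'
  have hνpos : ∀ σ, ValidWord N ω σ → 0 < wt ν ω σ :=
    wt_pos (fun i j hj => div_pos (Real.rpow_pos_of_pos (hh i j hj) _) (hF i))
  have hlim : Tendsto (fun n : ℕ => Real.log n / (- Real.log (quantError μ r n))) atTop
      (nhds sr) := by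
    apply final_limit _ r sr t hr hsr ht
    intro δ hδ hδt
    obtain ⟨C, hC⟩ := nu_bound χ t q hh hq0 hq1 hq F hF hωG hFprod δ hδ
    have hcut : ∀ x : ℝ, 0 ≤ x → ∃ Λ : Finset (List ℕ),
        (∀ τ ∈ Λ, ValidWord N ω τ ∧ c * Real.exp (-x) ≤ wt h ω τ ∧ wt h ω τ < Real.exp (-x)) ∧
        (∀ τ₁ ∈ Λ, ∀ τ₂ ∈ Λ, τ₁ ≠ τ₂ → ∀ x ∈ J τ₁, ∀ y ∈ J τ₂,
          β * max (diam (J τ₁)) (diam (J τ₂)) ≤ dist x y) ∧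
        ∑ τ ∈ Λ, μ.real (J τ) = 1 ∧ 0 < (Λ.card : ℝ) ∧
        Real.log Λ.card ≤ (t + δ) * x + (C - (t + δ) * Real.log c) ∧
        (t - δ) * x - C ≤ Real.log Λ.card := by
      intro x hx
      obtain ⟨k, hk⟩ := exists_pow_lt_of_lt_one (Real.exp_pos (-x)) hq1
      have hex1 : Real.exp (-x) ≤ 1 := Real.exp_le_one_iff.mpr (by linarith)
      obtain ⟨Λ, h1, h2, h3⟩ := exists_cut N ω h c q (Real.exp (-x)) β hc0 (Real.exp_pos _) hq0.le
        hβ0.le hc hq J hJsub (fun σ hv => (hgeo σ hv).1.isBounded) hsep k [] (valid_nil N ω)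
        (by rw [wt_nil]; nlinarith [Real.exp_pos (-x)]) (by rw [wt_nil, mul_one]; exact hk)
      have hps : ∑ τ ∈ Λ, μ.real (J τ) = 1 := by
        rw [Finset.sum_congr rfl (fun τ hτ => hμr τ (h1 τ hτ).1), h3 p hp1, wt_nil]
      have hνs : ∑ τ ∈ Λ, wt ν ω τ = 1 := by rw [h3 ν hνsum, wt_nil]
      have hcard : 0 < (Λ.card : ℝ) := by
        have : Λ.Nonempty := by
          by_contra hne
          rw [Finset.not_nonempty_iff_eq_empty] at hne
          simp [hne] at hνs
        exact_mod_cast Finset.card_pos.mpr this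
      refine ⟨Λ, fun τ hτ => ⟨(h1 τ hτ).1, (h1 τ hτ).2.2.2⟩, h2, hps, hcard, ?_, ?_⟩
      · have hlow : ∀ τ ∈ Λ, Real.exp ((t + δ) * (Real.log c - x) - C) ≤ wt ν ω τ := by
          intro τ hτ
          obtain ⟨hv, _, _, b1, b2⟩ := h1 τ hτ
          rw [← Real.le_log_iff_exp_le (hνpos τ hv)]
          refine le_trans ?_ (hC τ hv).1
          have := Real.log_le_log (mul_pos hc0 (Real.exp_pos _)) b1
          rw [Real.log_mul hc0.ne' (Real.exp_pos _).ne', Real.log_exp] at this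
          have := mul_le_mul_of_nonneg_left this (by linarith : 0 ≤ t + δ)
          linarith
        have := Finset.card_nsmul_le_sum Λ _ _ hlow
        rw [hνs, nsmul_eq_mul] at this
        have := Real.log_le_log (mul_pos hcard (Real.exp_pos _)) this
        rw [Real.log_mul hcard.ne' (Real.exp_pos _).ne', Real.log_exp, Real.log_one] at this
        linarith
      · have hup : ∀ τ ∈ Λ, wt ν ω τ ≤ Real.exp ((t - δ) * (-x) + C) := by
          intro τ hτ
          obtain ⟨hv, _, _, b1, b2⟩ := h1 τ hτ
          rw [← Real.log_le_iff_le_exp (hνpos τ hv)]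
          refine (hC τ hv).2.trans ?_
          have := Real.log_le_log (wt_pos hh τ hv) b2.le
          rw [Real.log_exp] at this
          have := mul_le_mul_of_nonneg_left this (by linarith : 0 ≤ t - δ)
          linarith
        have := Finset.sum_le_card_nsmul Λ _ _ hup
        rw [hνs, nsmul_eq_mul] at this
        have := Real.log_le_log one_pos this
        rw [Real.log_mul hcard.ne' (Real.exp_pos _).ne', Real.log_exp, Real.log_one] at this
        linarith
    have hdpos : ∀ τ, ValidWord N ω τ → 0 < diam (J τ) := by
      intro τ hv
      rw [(hgeo τ hv).2.2]
      exact mul_pos (wt_pos hgpos τ hv) hD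
    have hDr : 0 < diam (J []) ^ r := Real.rpow_pos_of_pos hD r
    have hmass : ∀ τ, ValidWord N ω τ →
        μ.real (J τ) * diam (J τ) ^ r = wt h ω τ * diam (J []) ^ r := by
      intro τ hv
      rw [hμr τ hv, (hgeo τ hv).2.2, Real.mul_rpow (wt_pos hgpos τ hv).le hD.le, hwt τ hv]
      ring
    -- lower bound for the error
    have hlower : ∃ K : ℝ, ∀ᶠ n : ℕ in atTop, 0 < quantError μ r n ∧
        r * (-Real.log (quantError μ r n)) ≤ (1 / (t - δ) - 1) * Real.log n + K := by
      have htd : 0 < t - δ := by linarith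
      have hb2 : 0 < (β / 2) ^ r := Real.rpow_pos_of_pos (by linarith) r
      have hB0 : 0 < (β / 2) ^ r * diam (J []) ^ r * c := by positivity
      refine ⟨(Real.log 2 + C) / (t - δ) - Real.log ((β / 2) ^ r * diam (J []) ^ r * c), ?_⟩
      have hlog : Tendsto (fun n : ℕ => Real.log n) atTop atTop :=
        Real.tendsto_log_atTop.comp tendsto_natCast_atTop_atTop
      filter_upwards [hlog.eventually_ge_atTop (-(Real.log 2 + C)), eventually_ge_atTop 1]
        with n hn hn1
      have hn0 : (0 : ℝ) < n := by exact_mod_cast hn1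
      obtain ⟨x, hx⟩ : ∃ x, x = (Real.log n + (Real.log 2 + C)) / (t - δ) := ⟨_, rfl⟩
      have hx0 : 0 ≤ x := by rw [hx]; exact div_nonneg (by linarith) htd.le
      obtain ⟨Λ, h1, h2, h3, h4, h5, h6⟩ := hcut x hx0
      have hxx : (t - δ) * x = Real.log n + (Real.log 2 + C) := by
        rw [hx]; field_simp
      have hcard : 2 * n ≤ Λ.card := by
        have : Real.log (2 * n) ≤ Real.log Λ.card := by
          rw [Real.log_mul two_ne_zero hn0.ne']; linarith
        have := (Real.log_le_log_iff (by positivity) h4).mp this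
        exact_mod_cast this
      have hA0 : 0 < (β / 2) ^ r * diam (J []) ^ r * c * Real.exp (-x) :=
        mul_pos hB0 (Real.exp_pos _)
      have hμK : μ (J []) = 1 := by
        rw [hμ [] (valid_nil N ω), wt_eq, wt_nil, ENNReal.ofReal_one]
      have hq := quant_lower μ r hr (J []) hJc hJne hμK Λ J
        (fun τ hτ => (hgeo τ (h1 τ hτ).1).1.measurableSet) β hβ0
        (fun τ hτ => hdpos τ (h1 τ hτ).1) h2 _ hA0.le (by
          intro τ hτ
          obtain ⟨hv, b1, _⟩ := h1 τ hτ
          rw [Real.mul_rpow (by linarith) diam_nonneg]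
          calc (β / 2) ^ r * diam (J []) ^ r * c * Real.exp (-x)
              = (β / 2) ^ r * (c * Real.exp (-x) * diam (J []) ^ r) := by ring
            _ ≤ (β / 2) ^ r * (wt h ω τ * diam (J []) ^ r) := by gcongr
            _ = μ.real (J τ) * ((β / 2) ^ r * diam (J τ) ^ r) := by rw [← hmass τ hv]; ring)
        n hn1 hcard
      have hpos := Real.rpow_pos_of_pos (mul_pos hn0 hA0) (1 / r)
      refine ⟨hpos.trans_le hq, ?_⟩
      have := Real.log_le_log hpos hq
      rw [Real.log_rpow (mul_pos hn0 hA0), Real.log_mul hn0.ne' hA0.ne',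
        Real.log_mul hB0.ne' (Real.exp_pos _).ne', Real.log_exp, one_div, inv_mul_le_iff₀ hr] at this
      have e : (1 / (t - δ) - 1) * Real.log n + ((Real.log 2 + C) / (t - δ) -
          Real.log ((β / 2) ^ r * diam (J []) ^ r * c)) = x - Real.log n -
          Real.log ((β / 2) ^ r * diam (J []) ^ r * c) := by
        rw [hx]; ring
      rw [e]
      linarith
    have hupper : ∃ K : ℝ, ∀ᶠ n : ℕ in atTop, 0 < quantError μ r n →
        (1 / (t + δ) - 1) * Real.log n - K ≤ r * (-Real.log (quantError μ r n)) := by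
      have htd : 0 < t + δ := by linarith
      obtain ⟨C1, hC1⟩ : ∃ C1, C1 = C - (t + δ) * Real.log c := ⟨_, rfl⟩
      refine ⟨C1 / (t + δ) + Real.log (diam (J []) ^ r), ?_⟩
      have hlog : Tendsto (fun n : ℕ => Real.log n) atTop atTop :=
        Real.tendsto_log_atTop.comp tendsto_natCast_atTop_atTop
      filter_upwards [hlog.eventually_ge_atTop C1, eventually_ge_atTop 1] with n hn hn1 hqp
      have hn0 : (0 : ℝ) < n := by exact_mod_cast hn1
      obtain ⟨x, hx⟩ : ∃ x, x = (Real.log n - C1) / (t + δ) := ⟨_, rfl⟩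
      have hx0 : 0 ≤ x := by rw [hx]; exact div_nonneg (by linarith) htd.le
      obtain ⟨Λ, h1, h2, h3, h4, h5, h6⟩ := hcut x hx0
      have hxx : (t + δ) * x = Real.log n - C1 := by
        rw [hx]; field_simp
      have hcard : Λ.card ≤ n := by
        have : Real.log Λ.card ≤ Real.log n := by linarith
        exact_mod_cast (Real.log_le_log_iff h4 hn0).mp this
      have hq := quant_upper μ r hr Λ J (fun τ hτ => (hgeo τ (h1 τ hτ).1).1.measurableSet)
        (fun τ hτ => (hgeo τ (h1 τ hτ).1).1.isBounded) (fun τ hτ => (hgeo τ (h1 τ hτ).1).2.1)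
        (sep_disjoint Λ J β hβ0 (fun τ hτ => hdpos τ (h1 τ hτ).1) h2) h3
        (Real.exp (-x) * diam (J []) ^ r) (by
          intro τ hτ
          obtain ⟨hv, _, b2⟩ := h1 τ hτ
          rw [hmass τ hv]
          gcongr) n hcard
      have hB : 0 < Real.exp (-x) * diam (J []) ^ r := mul_pos (Real.exp_pos _) hDr
      have hq2 : quantError μ r n ≤ (n * (Real.exp (-x) * diam (J []) ^ r)) ^ (1 / r) := by
        refine hq.trans ?_
        apply Real.rpow_le_rpow (mul_nonneg h4.le hB.le) _ (one_div_pos.mpr hr).le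
        exact mul_le_mul_of_nonneg_right (Nat.cast_le.mpr hcard) hB.le
      have := Real.log_le_log hqp hq2
      rw [Real.log_rpow (mul_pos hn0 hB), Real.log_mul hn0.ne' hB.ne',
        Real.log_mul (Real.exp_pos _).ne' hDr.ne', Real.log_exp, one_div, le_inv_mul_iff₀ hr] at this
      have e : (1 / (t + δ) - 1) * Real.log n - (C1 / (t + δ) + Real.log (diam (J []) ^ r))
          = x - Real.log n - Real.log (diam (J []) ^ r) := by
        rw [hx]; ring
      rw [e]
      linarith
    obtain ⟨K1, hK1⟩ := hlower
    obtain ⟨K2, hK2⟩ := hupper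
    refine ⟨max K1 K2, ?_⟩
    filter_upwards [hK1, hK2] with n a1 a2
    have a3 := a2 a1.1
    have := le_max_left K1 K2
    have := le_max_right K1 K2
    exact ⟨by linarith, by linarith [a1.2]⟩
  exact ⟨hlim.limsup_eq, hlim.liminf_eq⟩
end
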